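/- There exist absolute constants ĉ₁, ĉ₂, ĉ₃, ĉ₄, ĉ₅, ĉ₆, ĉ₇ > 0 and C > 0 with the following property (third phase / local convergence). Assume 𝒜 satisfies the RIP of order 2r+1 with constant δ < ĉ₁/(κ³√r) and that μ ≤ ĉ₂/(κ⁴‖X‖). Suppose there exist a natural number t₂ and a positive real number γ with γ ≤ ĉ₃ · min{√(σ_min(X))/κ^{9/2}, √‖X‖/k^{4/3}} such that at iteration t₂: σ_min(L_XᵀZ_{t₂}) ≥ √(σ_min(X)/8); ‖Z_{t₂}Q_{t₂,⊥}‖ ≤ γ; ‖L_{X,⊥}ᵀP_{Z_{t₂}Q_{t₂}}‖ ≤ ĉ₄/κ²; ‖Z_{t₂}‖ ≤ 2√‖X‖; ‖Z̃_{t₂}ᵀZ_{t₂}Q_{t₂,⊥}‖ ≤ (ĉ₄ĉ₅√‖X‖/κ³)·γ; ‖Z̃_{t₂}ᵀP_{Z_{t₂}Q_{t₂}}‖ ≤ ĉ₄ĉ₆√‖X‖/κ³; and moreover ‖Z̃_{t₂}ᵀZ_{t₂}‖ + 120000μ·ln(9√‖X‖/(200kγ))·‖X‖³/σ_min(X) ≤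 (ĉ₇/κ⁴)‖X‖. Then there exists a natural number t₃ ≥ t₂ with t₃ − t₂ ≤ 300·ln(9√‖X‖/(200kγ))/(μσ_min(X)) such that ‖sym(X) − Z_{t₃}Z_{t₃}ᵀ + Z̃_{t₃}Z̃_{t₃}ᵀ‖ ≤ C·kγ√‖X‖. -/

import Mathlib

open Matrix MeasureTheory ProbabilityTheory

noncomputable section

namespace AsymMatrixSensing

/-- Euclidean norm of a real vector. -/
def euclNorm {ι : Type*} [Fintype ι] (v : ι → ℝ) : ℝ :=
  Real.sqrt (∑ i, v i ^ 2)

/-- Spectral norm of a real matrix. -/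
def specNorm {ι₁ ι₂ : Type*} [Fintype ι₁] [Fintype ι₂] (M : Matrix ι₁ ι₂ ℝ) : ℝ :=
  sSup {c : ℝ | ∃ x : ι₂ → ℝ, euclNorm x ≤ 1 ∧ c = euclNorm (M.mulVec x)}

/-- Frobenius norm of a real matrix. -/
def frobNorm {ι₁ ι₂ : Type*} [Fintype ι₁] [Fintype ι₂] (M : Matrix ι₁ ι₂ ℝ) : ℝ :=
  Real.sqrt (∑ i, ∑ j, M i j ^ 2)

/-- Nuclear norm of a real matrix (characterized by duality with the spectral norm). -/
def nucNorm {ι₁ ι₂ : Type*} [Fintype ι₁] [Fintype ι₂] (M : Matrix ι₁ ι₂ ℝ) : ℝ :=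
  sSup {c : ℝ | ∃ B : Matrix ι₁ ι₂ ℝ, specNorm B ≤ 1 ∧ c = ∑ i, ∑ j, M i j * B i j}

/-- Smallest singular value `σ_{min(a,b)}(M)` of a matrix. -/
def sigmaMin {ι₁ ι₂ : Type*} [Fintype ι₁] [Fintype ι₂] (M : Matrix ι₁ ι₂ ℝ) : ℝ :=
  max (sInf {c : ℝ | ∃ x : ι₂ → ℝ, euclNorm x = 1 ∧ c = euclNorm (M.mulVec x)})
      (sInf {c : ℝ | ∃ y : ι₁ → ℝ, euclNorm y = 1 ∧ c = euclNorm (Mᵀ.mulVec y)})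

/-- Smallest nonzero singular value `σ_rank(M)`: the minimum of `‖Mx‖` over unit
vectors `x` orthogonal to the kernel of `M`. -/
def sigmaPos {ι₁ ι₂ : Type*} [Fintype ι₁] [Fintype ι₂] (M : Matrix ι₁ ι₂ ℝ) : ℝ :=
  sInf {c : ℝ | ∃ x : ι₂ → ℝ, euclNorm x = 1 ∧
    (∀ y : ι₂ → ℝ, M.mulVec y = 0 → x ⬝ᵥ y = 0) ∧ c = euclNorm (M.mulVec x)}

/-- Condition number `κ = ‖M‖ / σ_min(M)`. -/
def condNum {ι₁ ι₂ : Type*} [Fintype ι₁] [Fintype ι₂] (M : Matrix ι₁ ι₂ ℝ) : ℝ :=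
  specNorm M / sigmaPos M

/-- Trace inner product `⟨M, N⟩ = trace(Mᵀ N)`. -/
def minner {ι₁ ι₂ : Type*} [Fintype ι₁] [Fintype ι₂] (M N : Matrix ι₁ ι₂ ℝ) : ℝ :=
  ∑ i, ∑ j, M i j * N i j

/-- `P` is a matrix with orthonormal columns spanning the column space of `M`. -/
def IsOrthCol {ι κ₁ κ₂ : Type*} [Fintype ι] [Fintype κ₁] [Fintype κ₂] [DecidableEq κ₂]
    (P : Matrix ι κ₂ ℝ) (M : Matrix ι κ₁ ℝ) : Prop :=
  Pᵀ * P = 1 ∧ (∃ C : Matrix κ₁ κ₂ ℝ, P = M * C) ∧ P * Pᵀ * M = M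

/-- `L` has orthonormal columns spanning the subspace spanned by eigenvectors of the
symmetric matrix `F` corresponding to its `r` largest eigenvalues. -/
def IsTopEigenspace {ι : Type*} [Fintype ι] [DecidableEq ι] {r : ℕ} (F : Matrix ι ι ℝ)
    (L : Matrix ι (Fin r) ℝ) : Prop :=
  Lᵀ * L = 1 ∧ ∃ d : Fin r → ℝ, F * L = L * Matrix.diagonal d ∧
    ∀ (v : ι → ℝ) (lam : ℝ), v ≠ 0 → F.mulVec v = lam • v →
      Lᵀ.mulVec v = 0 → ∀ i, lam ≤ d i

variable {n₁ n₂ m k r : ℕ}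

/-- The measurement operator `𝒜`, given by `[𝒜(Z)]ᵢ = ⟨Aᵢ, Z⟩`. -/
def calA (A : Fin m → Matrix (Fin n₁) (Fin n₂) ℝ) (Z : Matrix (Fin n₁) (Fin n₂) ℝ) :
    Fin m → ℝ := fun i => minner (A i) Z

/-- The restricted isometry property of order `s` with constant `δ`. -/
def HasRIP (A : Fin m → Matrix (Fin n₁) (Fin n₂) ℝ) (s : ℕ) (δ : ℝ) : Prop :=
  ∀ M : Matrix (Fin n₁) (Fin n₂) ℝ, M.rank ≤ s →
    (1 - δ) * frobNorm M ^ 2 ≤ ∑ i, calA A M i ^ 2 ∧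
      ∑ i, calA A M i ^ 2 ≤ (1 + δ) * frobNorm M ^ 2

/-- `𝒜*𝒜`. -/
def AstarA (A : Fin m → Matrix (Fin n₁) (Fin n₂) ℝ) (Z : Matrix (Fin n₁) (Fin n₂) ℝ) :
    Matrix (Fin n₁) (Fin n₂) ℝ := ∑ i, minner (A i) Z • A i

/-- The symmetrization `sym(X) = [[0, X], [Xᵀ, 0]]`. -/
def symMat (X : Matrix (Fin n₁) (Fin n₂) ℝ) :
    Matrix (Fin n₁ ⊕ Fin n₂) (Fin n₁ ⊕ Fin n₂) ℝ := Matrix.fromBlocks 0 X Xᵀ 0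

/-- The symmetrized measurement matrices `Bᵢ = (1/√2)[[0, Aᵢ], [Aᵢᵀ, 0]]`. -/
def Bmat (A : Fin m → Matrix (Fin n₁) (Fin n₂) ℝ) (i : Fin m) :
    Matrix (Fin n₁ ⊕ Fin n₂) (Fin n₁ ⊕ Fin n₂) ℝ :=
  (Real.sqrt 2)⁻¹ • Matrix.fromBlocks 0 (A i) (A i)ᵀ 0

/-- `ℬ*ℬ`. -/
def BstarB (A : Fin m → Matrix (Fin n₁) (Fin n₂) ℝ)
    (S : Matrix (Fin n₁ ⊕ Fin n₂) (Fin n₁ ⊕ Fin n₂) ℝ) :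
    Matrix (Fin n₁ ⊕ Fin n₂) (Fin n₁ ⊕ Fin n₂) ℝ :=
  ∑ i, minner (Bmat A i) S • Bmat A i

/-- The factorized gradient descent iterates `(V_t, W_t)`. -/
def iter (A : Fin m → Matrix (Fin n₁) (Fin n₂) ℝ) (X : Matrix (Fin n₁) (Fin n₂) ℝ)
    (μ : ℝ) (V₀ : Matrix (Fin n₁) (Fin k) ℝ) (W₀ : Matrix (Fin n₂) (Fin k) ℝ) :
    ℕ → Matrix (Fin n₁) (Fin k) ℝ × Matrix (Fin n₂) (Fin k) ℝ
  | 0 => (V₀, W₀)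
  | t + 1 =>
    let p := iter A X μ V₀ W₀ t
    let G := AstarA A (p.1 * p.2ᵀ - X)
    (p.1 - μ • (G * p.2), p.2 - μ • (Gᵀ * p.1))

/-- The vertical stacking `(1/√2)[V; W]`. -/
def Zstack {κ : ℕ} (V : Matrix (Fin n₁) (Fin κ) ℝ) (W : Matrix (Fin n₂) (Fin κ) ℝ) :
    Matrix (Fin n₁ ⊕ Fin n₂) (Fin κ) ℝ :=
  (Real.sqrt 2)⁻¹ • Matrix.fromRows V W

/-- `Z_t = (1/√2)[V_t; W_t]`. -/
def Zit (A : Fin m → Matrix (Fin n₁) (Fin n₂) ℝ) (X : Matrix (Fin n₁) (Fin n₂) ℝ)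
    (μ : ℝ) (V₀ : Matrix (Fin n₁) (Fin k) ℝ) (W₀ : Matrix (Fin n₂) (Fin k) ℝ) (t : ℕ) :
    Matrix (Fin n₁ ⊕ Fin n₂) (Fin k) ℝ :=
  Zstack (iter A X μ V₀ W₀ t).1 (iter A X μ V₀ W₀ t).2

/-- `Z̃_t = (1/√2)[V_t; −W_t]`. -/
def Ztil (A : Fin m → Matrix (Fin n₁) (Fin n₂) ℝ) (X : Matrix (Fin n₁) (Fin n₂) ℝ)
    (μ : ℝ) (V₀ : Matrix (Fin n₁) (Fin k) ℝ) (W₀ : Matrix (Fin n₂) (Fin k) ℝ) (t : ℕ) :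
    Matrix (Fin n₁ ⊕ Fin n₂) (Fin k) ℝ :=
  Zstack (iter A X μ V₀ W₀ t).1 (-(iter A X μ V₀ W₀ t).2)

/-- `Δ_t = (Id − ℬ*ℬ)(Z_tZ_tᵀ − Z̃_tZ̃_tᵀ − sym(X))`. -/
def Δit (A : Fin m → Matrix (Fin n₁) (Fin n₂) ℝ) (X : Matrix (Fin n₁) (Fin n₂) ℝ)
    (μ : ℝ) (V₀ : Matrix (Fin n₁) (Fin k) ℝ) (W₀ : Matrix (Fin n₂) (Fin k) ℝ) (t : ℕ) :
    Matrix (Fin n₁ ⊕ Fin n₂) (Fin n₁ ⊕ Fin n₂) ℝ :=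
  let D := Zit A X μ V₀ W₀ t * (Zit A X μ V₀ W₀ t)ᵀ
    - Ztil A X μ V₀ W₀ t * (Ztil A X μ V₀ W₀ t)ᵀ - symMat X
  D - BstarB A D

/-- The block diagonal matrix `diag(Id_{n₁}, −Id_{n₂})`. -/
def flipSign (n₁ n₂ : ℕ) : Matrix (Fin n₁ ⊕ Fin n₂) (Fin n₁ ⊕ Fin n₂) ℝ :=
  Matrix.fromBlocks 1 0 0 (-1)

/-- Product Gaussian measure modelling the random initialization pair `(V, W)`
with i.i.d. standard Gaussian entries. -/
def gaussPair (n₁ n₂ k : ℕ) :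
    Measure ((Fin n₁ → Fin k → ℝ) × (Fin n₂ → Fin k → ℝ)) :=
  (Measure.pi fun _ : Fin n₁ => Measure.pi fun _ : Fin k => gaussianReal 0 1).prod
    (Measure.pi fun _ : Fin n₂ => Measure.pi fun _ : Fin k => gaussianReal 0 1)

section Phase3Aux
set_option linter.unusedSectionVars false
set_option linter.unusedVariables false
set_option linter.unreachableTactic false
set_option linter.unnecessarySeqFocus false
set_option linter.unusedTactic false
set_option linter.unusedSimpArgs false
open scoped Matrix.Norms.L2Operator

section Base
variable {ι₁ ι₂ ι₃ : Type*} [Fintype ι₁] [Fintype ι₂] [Fintype ι₃]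
  [DecidableEq ι₁] [DecidableEq ι₂] [DecidableEq ι₃]

lemma le_of_sq_le {x y : ℝ} (h : x ^ 2 ≤ y ^ 2) (hy : 0 ≤ y) : x ≤ y :=
  abs_le_of_sq_le_sq' h hy |>.2

lemma euclNorm_eq {ι : Type*} [Fintype ι] (v : ι → ℝ) :
    euclNorm v = ‖(WithLp.toLp 2 v : EuclideanSpace ℝ ι)‖ := by
  rw [EuclideanSpace.norm_eq]; simp [euclNorm]

lemma euclNorm_nonneg {ι : Type*} [Fintype ι] (v : ι → ℝ) : 0 ≤ euclNorm v := Real.sqrt_nonneg _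

lemma euclNorm_sq {ι : Type*} [Fintype ι] (v : ι → ℝ) : euclNorm v ^ 2 = v ⬝ᵥ v := by
  rw [euclNorm, Real.sq_sqrt (Finset.sum_nonneg fun i _ => sq_nonneg _)]
  simp [dotProduct, sq]

lemma euclNorm_smul {ι : Type*} [Fintype ι] (c : ℝ) (v : ι → ℝ) :
    euclNorm (c • v) = |c| * euclNorm v := by
  rw [euclNorm_eq, euclNorm_eq, WithLp.toLp_smul, norm_smul, Real.norm_eq_abs]

lemma euclNorm_eq_zero {ι : Type*} [Fintype ι] {v : ι → ℝ} (h : euclNorm v = 0) : v = 0 := by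
  have := euclNorm_sq v
  rw [h] at this
  exact dotProduct_self_eq_zero.1 (by linarith)

lemma dot_le_euclNorm {ι : Type*} [Fintype ι] (v w : ι → ℝ) :
    v ⬝ᵥ w ≤ euclNorm v * euclNorm w := by
  have h := real_inner_le_norm (WithLp.toLp 2 w : EuclideanSpace ℝ ι) (WithLp.toLp 2 v)
  rw [← euclNorm_eq, ← euclNorm_eq] at h
  simpa [PiLp.inner_apply, dotProduct, mul_comm] using h

lemma euclNorm_mulVec_le (M : Matrix ι₁ ι₂ ℝ) (x : ι₂ → ℝ) :
    euclNorm (M *ᵥ x) ≤ ‖M‖ * euclNorm x := by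
  rw [euclNorm_eq, euclNorm_eq]
  exact Matrix.l2_opNorm_mulVec M (WithLp.toLp 2 x)

lemma norm_le_of_mulVec (M : Matrix ι₁ ι₂ ℝ) {c : ℝ} (hc : 0 ≤ c)
    (h : ∀ x, euclNorm (M *ᵥ x) ≤ c * euclNorm x) : ‖M‖ ≤ c := by
  rw [Matrix.l2_opNorm_def]
  refine ContinuousLinearMap.opNorm_le_bound _ hc fun x => ?_
  have := h x.ofLp
  rw [euclNorm_eq, euclNorm_eq] at this
  exact this

lemma specNorm_eq (M : Matrix ι₁ ι₂ ℝ) : specNorm M = ‖M‖ := by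
  have hb : BddAbove {c : ℝ | ∃ x : ι₂ → ℝ, euclNorm x ≤ 1 ∧ c = euclNorm (M.mulVec x)} := by
    refine ⟨‖M‖, ?_⟩
    rintro c ⟨x, hx, rfl⟩
    exact (euclNorm_mulVec_le M x).trans (mul_le_of_le_one_right (norm_nonneg _) hx)
  have h0 : (0:ℝ) ∈ {c : ℝ | ∃ x : ι₂ → ℝ, euclNorm x ≤ 1 ∧ c = euclNorm (M.mulVec x)} :=
    ⟨0, by simp [euclNorm], by simp [euclNorm]⟩
  apply le_antisymm
  · apply csSup_le ⟨0, h0⟩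
    rintro c ⟨x, hx, rfl⟩
    exact (euclNorm_mulVec_le M x).trans (mul_le_of_le_one_right (norm_nonneg _) hx)
  · apply norm_le_of_mulVec _ (le_csSup hb h0)
    intro x
    by_cases hx : euclNorm x = 0
    · rw [euclNorm_eq_zero hx]; simp [euclNorm]
    have hp : 0 < euclNorm x := lt_of_le_of_ne (euclNorm_nonneg x) (Ne.symm hx)
    have : euclNorm (M *ᵥ ((euclNorm x)⁻¹ • x)) ≤ specNorm M := by
      apply le_csSup hb
      refine ⟨_, ?_, rfl⟩
      rw [euclNorm_smul, abs_of_pos (inv_pos.2 hp), inv_mul_cancel₀ hx]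
    rw [Matrix.mulVec_smul, euclNorm_smul, abs_of_pos (inv_pos.2 hp), inv_mul_le_iff₀ hp, mul_comm] at this
    exact this

lemma nm_t (M : Matrix ι₁ ι₂ ℝ) : ‖Mᵀ‖ = ‖M‖ := by
  rw [← Matrix.conjTranspose_eq_transpose_of_trivial, Matrix.l2_opNorm_conjTranspose]

lemma nm_mul {M : Matrix ι₁ ι₂ ℝ} {N : Matrix ι₂ ι₃ ℝ} {x y : ℝ} (hM : ‖M‖ ≤ x) (hN : ‖N‖ ≤ y) :
    ‖M * N‖ ≤ x * y :=
  (Matrix.l2_opNorm_mul M N).trans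
    (mul_le_mul hM hN (norm_nonneg _) ((norm_nonneg _).trans hM))

lemma nm_t_le {M : Matrix ι₁ ι₂ ℝ} {x : ℝ} (hM : ‖M‖ ≤ x) : ‖Mᵀ‖ ≤ x := by rwa [nm_t]

lemma nm_tmul (M : Matrix ι₁ ι₂ ℝ) : ‖Mᵀ * M‖ = ‖M‖ * ‖M‖ := by
  rw [← Matrix.conjTranspose_eq_transpose_of_trivial, Matrix.l2_opNorm_conjTranspose_mul_self]

lemma nm_smul {M : Matrix ι₁ ι₂ ℝ} {c x : ℝ} (hc : 0 ≤ c) (hM : ‖M‖ ≤ x) : ‖c • M‖ ≤ c * x := by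
  rw [norm_smul, Real.norm_eq_abs, abs_of_nonneg hc]
  exact mul_le_mul_of_nonneg_left hM hc

lemma nm_add {M N : Matrix ι₁ ι₂ ℝ} {x y : ℝ} (hM : ‖M‖ ≤ x) (hN : ‖N‖ ≤ y) :
    ‖M + N‖ ≤ x + y := (norm_add_le _ _).trans (add_le_add hM hN)

lemma nm_sub {M N : Matrix ι₁ ι₂ ℝ} {x y : ℝ} (hM : ‖M‖ ≤ x) (hN : ‖N‖ ≤ y) :
    ‖M - N‖ ≤ x + y := (norm_sub_le _ _).trans (add_le_add hM hN)

lemma nm_one : ‖(1 : Matrix ι₁ ι₁ ℝ)‖ ≤ 1 := by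
  apply norm_le_of_mulVec _ zero_le_one; intro x; simp

lemma nm_iso {P : Matrix ι₁ ι₂ ℝ} (h : Pᵀ * P = 1) : ‖P‖ ≤ 1 := by
  have h1 := nm_tmul P
  rw [h] at h1
  have := nm_one (ι₁ := ι₂)
  nlinarith [norm_nonneg P]

lemma euclNorm_gram (b : Matrix ι₁ ι₂ ℝ) (v w : ι₂ → ℝ) :
    v ⬝ᵥ ((bᵀ * b) *ᵥ w) = (b *ᵥ v) ⬝ᵥ (b *ᵥ w) := by
  rw [← Matrix.mulVec_mulVec, Matrix.dotProduct_mulVec, Matrix.vecMul_transpose]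

lemma nm_proj {P : Matrix ι₁ ι₂ ℝ} (h : Pᵀ * P = 1) : ‖(1 : Matrix ι₁ ι₁ ℝ) - P * Pᵀ‖ ≤ 1 := by
  have h2 : (1 - P * Pᵀ)ᵀ * (1 - P * Pᵀ) = 1 - P * Pᵀ := by
    have : P * Pᵀ * (P * Pᵀ) = P * Pᵀ := by
      rw [Matrix.mul_assoc, ← Matrix.mul_assoc Pᵀ, h, Matrix.one_mul]
    simp only [Matrix.transpose_sub, Matrix.transpose_one, Matrix.transpose_mul,
      Matrix.transpose_transpose, Matrix.sub_mul, Matrix.mul_sub, Matrix.one_mul, Matrix.mul_one,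
      this]
    abel
  have h1 := nm_tmul (1 - P * Pᵀ)
  rw [h2] at h1
  nlinarith [norm_nonneg (1 - P * Pᵀ)]

/-- contraction by a Gram matrix. -/
lemma nm_gram_contract (b : Matrix ι₁ ι₂ ℝ) {μ c M : ℝ} (hμ : 0 ≤ μ) (hb : ‖b‖ ^ 2 ≤ M)
    (hM : μ * M ≤ 1) (hc1 : μ * c ≤ 1)
    (hc : ∀ v, c * euclNorm v ^ 2 ≤ euclNorm (b *ᵥ v) ^ 2) :
    ‖1 - μ • (bᵀ * b)‖ ≤ 1 - μ * c / 2 := by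
  apply norm_le_of_mulVec _ (by linarith)
  intro v
  have e : euclNorm ((1 - μ • (bᵀ * b)) *ᵥ v) ^ 2 =
      euclNorm v ^ 2 - 2 * μ * euclNorm (b *ᵥ v) ^ 2 + μ ^ 2 * euclNorm (bᵀ *ᵥ (b *ᵥ v)) ^ 2 := by
    simp only [euclNorm_sq, Matrix.sub_mulVec, Matrix.one_mulVec, Matrix.smul_mulVec,
      sub_dotProduct, dotProduct_sub, smul_dotProduct, dotProduct_smul, smul_eq_mul]
    rw [dotProduct_comm (((bᵀ * b) *ᵥ v)) v, euclNorm_gram, ← Matrix.mulVec_mulVec]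
    ring
  have h1 := euclNorm_mulVec_le bᵀ (b *ᵥ v)
  rw [nm_t] at h1
  have h2 : euclNorm (bᵀ *ᵥ (b *ᵥ v)) ^ 2 ≤ M * euclNorm (b *ᵥ v) ^ 2 := by
    calc _ ≤ (‖b‖ * euclNorm (b *ᵥ v)) ^ 2 := by gcongr; exact euclNorm_nonneg _
      _ = ‖b‖ ^ 2 * euclNorm (b *ᵥ v) ^ 2 := by ring
      _ ≤ _ := by gcongr
  have h3 : μ ^ 2 * euclNorm (bᵀ *ᵥ (b *ᵥ v)) ^ 2 ≤ μ * euclNorm (b *ᵥ v) ^ 2 := by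
    calc _ ≤ μ ^ 2 * (M * euclNorm (b *ᵥ v) ^ 2) := by gcongr
      _ = (μ * M) * (μ * euclNorm (b *ᵥ v) ^ 2) := by ring
      _ ≤ 1 * (μ * euclNorm (b *ᵥ v) ^ 2) := by gcongr
      _ = _ := one_mul _
  have h4 := mul_le_mul_of_nonneg_left (hc v) hμ
  refine le_of_sq_le ?_ (mul_nonneg (by linarith) (euclNorm_nonneg _))
  rw [e]
  nlinarith [sq_nonneg (μ * c * euclNorm v)]

/-- shrinkage of the norm by the cubic term. -/
lemma nm_cubic (a : Matrix ι₁ ι₂ ℝ) {μ : ℝ} (hμ : 0 ≤ μ) (ha : ‖a‖ ≤ 3) (hM : μ ≤ 1 / 100) :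
    ‖a - μ • (a * (aᵀ * a))‖ ≤ 3 - 13 * μ := by
  apply norm_le_of_mulVec _ (by linarith)
  intro v
  set y := euclNorm (a *ᵥ v) with hy
  set n := euclNorm v with hn
  set g := euclNorm ((aᵀ * a) *ᵥ v) with hg
  have hn0 : 0 ≤ n := euclNorm_nonneg _
  have hg0 : 0 ≤ g := euclNorm_nonneg _
  have hy0 : 0 ≤ y := euclNorm_nonneg _
  have e : euclNorm ((a - μ • (a * (aᵀ * a))) *ᵥ v) ^ 2 =
      y ^ 2 - 2 * μ * g ^ 2 + μ ^ 2 * euclNorm (a *ᵥ ((aᵀ * a) *ᵥ v)) ^ 2 := by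
    have h1 : (a *ᵥ v) ⬝ᵥ (a *ᵥ ((aᵀ * a) *ᵥ v)) = ((aᵀ * a) *ᵥ v) ⬝ᵥ ((aᵀ * a) *ᵥ v) := by
      rw [← euclNorm_gram, Matrix.dotProduct_mulVec, ← Matrix.mulVec_transpose]
      simp
    rw [hy, hg]
    simp only [euclNorm_sq, Matrix.sub_mulVec, Matrix.smul_mulVec,
      sub_dotProduct, dotProduct_sub, smul_dotProduct, dotProduct_smul, smul_eq_mul]
    rw [← Matrix.mulVec_mulVec, dotProduct_comm (a *ᵥ ((aᵀ * a) *ᵥ v)) (a *ᵥ v), h1]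
    ring
  have h1 : euclNorm (a *ᵥ ((aᵀ * a) *ᵥ v)) ≤ 3 * g :=
    (euclNorm_mulVec_le _ _).trans (mul_le_mul_of_nonneg_right ha hg0)
  have h2 : y ^ 2 ≤ n * g := by
    rw [hy, euclNorm_sq, ← euclNorm_gram]
    exact dot_le_euclNorm _ _
  have h3 : y ≤ 3 * n := (euclNorm_mulVec_le _ _).trans (mul_le_mul_of_nonneg_right ha hn0)
  have h4 : euclNorm (a *ᵥ ((aᵀ * a) *ᵥ v)) ^ 2 ≤ 9 * g ^ 2 := by
    nlinarith [euclNorm_nonneg (a *ᵥ ((aᵀ * a) *ᵥ v))]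
  refine le_of_sq_le ?_ (mul_nonneg (by linarith) hn0)
  rw [e]
  -- y² - 1.91 μ g² ≤ (3-13μ)² n²
  have h5 : μ ^ 2 * euclNorm (a *ᵥ ((aᵀ * a) *ᵥ v)) ^ 2 ≤ 9 / 100 * μ * g ^ 2 := by
    calc _ ≤ μ ^ 2 * (9 * g ^ 2) := by gcongr
      _ = μ * (9 * μ * g ^ 2) := by ring
      _ ≤ μ * (9 * (1 / 100) * g ^ 2) := by gcongr
      _ = _ := by ring
  -- convexity: g^2 ≥ 2 t n g - t^2 n^2 with t = 9
  have h6 : 2 * 9 * y ^ 2 - 81 * n ^ 2 ≤ g ^ 2 := by nlinarith [sq_nonneg (g - 9 * n)]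
  have h7 : μ * (18 * y ^ 2 - 81 * n ^ 2) ≤ μ * g ^ 2 := by
    apply mul_le_mul_of_nonneg_left _ hμ; linarith
  have h8 : y ^ 2 ≤ 9 * n ^ 2 := by nlinarith
  have h9 : 0 ≤ 1 - 2 * μ * 18 := by linarith
  have h10 : 0 ≤ μ * n ^ 2 := by positivity
  nlinarith [mul_le_mul_of_nonneg_left h8 (by linarith : (0:ℝ) ≤ 1 - 191/100 * μ * 18), sq_nonneg (μ * n)]

/-- perturbation of inverses. -/
lemma inv_perturb (M N M' : Matrix ι₁ ι₁ ℝ) (h : N * M = 1) (hs : ‖(M' - M) * N‖ ≤ 1 / 2) :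
    ∃ N', N' * M' = 1 ∧ M' * N' = 1 ∧ ‖N'‖ ≤ 2 * ‖N‖ := by
  have hlow : ∀ v, euclNorm v ≤ 2 * euclNorm ((M' * N) *ᵥ v) := by
    intro v
    have hMN : M * N = 1 := mul_eq_one_comm.1 h
    have e : v = (M' * N) *ᵥ v - ((M' - M) * N) *ᵥ v := by
      rw [← Matrix.sub_mulVec, Matrix.sub_mul, hMN]; simp
    have h1 := euclNorm_mulVec_le ((M' - M) * N) v
    have h2 : euclNorm v ≤ euclNorm ((M' * N) *ᵥ v) + euclNorm (((M' - M) * N) *ᵥ v) := by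
      conv_lhs => rw [e]
      simp only [euclNorm_eq, WithLp.toLp_sub]
      exact norm_sub_le _ _
    nlinarith [euclNorm_nonneg v]
  have hinj : Function.Injective (M' * N).mulVec := by
    intro x y hxy
    have h0 : (M' * N) *ᵥ (x - y) = 0 := by
      rw [Matrix.mulVec_sub]; exact sub_eq_zero.2 hxy
    have := hlow (x - y)
    rw [h0] at this
    have h00 : euclNorm (0 : ι₁ → ℝ) = 0 := by simp [euclNorm]
    rw [h00] at this
    exact sub_eq_zero.1 (euclNorm_eq_zero (le_antisymm (by linarith) (euclNorm_nonneg _)))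
  have hu : IsUnit (M' * N) := Matrix.mulVec_injective_iff_isUnit.1 hinj
  obtain ⟨U, hU⟩ := hu
  have hU1 : (M' * N) * (↑U⁻¹ : Matrix ι₁ ι₁ ℝ) = 1 := by rw [← hU]; simp
  have hUn : ‖(↑U⁻¹ : Matrix ι₁ ι₁ ℝ)‖ ≤ 2 := by
    apply norm_le_of_mulVec _ (by norm_num)
    intro x
    have := hlow ((↑U⁻¹ : Matrix ι₁ ι₁ ℝ) *ᵥ x)
    rwa [Matrix.mulVec_mulVec, hU1, Matrix.one_mulVec] at this
  have h1 : M' * (N * (↑U⁻¹ : Matrix ι₁ ι₁ ℝ)) = 1 := by rw [← Matrix.mul_assoc, hU1]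
  refine ⟨N * (↑U⁻¹ : Matrix ι₁ ι₁ ℝ), mul_eq_one_comm.1 h1, h1, ?_⟩
  have := nm_mul (le_refl ‖N‖) hUn
  linarith
end Base


section YStep
variable {ρ : Type*} [Fintype ρ] [DecidableEq ρ]

set_option maxHeartbeats 2000000 in
lemma Ystep (a b Sg Si Y Ra Rb : Matrix ρ ρ ℝ) {μ σ R : ℝ}
    (hσ : 0 < σ) (hσ1 : σ ≤ 1) (hμ : 0 < μ) (hμs : μ ≤ 0.000000001 * σ ^ 4)
    (hY : Y * (a * bᵀ) = 1) (hSS : Si * Sg = 1) (hSg : ‖Sg‖ ≤ 1)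
    (hSc : ‖1 - μ • Sg‖ ≤ 1 - μ * σ) (hSi : ‖Si‖ ≤ 1 / σ)
    (ha : ‖a‖ ≤ 3) (hb : ‖b‖ ≤ 3) (hτ : ‖a - b‖ ≤ 0.000000001 * σ ^ 2)
    (hx : ‖Y - Si‖ ≤ 15 / σ) (hRa : ‖Ra‖ ≤ R) (hRb : ‖Rb‖ ≤ R) (hR : R ≤ 0.001 * σ) :
    ∃ Y', Y' * ((a + μ • ((Sg - a * bᵀ) * b + Ra)) *
        (b + μ • ((Sg - a * bᵀ)ᵀ * a + Rb))ᵀ) = 1 ∧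
      ‖Y' - Si‖ ≤ (1 - μ * σ / 2) * ‖Y - Si‖ + 3000 * μ * R / σ ^ 2 := by
  have hSS' : Sg * Si = 1 := mul_eq_one_comm.1 hSS
  have hY' : a * bᵀ * Y = 1 := mul_eq_one_comm.1 hY
  set D := Y - Si with hD
  set x := ‖D‖ with hxd
  have hx0 : 0 ≤ x := norm_nonneg _
  have hR0 : 0 ≤ R := (norm_nonneg _).trans hRa
  have hYD : Y = D + Si := by rw [hD]; abel
  have hYn : ‖Y‖ ≤ 16 / σ := by
    rw [hYD]
    calc _ ≤ 15 / σ + 1 / σ := nm_add hx hSi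
      _ = _ := by ring
  have hIa : ‖bᵀ * Y‖ ≤ 3 * (16 / σ) := nm_mul (nm_t_le hb) hYn
  have hJb : ‖Y * a‖ ≤ 16 / σ * 3 := nm_mul hYn ha
  set τ := a - b with hτd
  have hτt : ‖τᵀ‖ ≤ 0.000000001 * σ ^ 2 := nm_t_le hτ
  have hbτ : b = a - τ := by rw [hτd]; abel
  have haτ : aᵀ = bᵀ + τᵀ := by rw [hτd, Matrix.transpose_sub]; abel
  have hbIa : b * (bᵀ * Y) = 1 - τ * (bᵀ * Y) := by
    conv_lhs => rw [hbτ]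
    rw [Matrix.sub_mul, ← hbτ, ← Matrix.mul_assoc, hY']
  set E := Sg - a * bᵀ with hE
  have hDSg : Y * E = D * Sg := by
    rw [hE, Matrix.mul_sub, hY, hD, Matrix.sub_mul, hSS]
  have hSgD : E * Y = Sg * D := by
    rw [hE, Matrix.sub_mul, hY', hD, Matrix.mul_sub, hSS']
  have hEA : E = a * bᵀ * (D * Sg) := by
    rw [← hDSg, ← Matrix.mul_assoc, hY', Matrix.one_mul]
  set F := E * b + Ra with hF
  set H := aᵀ * E + Rbᵀ with hH
  have hHt : (Eᵀ * a + Rb)ᵀ = H := by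
    rw [hH, Matrix.transpose_add, Matrix.transpose_mul, Matrix.transpose_transpose]
  set Δ := μ • (F * bᵀ + a * H) + (μ ^ 2) • (F * H) with hΔ
  have hA' : (a + μ • F) * (b + μ • (Eᵀ * a + Rb))ᵀ = a * bᵀ + Δ := by
    rw [Matrix.transpose_add, Matrix.transpose_smul, hHt, hΔ]
    simp only [Matrix.add_mul, Matrix.mul_add, Matrix.smul_mul, Matrix.mul_smul]
    module
  rw [hA']
  -- norm bounds
  have hDS : ‖D * Sg‖ ≤ x := by have := nm_mul (le_refl ‖D‖) hSg; linarith
  have hSD : ‖Sg * D‖ ≤ x := by have := nm_mul hSg (le_refl ‖D‖); linarith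
  have hYF : Y * F = D * Sg * b + Y * Ra := by
    rw [hF, Matrix.mul_add, ← Matrix.mul_assoc, hDSg]
  have hHY : H * Y = aᵀ * (Sg * D) + Rbᵀ * Y := by
    rw [hH, Matrix.add_mul, Matrix.mul_assoc, hSgD]
  have hYFn : ‖Y * F‖ ≤ x * 3 + 16 / σ * R := by
    rw [hYF]; exact nm_add (nm_mul hDS hb) (nm_mul hYn hRa)
  have hHYn : ‖H * Y‖ ≤ 3 * x + R * (16 / σ) := by
    rw [hHY]; exact nm_add (nm_mul (nm_t_le ha) hSD) (nm_mul (nm_t_le hRb) hYn)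
  have hA9 : ‖a * bᵀ‖ ≤ 3 * 3 := nm_mul ha (nm_t_le hb)
  have hEn : ‖E‖ ≤ 3 * 3 * x := by rw [hEA]; exact nm_mul hA9 hDS
  have hFn : ‖F‖ ≤ 3 * 3 * x * 3 + R := nm_add (nm_mul hEn hb) hRa
  -- W
  set W := - (D * Sg * (τ * (bᵀ * Y))) + (Y * Ra) * (bᵀ * Y) + (Y * a) * (τᵀ * (Sg * D))
      + (Y * a) * (Rbᵀ * Y) + μ • ((Y * F) * (H * Y)) with hW
  have hYΔY : Y * (Δ * Y) = μ • (D * Sg + Sg * D) + μ • W := by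
    have e1 : Y * (F * bᵀ * Y) = D * Sg - D * Sg * (τ * (bᵀ * Y)) + (Y * Ra) * (bᵀ * Y) := by
      calc Y * (F * bᵀ * Y) = (Y * F) * (bᵀ * Y) := by simp only [Matrix.mul_assoc]
        _ = D * Sg * (b * (bᵀ * Y)) + (Y * Ra) * (bᵀ * Y) := by
          rw [hYF, Matrix.add_mul]; simp only [Matrix.mul_assoc]
        _ = _ := by rw [hbIa, Matrix.mul_sub, Matrix.mul_one]
    have e2 : Y * (a * H * Y) = Sg * D + (Y * a) * (τᵀ * (Sg * D)) + (Y * a) * (Rbᵀ * Y) := by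
      calc Y * (a * H * Y) = (Y * a) * (H * Y) := by simp only [Matrix.mul_assoc]
        _ = (Y * (a * bᵀ)) * (Sg * D) + (Y * a) * (τᵀ * (Sg * D)) + (Y * a) * (Rbᵀ * Y) := by
          rw [hHY, haτ]; simp only [Matrix.mul_assoc, Matrix.add_mul, Matrix.mul_add]
        _ = _ := by rw [hY, Matrix.one_mul]
    have e3 : Y * (F * H * Y) = (Y * F) * (H * Y) := by simp only [Matrix.mul_assoc]
    rw [hΔ, Matrix.add_mul, Matrix.mul_add, Matrix.smul_mul, Matrix.mul_smul, Matrix.smul_mul,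
      Matrix.mul_smul, e3, Matrix.add_mul, Matrix.mul_add, e1, e2, hW]
    module
  have hΔYn : ‖Δ * Y‖ ≤ μ * (20 * x + 100 * R / σ) := by
    have e1 : F * bᵀ * Y = E - E * (τ * (bᵀ * Y)) + Ra * (bᵀ * Y) := by
      calc F * bᵀ * Y = F * (bᵀ * Y) := by simp only [Matrix.mul_assoc]
        _ = E * (b * (bᵀ * Y)) + Ra * (bᵀ * Y) := by
          rw [hF, Matrix.add_mul]; simp only [Matrix.mul_assoc]
        _ = _ := by rw [hbIa, Matrix.mul_sub, Matrix.mul_one]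
    have e2 : a * H * Y = a * bᵀ * (Sg * D) + a * (τᵀ * (Sg * D)) + a * (Rbᵀ * Y) := by
      calc a * H * Y = a * (H * Y) := by simp only [Matrix.mul_assoc]
        _ = _ := by
          rw [hHY, haτ]; simp only [Matrix.mul_assoc, Matrix.add_mul, Matrix.mul_add]
    have n1 : ‖F * bᵀ * Y‖ ≤ (3 * 3 * x + 3 * 3 * x * (0.000000001 * σ ^ 2 * (3 * (16 / σ))))
        + R * (3 * (16 / σ)) := by
      rw [e1]; exact nm_add (nm_sub hEn (nm_mul hEn (nm_mul hτ hIa))) (nm_mul hRa hIa)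
    have n2 : ‖a * H * Y‖ ≤ (3 * 3 * x + 3 * (0.000000001 * σ ^ 2 * x)) + 3 * (R * (16 / σ)) := by
      rw [e2]
      exact nm_add (nm_add (nm_mul hA9 hSD) (nm_mul ha (nm_mul hτt hSD)))
        (nm_mul ha (nm_mul (nm_t_le hRb) hYn))
    have n3 : ‖F * H * Y‖ ≤ (3 * 3 * x * 3 + R) * (3 * x + R * (16 / σ)) := by
      rw [Matrix.mul_assoc]; exact nm_mul hFn hHYn
    have e : Δ * Y = μ • ((F * bᵀ * Y + a * H * Y) + μ • (F * H * Y)) := by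
      rw [hΔ]; simp only [Matrix.add_mul, Matrix.smul_mul]; module
    rw [e]
    refine nm_smul hμ.le ?_
    refine (nm_add (nm_add n1 n2) (nm_smul hμ.le n3)).trans ?_
    have q1 : 0.000000001 * σ ^ 2 * (3 * (16 / σ)) = 0.000000048 * σ := by field_simp; norm_num <;> ring
    have q2 : R * (16 / σ) = 16 * (R / σ) := by ring
    have q3 : 100 * R / σ = 100 * (R / σ) := by ring
    have q4 : μ * ((3 * 3 * x * 3 + R) * (3 * x + R * (16 / σ))) ≤
        (0.000001) * (3 * x + R * (16 / σ)) := by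
      rw [← mul_assoc]
      apply mul_le_mul_of_nonneg_right _ (by positivity)
      have : (3 * 3 * x * 3 + R) ≤ 410 / σ := by
        have : R ≤ 1 / σ := by
          rw [le_div_iff₀ hσ]; nlinarith only [hR, hσ, hσ1, hR0]
        have : 27 * x ≤ 405 / σ := by
          have := mul_le_mul_of_nonneg_left hx (by norm_num : (0:ℝ) ≤ 27)
          rw [← mul_div_assoc] at this; norm_num at this ⊢; linarith
        have e : 410 / σ = 405 / σ + 5 * (1 / σ) := by ring
        have : 0 < 1 / σ := by positivity
        linarith
      calc μ * (3 * 3 * x * 3 + R) ≤ (0.000000001 * σ ^ 4) * (410 / σ) := by gcongr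
        _ = 0.000000410 * σ ^ 3 := by field_simp; norm_num <;> ring
        _ ≤ 0.000000410 * 1 ^ 3 := by gcongr
        _ ≤ _ := by norm_num
    rw [q1]
    have q5 : R * (3 * (16 / σ)) = 48 * (R / σ) := by ring
    have q6 : 0 ≤ R / σ := by positivity
    have q7 : x * σ ≤ x := mul_le_of_le_one_right hx0 hσ1
    have q8 : σ ^ 2 * x ≤ x := mul_le_of_le_one_left hx0 (pow_le_one₀ hσ.le hσ1)
    rw [q2] at q4 ⊢
    rw [q3, q5]
    generalize μ * ((3 * 3 * x * 3 + R) * (3 * x + 16 * (R / σ))) = G at q4 ⊢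
    generalize R / σ = v at q4 q6 ⊢
    have q9 : 3 * 3 * x * (0.000000048 * σ) ≤ 0.000000432 * x := by linarith
    linarith
  have hh : 20 * x + 100 * R / σ ≤ 301 / σ := by
    have : 100 * R / σ ≤ 1 / σ := by
      apply div_le_div_of_nonneg_right _ hσ.le; linarith
    have : 20 * x ≤ 300 / σ := by
      have := mul_le_mul_of_nonneg_left hx (by norm_num : (0:ℝ) ≤ 20)
      rw [← mul_div_assoc] at this; norm_num at this ⊢; linarith
    have e : 301 / σ = 300 / σ + 1 / σ := by ring
    linarith
  have hμh : μ * (301 / σ) ≤ 0.000000301 * σ ^ 3 := by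
    calc _ ≤ (0.000000001 * σ ^ 4) * (301 / σ) := by gcongr
      _ = _ := by field_simp; norm_num <;> ring
  have hσ3 : σ ^ 3 ≤ 1 := pow_le_one₀ hσ.le hσ1
  obtain ⟨Y', hY'1, hY'2, hY'n⟩ := inv_perturb (a * bᵀ) Y (a * bᵀ + Δ) hY (by
    rw [add_sub_cancel_left]
    refine hΔYn.trans ?_
    have := mul_le_mul_of_nonneg_left hh hμ.le
    linarith)
  refine ⟨Y', hY'1, ?_⟩
  have hexp : Y' = Y - Y * (Δ * Y) + Y' * ((Δ * Y) * (Δ * Y)) := by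
    have h1 : Y' = Y - Y' * (Δ * Y) := by
      have : Y' * ((a * bᵀ + Δ) * Y) = Y := by rw [← Matrix.mul_assoc, hY'1, Matrix.one_mul]
      rw [Matrix.add_mul, hY', Matrix.mul_add, Matrix.mul_one] at this
      rw [eq_sub_iff_add_eq]; exact this
    have h2 : Y' * (Δ * Y) = Y * (Δ * Y) - Y' * ((Δ * Y) * (Δ * Y)) := by
      conv_lhs => rw [h1]
      rw [Matrix.sub_mul, Matrix.mul_assoc Y' (Δ * Y) (Δ * Y)]
    conv_lhs => rw [h1, h2]
    abel
  have hfin : Y' - Si = ((1 - μ • Sg) * (D * (1 - μ • Sg)) - (μ ^ 2) • (Sg * (D * Sg)))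
      - μ • W + Y' * ((Δ * Y) * (Δ * Y)) := by
    conv_lhs => rw [hexp, hYΔY]
    rw [hYD]
    simp only [Matrix.sub_mul, Matrix.mul_sub, Matrix.one_mul, Matrix.mul_one, Matrix.smul_mul,
      Matrix.mul_smul]
    module
  have nW : ‖W‖ ≤ x * (0.000000001 * σ ^ 2 * (3 * (16 / σ))) + (16 / σ * R) * (3 * (16 / σ))
      + (16 / σ * 3) * (0.000000001 * σ ^ 2 * x) + (16 / σ * 3) * (R * (16 / σ))
      + μ * ((x * 3 + 16 / σ * R) * (3 * x + R * (16 / σ))) := by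
    rw [hW]
    refine nm_add (nm_add (nm_add (nm_add ?_ ?_) ?_) ?_) ?_
    · rw [norm_neg]; exact nm_mul hDS (nm_mul hτ hIa)
    · exact nm_mul (nm_mul hYn hRa) hIa
    · exact nm_mul hJb (nm_mul hτt hSD)
    · exact nm_mul hJb (nm_mul (nm_t_le hRb) hYn)
    · exact nm_smul hμ.le (nm_mul hYFn hHYn)
  have n1 : ‖(1 - μ • Sg) * (D * (1 - μ • Sg))‖ ≤ (1 - μ * σ) * (x * (1 - μ * σ)) :=
    nm_mul hSc (nm_mul (le_refl _) hSc)
  have n2 : ‖(μ ^ 2) • (Sg * (D * Sg))‖ ≤ μ ^ 2 * (1 * x) :=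
    nm_smul (by positivity) (nm_mul hSg hDS)
  have n4 : ‖Y' * ((Δ * Y) * (Δ * Y))‖ ≤
      (2 * (16 / σ)) * ((μ * (20 * x + 100 * R / σ)) * (μ * (301 / σ))) := by
    refine nm_mul (hY'n.trans (by linarith)) (nm_mul hΔYn (hΔYn.trans ?_))
    exact mul_le_mul_of_nonneg_left hh hμ.le
  rw [hfin]
  refine (nm_add (nm_sub (nm_sub n1 n2) (nm_smul hμ.le nW)) n4).trans ?_
  -- scalar inequality
  have hu : 0 ≤ R / σ ^ 2 := by positivity
  set v := R / σ ^ 2 with hv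
  have r1 : R = v * σ ^ 2 := by rw [hv]; field_simp
  have s1 : x * (0.000000001 * σ ^ 2 * (3 * (16 / σ))) = 0.000000048 * σ * x := by field_simp; norm_num <;> ring
  have s2 : (16 / σ * R) * (3 * (16 / σ)) = 768 * v := by rw [hv]; field_simp; norm_num <;> ring
  have s3 : (16 / σ * 3) * (0.000000001 * σ ^ 2 * x) = 0.000000048 * σ * x := by field_simp; norm_num <;> ring
  have s4 : (16 / σ * 3) * (R * (16 / σ)) = 768 * v := by rw [hv]; field_simp; norm_num <;> ring
  have s5 : μ * ((x * 3 + 16 / σ * R) * (3 * x + R * (16 / σ))) ≤ 0.000001 * σ * (3 * x + 16 * v) := by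
    have t1 : x * 3 + 16 / σ * R ≤ 61 / σ := by
      have : 16 / σ * R ≤ 16 / σ * 1 := by gcongr; linarith
      have e : 61 / σ = 3 * (15 / σ) + 16 / σ * 1 := by ring
      linarith
    have t2 : 3 * x + R * (16 / σ) ≤ 3 * x + 16 * v := by
      have : R * (16 / σ) = 16 * v * σ := by rw [hv]; field_simp
      rw [this]; nlinarith only [mul_le_of_le_one_right hu hσ1]
    calc _ ≤ (0.000000001 * σ ^ 4) * ((61 / σ) * (3 * x + 16 * v)) := by gcongr
      _ = 0.000000061 * σ * σ ^ 2 * (3 * x + 16 * v) := by field_simp; norm_num <;> ring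
      _ ≤ 0.000000061 * σ * 1 ^ 2 * (3 * x + 16 * v) := by gcongr
      _ ≤ _ := by
        have : 0 ≤ σ * (3 * x + 16 * v) := by positivity
        linarith only [this]
  have s6 : (2 * (16 / σ)) * ((μ * (20 * x + 100 * R / σ)) * (μ * (301 / σ))) ≤
      μ * (0.001 * σ * (x + 5 * v)) := by
    have t2 : 20 * x + 100 * R / σ ≤ 20 * x + 100 * v := by
      have : 100 * R / σ = 100 * v * σ := by rw [hv]; field_simp
      rw [this]; nlinarith only [mul_le_of_le_one_right hu hσ1]
    calc _ ≤ (2 * (16 / σ)) * ((μ * (20 * x + 100 * v)) * (0.000000301 * σ ^ 3)) := by gcongr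
      _ = μ * (0.000009632 * σ * σ * (20 * x + 100 * v)) := by field_simp; norm_num <;> ring
      _ ≤ μ * (0.000009632 * 1 * σ * (20 * x + 100 * v)) := by gcongr
      _ ≤ _ := by
        apply mul_le_mul_of_nonneg_left _ hμ.le
        have h1 : 0 ≤ σ * x := by positivity
        have h2 : 0 ≤ σ * v := by positivity
        linarith only [h1, h2]
  rw [s1, s2, s3, s4]
  have s7 : 3000 * μ * R / σ ^ 2 = 3000 * μ * v := by rw [hv]; ring
  rw [s7]
  have hμσ : μ ≤ 0.000000001 * σ := by
    refine hμs.trans ?_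
    have : σ ^ 4 ≤ σ := by
      calc σ ^ 4 = σ * σ ^ 3 := by ring
        _ ≤ σ * 1 := by gcongr
        _ = σ := mul_one _
    linarith
  have hμσ1 : 0 ≤ μ * σ := by positivity
  have hμσ2 : μ * σ ≤ 1 := by nlinarith only [hμσ, hσ1, hσ, hμ]
  have f1 : (1 - μ * σ) * (x * (1 - μ * σ)) ≤ (1 - μ * σ) * x := by
    apply mul_le_mul_of_nonneg_left _ (by linarith)
    exact mul_le_of_le_one_right hx0 (by linarith)
  have f2 : μ ^ 2 * (1 * x) ≤ 0.000000001 * (μ * (σ * x)) := by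
    calc μ ^ 2 * (1 * x) = μ * (μ * x) := by ring
      _ ≤ μ * (0.000000001 * σ * x) := by gcongr
      _ = _ := by ring
  have f3 : μ * (0.000000048 * σ * x + 768 * v + 0.000000048 * σ * x + 768 * v +
      μ * ((x * 3 + 16 / σ * R) * (3 * x + R * (16 / σ)))) ≤
      μ * (0.000000048 * σ * x + 768 * v + 0.000000048 * σ * x + 768 * v + 0.000001 * σ * (3 * x + 16 * v)) := by
    gcongr
  have f4 : 0 ≤ μ * (σ * x) := by positivity
  have f5 : μ * (σ * v) ≤ μ * v := by
    apply mul_le_mul_of_nonneg_left _ hμ.le; exact mul_le_of_le_one_left hu hσ1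
  have f6 : 0 ≤ μ * v := by positivity
  linarith only [f1, f2, f3, f4, f5, f6, s6]
end YStep


section Step
variable {ι₁ ι₂ ρ η : Type*} [Fintype ι₁] [Fintype ι₂] [Fintype ρ] [Fintype η]
  [DecidableEq ι₁] [DecidableEq ι₂] [DecidableEq ρ] [DecidableEq η]

lemma pp {κ : Type*} {P : Matrix ι₁ ρ ℝ} (h : Pᵀ * P = 1) (M : Matrix ρ κ ℝ) :
    Pᵀ * (P * M) = M := by
  rw [← Matrix.mul_assoc, h, Matrix.one_mul]

lemma nm_one_mul_le {κ : Type*} [Fintype κ] [DecidableEq κ] {P : Matrix ι₁ ρ ℝ} (h : Pᵀ * P = 1)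
    {M : Matrix ι₁ κ ℝ} {x : ℝ} (hM : ‖M‖ ≤ x) : ‖Pᵀ * M‖ ≤ x := by
  have := nm_mul (nm_t_le (nm_iso h)) hM; linarith

lemma nm_one_mul_le2 {κ : Type*} [Fintype κ] [DecidableEq κ] {P : Matrix ι₁ ρ ℝ} (h : Pᵀ * P = 1)
    {M : Matrix ρ κ ℝ} {x : ℝ} (hM : ‖M‖ ≤ x) : ‖P * M‖ ≤ x := by
  have := nm_mul (nm_iso h) hM; linarith

lemma nm_comp_le {κ : Type*} [Fintype κ] [DecidableEq κ] {P : Matrix ι₁ ρ ℝ} (h : Pᵀ * P = 1)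
    {M : Matrix ι₁ κ ℝ} {x : ℝ} (hM : ‖M‖ ≤ x) : ‖M - P * (Pᵀ * M)‖ ≤ x := by
  have e : M - P * (Pᵀ * M) = (1 - P * Pᵀ) * M := by
    rw [Matrix.sub_mul, Matrix.one_mul, Matrix.mul_assoc]
  rw [e]
  have := nm_mul (nm_proj h) hM; linarith

/-- norm step -/
lemma L1 (P : Matrix ι₁ ρ ℝ) (Q : Matrix ι₂ ρ ℝ) (Sg : Matrix ρ ρ ℝ) (a : Matrix ι₁ ρ ℝ)
    (b : Matrix ι₂ ρ ℝ) (D : Matrix ι₁ ι₂ ℝ) {μ : ℝ} (hP : Pᵀ * P = 1) (hQ : Qᵀ * Q = 1)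
    (hμ : 0 ≤ μ) (hμ1 : μ ≤ 1 / 100) (hSg : ‖Sg‖ ≤ 1) (ha : ‖a‖ ≤ 3) (hb : ‖b‖ ≤ 3)
    (hβ : ‖aᵀ * a - bᵀ * b‖ ≤ 1) (hD : ‖D‖ ≤ 1) :
    ‖a + μ • ((P * Sg * Qᵀ - a * bᵀ + D) * b)‖ ≤ 3 := by
  have e : a + μ • ((P * Sg * Qᵀ - a * bᵀ + D) * b) =
      (a - μ • (a * (aᵀ * a))) + μ • (P * (Sg * (Qᵀ * b)) + a * (aᵀ * a - bᵀ * b) + D * b) := by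
    simp only [Matrix.mul_add, Matrix.add_mul, Matrix.sub_mul, Matrix.mul_sub, Matrix.mul_assoc]
    module
  rw [e]
  have h1 := nm_cubic a hμ ha hμ1
  have h2 : ‖P * (Sg * (Qᵀ * b)) + a * (aᵀ * a - bᵀ * b) + D * b‖ ≤ 1 * 3 + 3 * 1 + 1 * 3 :=
    nm_add (nm_add (nm_one_mul_le2 hP (nm_mul hSg (nm_one_mul_le hQ hb))) (nm_mul ha hβ))
      (nm_mul hD hb)
  have h3 := nm_add h1 (nm_smul hμ h2)
  linarith

/-- inverse bounds -/
lemma L0 (a1 b1 Y : Matrix ρ ρ ℝ) {σ : ℝ} (hσ : 0 < σ) (hσ1 : σ ≤ 1)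
    (hY : Y * (a1 * b1ᵀ) = 1) (hYn : ‖Y‖ ≤ 16 / σ) (ha : ‖a1‖ ≤ 3)
    (hτ : ‖a1 - b1‖ ≤ 0.000000001 * σ ^ 2) :
    ∃ Ib : Matrix ρ ρ ℝ, Ib * b1 = 1 ∧ ‖Ib‖ ^ 2 ≤ 17 / σ ∧ ‖Ib‖ ≤ 5 / σ := by
  have h1 : (Y * a1) * b1ᵀ = 1 := by rw [Matrix.mul_assoc]; exact hY
  have h2 : b1 * (Y * a1)ᵀ = 1 := by
    have := congrArg Matrix.transpose h1
    rwa [Matrix.transpose_mul, Matrix.transpose_transpose, Matrix.transpose_one] at this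
  have hn : ‖(Y * a1)ᵀ‖ ≤ 16 / σ * 3 := nm_t_le (nm_mul hYn ha)
  have hsq : ‖(Y * a1)ᵀ‖ ^ 2 ≤ 17 / σ := by
    rw [sq, ← nm_tmul, Matrix.transpose_transpose]
    have e : Y * a1 * (Y * a1)ᵀ = Y * (1 + (a1 - b1) * (Y * a1)ᵀ) := by
      rw [Matrix.sub_mul, h2, Matrix.mul_assoc]; congr 1; abel
    rw [e]
    refine (nm_mul hYn (nm_add nm_one (nm_mul hτ hn))).trans ?_
    have : 0.000000001 * σ ^ 2 * (16 / σ * 3) = 0.000000048 * σ := by field_simp; norm_num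
    rw [this, div_mul_eq_mul_div]
    apply div_le_div_of_nonneg_right _ hσ.le
    linarith
  refine ⟨(Y * a1)ᵀ, mul_eq_one_comm.1 h2, hsq, ?_⟩
  apply le_of_sq_le _ (by positivity)
  refine hsq.trans ?_
  rw [div_pow, div_le_div_iff₀ hσ (by positivity)]
  nlinarith only [hσ, hσ1]

lemma L0c (Q : Matrix ι₂ ρ ℝ) (b : Matrix ι₂ ρ ℝ) (hQ : Qᵀ * Q = 1) (Ib : Matrix ρ ρ ℝ) {σ μ : ℝ}
    (hσ : 0 < σ) (hσ1 : σ ≤ 1) (hμ : 0 ≤ μ) (hμ1 : μ ≤ 1 / 100) (hb : ‖b‖ ≤ 3)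
    (h : Ib * (Qᵀ * b) = 1) (hn : ‖Ib‖ ^ 2 ≤ 17 / σ) :
    ‖1 - μ • (bᵀ * b)‖ ≤ 1 - μ * σ / 40 := by
  have key := nm_gram_contract b (M := 9) (c := σ / 20) hμ
    (by nlinarith only [hb, norm_nonneg b]) (by linarith) (by nlinarith only [hσ, hσ1, hμ, hμ1]) (by
    intro v
    have h1 : euclNorm v ≤ ‖Ib‖ * euclNorm (b *ᵥ v) := by
      calc euclNorm v = euclNorm (Ib *ᵥ ((Qᵀ * b) *ᵥ v)) := by
            rw [Matrix.mulVec_mulVec, h, Matrix.one_mulVec]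
        _ ≤ ‖Ib‖ * euclNorm ((Qᵀ * b) *ᵥ v) := euclNorm_mulVec_le _ _
        _ ≤ ‖Ib‖ * (1 * euclNorm (b *ᵥ v)) := by
            apply mul_le_mul_of_nonneg_left _ (norm_nonneg _)
            rw [← Matrix.mulVec_mulVec]
            refine (euclNorm_mulVec_le _ _).trans ?_
            exact mul_le_mul_of_nonneg_right (nm_t_le (nm_iso hQ)) (euclNorm_nonneg _)
        _ = _ := by rw [one_mul]
    have h2 : euclNorm v ^ 2 ≤ ‖Ib‖ ^ 2 * euclNorm (b *ᵥ v) ^ 2 := by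
      rw [← mul_pow]; exact pow_le_pow_left₀ (euclNorm_nonneg _) h1 2
    have h3 : ‖Ib‖ ^ 2 * euclNorm (b *ᵥ v) ^ 2 ≤ 17 / σ * euclNorm (b *ᵥ v) ^ 2 :=
      mul_le_mul_of_nonneg_right hn (sq_nonneg _)
    have h4 : σ / 20 * (17 / σ * euclNorm (b *ᵥ v) ^ 2) = 17 / 20 * euclNorm (b *ᵥ v) ^ 2 := by
      field_simp
    have h5 := mul_le_mul_of_nonneg_left (h2.trans h3) (by positivity : 0 ≤ σ / 20)
    have h6 := sq_nonneg (euclNorm (b *ᵥ v))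
    linarith)
  linarith

/-- orthogonal part step, generic right factor -/
lemma L2id {κ : Type*} (P : Matrix ι₁ ρ ℝ) (Q : Matrix ι₂ ρ ℝ) (Sg : Matrix ρ ρ ℝ)
    (a : Matrix ι₁ ρ ℝ) (u : Matrix ι₁ κ ℝ) (w : Matrix ι₂ κ ℝ)
    (b : Matrix ι₂ ρ ℝ) (D : Matrix ι₁ ι₂ ℝ) {μ : ℝ} (hP : Pᵀ * P = 1) :
    (u + μ • ((P * Sg * Qᵀ - a * bᵀ + D) * w)) -
      P * (Pᵀ * (u + μ • ((P * Sg * Qᵀ - a * bᵀ + D) * w))) =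
    (u - P * (Pᵀ * u)) + μ • ((D * w - P * (Pᵀ * (D * w))) - (a - P * (Pᵀ * a)) * (bᵀ * w)) := by
  simp only [Matrix.mul_add, Matrix.add_mul, Matrix.sub_mul, Matrix.mul_sub, Matrix.mul_assoc,
    Matrix.mul_smul, pp hP]
  module

lemma L2a (P : Matrix ι₁ ρ ℝ) (Q : Matrix ι₂ ρ ℝ) (Sg : Matrix ρ ρ ℝ) (a : Matrix ι₁ ρ ℝ)
    (b : Matrix ι₂ ρ ℝ) (D : Matrix ι₁ ι₂ ℝ) {μ θ d : ℝ} (hP : Pᵀ * P = 1) (hμ : 0 ≤ μ)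
    (hc : ‖1 - μ • (bᵀ * b)‖ ≤ θ) (hb : ‖b‖ ≤ 3) (hD : ‖D‖ ≤ d) :
    ‖(a + μ • ((P * Sg * Qᵀ - a * bᵀ + D) * b)) -
      P * (Pᵀ * (a + μ • ((P * Sg * Qᵀ - a * bᵀ + D) * b)))‖ ≤
    θ * ‖a - P * (Pᵀ * a)‖ + 3 * μ * d := by
  rw [L2id P Q Sg a a b b D hP]
  have e : (a - P * (Pᵀ * a)) + μ • ((D * b - P * (Pᵀ * (D * b))) - (a - P * (Pᵀ * a)) * (bᵀ * b))
     = (a - P * (Pᵀ * a)) * (1 - μ • (bᵀ * b)) + μ • (D * b - P * (Pᵀ * (D * b))) := by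
    rw [Matrix.mul_sub (a - P * (Pᵀ * a)), Matrix.mul_one, Matrix.mul_smul]; module
  rw [e]
  refine (nm_add (nm_mul le_rfl hc) (nm_smul hμ (nm_comp_le hP (nm_mul hD hb)))).trans ?_
  apply le_of_eq; ring

lemma L2u {κ : Type*} [Fintype κ] [DecidableEq κ] (P : Matrix ι₁ ρ ℝ) (Q : Matrix ι₂ ρ ℝ)
    (Sg : Matrix ρ ρ ℝ) (a : Matrix ι₁ ρ ℝ) (u : Matrix ι₁ κ ℝ) (w : Matrix ι₂ κ ℝ)
    (b : Matrix ι₂ ρ ℝ) (D : Matrix ι₁ ι₂ ℝ) {μ θ d ν : ℝ} (hP : Pᵀ * P = 1) (hμ : 0 ≤ μ)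
    (ha2 : ‖a - P * (Pᵀ * a)‖ ≤ θ) (hb : ‖b‖ ≤ 3) (hD : ‖D‖ ≤ d) (hw : ‖w‖ ≤ ν) :
    ‖(u + μ • ((P * Sg * Qᵀ - a * bᵀ + D) * w)) -
      P * (Pᵀ * (u + μ • ((P * Sg * Qᵀ - a * bᵀ + D) * w)))‖ ≤
    ‖u - P * (Pᵀ * u)‖ + μ * ((d + 3 * θ) * ν) := by
  rw [L2id P Q Sg a u w b D hP]
  refine (nm_add le_rfl (nm_smul hμ (nm_sub (nm_comp_le hP (nm_mul hD hw))
    (nm_mul ha2 (nm_mul (nm_t_le hb) hw))))).trans ?_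
  apply le_of_eq; ring

/-- balance step -/
lemma L4 {κ : Type*} [Fintype κ] [DecidableEq κ] (a : Matrix ι₁ ρ ℝ) (b : Matrix ι₂ ρ ℝ)
    (u : Matrix ι₁ κ ℝ) (w : Matrix ι₂ κ ℝ) (G : Matrix ι₁ ι₂ ℝ) {μ ν : ℝ}
    (ha : ‖a‖ ≤ 3) (hb : ‖b‖ ≤ 3) (hG : ‖G‖ ≤ 11) (hu : ‖u‖ ≤ ν) (hw : ‖w‖ ≤ ν) :
    ‖(a + μ • (G * b))ᵀ * (u + μ • (G * w)) - (b + μ • (Gᵀ * a))ᵀ * (w + μ • (Gᵀ * u))‖ ≤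
      ‖aᵀ * u - bᵀ * w‖ + 726 * μ ^ 2 * ν := by
  have e : (a + μ • (G * b))ᵀ * (u + μ • (G * w)) - (b + μ • (Gᵀ * a))ᵀ * (w + μ • (Gᵀ * u)) =
      (aᵀ * u - bᵀ * w) + (μ ^ 2) • ((G * b)ᵀ * (G * w) - (Gᵀ * a)ᵀ * (Gᵀ * u)) := by
    simp only [Matrix.transpose_add, Matrix.transpose_smul, Matrix.transpose_mul,
      Matrix.transpose_transpose, Matrix.mul_add, Matrix.add_mul, Matrix.mul_assoc,
      Matrix.mul_smul, Matrix.smul_mul]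
    module
  rw [e]
  have hGt := nm_t_le hG
  refine (nm_add le_rfl (nm_smul (sq_nonneg μ) (nm_sub (nm_mul (nm_t_le (nm_mul hG hb)) (nm_mul hG hw))
    (nm_mul (nm_t_le (nm_mul hGt ha)) (nm_mul hGt hu))))).trans ?_
  apply le_of_eq; ring

/-- imbalance step -/
lemma L3 (P : Matrix ι₁ ρ ℝ) (Q : Matrix ι₂ ρ ℝ) (Sg : Matrix ρ ρ ℝ) (a : Matrix ι₁ ρ ℝ)
    (b : Matrix ι₂ ρ ℝ) (D : Matrix ι₁ ι₂ ℝ) {μ σ d B : ℝ} (hP : Pᵀ * P = 1) (hQ : Qᵀ * Q = 1)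
    (hSt : Sgᵀ = Sg) (hμ : 0 ≤ μ) (hσ : 0 ≤ σ)
    (hSg : ‖Sg‖ ≤ 1) (hSc : ‖1 - μ • Sg‖ ≤ 1 - μ * σ) (hc : ‖1 - μ • (bᵀ * b)‖ ≤ 1)
    (ha : ‖a‖ ≤ 3) (hb : ‖b‖ ≤ 3) (hβ : ‖aᵀ * a - bᵀ * b‖ ≤ B) (hD : ‖D‖ ≤ d) :
    ‖Pᵀ * (a + μ • ((P * Sg * Qᵀ - a * bᵀ + D) * b)) -
      Qᵀ * (b + μ • ((P * Sg * Qᵀ - a * bᵀ + D)ᵀ * a))‖ ≤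
    (1 - μ * σ + 9 * μ ^ 2) * ‖Pᵀ * a - Qᵀ * b‖ + μ * (3 * B + 6 * d) := by
  have e : Pᵀ * (a + μ • ((P * Sg * Qᵀ - a * bᵀ + D) * b)) -
      Qᵀ * (b + μ • ((P * Sg * Qᵀ - a * bᵀ + D)ᵀ * a)) =
      (1 - μ • Sg) * ((Pᵀ * a - Qᵀ * b) * (1 - μ • (bᵀ * b)))
      - (μ ^ 2) • (Sg * ((Pᵀ * a - Qᵀ * b) * (bᵀ * b)))
      + μ • ((Qᵀ * b) * (aᵀ * a - bᵀ * b) + (Pᵀ * (D * b) - Qᵀ * (Dᵀ * a))) := by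
    simp only [Matrix.mul_add, Matrix.add_mul, Matrix.sub_mul, Matrix.mul_sub, Matrix.mul_assoc,
      Matrix.mul_smul, Matrix.smul_mul, Matrix.transpose_add, Matrix.transpose_sub,
      Matrix.transpose_mul, Matrix.transpose_transpose, pp hP, pp hQ, hSt, Matrix.one_mul,
      Matrix.mul_one]
    module
  rw [e]
  refine (nm_add (nm_sub (nm_mul hSc (nm_mul le_rfl hc)) (nm_smul (sq_nonneg μ)
    (nm_mul hSg (nm_mul le_rfl (nm_mul (nm_t_le hb) hb))))) (nm_smul hμ
    (nm_add (nm_mul (nm_one_mul_le hQ hb) hβ) (nm_sub (nm_one_mul_le hP (nm_mul hD hb))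
      (nm_one_mul_le hQ (nm_mul (nm_t_le hD) ha)))))).trans ?_
  apply le_of_eq; ring

end Step


section Step2
variable {ι₁ ι₂ ρ η : Type*} [Fintype ι₁] [Fintype ι₂] [Fintype ρ] [Fintype η]
  [DecidableEq ι₁] [DecidableEq ι₂] [DecidableEq ρ] [DecidableEq η]

structure Env (P : Matrix ι₁ ρ ℝ) (Q : Matrix ι₂ ρ ℝ) (Sg Si : Matrix ρ ρ ℝ) (μ σ : ℝ) : Prop where
  hP : Pᵀ * P = 1
  hQ : Qᵀ * Q = 1
  hSS : Si * Sg = 1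
  hSt : Sgᵀ = Sg
  hSg : ‖Sg‖ ≤ 1
  hSc : ‖1 - μ • Sg‖ ≤ 1 - μ * σ
  hSi : ‖Si‖ ≤ 1 / σ
  hσ : 0 < σ
  hσ1 : σ ≤ 1
  hμ : 0 < μ
  hμs : μ ≤ 0.000000001 * σ ^ 4

structure Sig (P : Matrix ι₁ ρ ℝ) (Q : Matrix ι₂ ρ ℝ) (Si : Matrix ρ ρ ℝ) (σ B Φ : ℝ)
    (a : Matrix ι₁ ρ ℝ) (b : Matrix ι₂ ρ ℝ) : Prop where
  ha : ‖a‖ ≤ 3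
  hb : ‖b‖ ≤ 3
  hτ : ‖Pᵀ * a - Qᵀ * b‖ ≤ 0.000000001 * σ ^ 2
  ha2 : ‖a - P * (Pᵀ * a)‖ ≤ 0.000000001 * σ ^ 2
  hb2 : ‖b - Q * (Qᵀ * b)‖ ≤ 0.000000001 * σ ^ 2
  hβ : ‖aᵀ * a - bᵀ * b‖ ≤ B
  hY : ∃ Y, Y * ((Pᵀ * a) * (Qᵀ * b)ᵀ) = 1 ∧
    ‖Y - Si‖ + (‖a - P * (Pᵀ * a)‖ + ‖b - Q * (Qᵀ * b)‖) / σ ≤ Φ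

lemma Y_norm {P : Matrix ι₁ ρ ℝ} {Q : Matrix ι₂ ρ ℝ} {Sg Si : Matrix ρ ρ ℝ} {μ σ B Φ : ℝ}
    (he : Env P Q Sg Si μ σ) {Y : Matrix ρ ρ ℝ} {z : ℝ} (hz : 0 ≤ z)
    (h : ‖Y - Si‖ + z / σ ≤ Φ) (hΦ : Φ ≤ 15 / σ) : ‖Y - Si‖ ≤ 15 / σ ∧ ‖Y‖ ≤ 16 / σ := by
  have h0 : 0 ≤ z / σ := div_nonneg hz he.hσ.le
  have h1 : ‖Y - Si‖ ≤ 15 / σ := by linarith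
  refine ⟨h1, ?_⟩
  have e : Y = (Y - Si) + Si := by abel
  rw [e]
  calc _ ≤ 15 / σ + 1 / σ := nm_add h1 he.hSi
    _ = _ := by ring

lemma inv_bounds {P : Matrix ι₁ ρ ℝ} {Q : Matrix ι₂ ρ ℝ} {Sg Si : Matrix ρ ρ ℝ} {μ σ B Φ : ℝ}
    {a : Matrix ι₁ ρ ℝ} {b : Matrix ι₂ ρ ℝ}
    (he : Env P Q Sg Si μ σ) (hs : Sig P Q Si σ B Φ a b) (hΦ : Φ ≤ 15 / σ) :
    (∃ Ib : Matrix ρ ρ ℝ, Ib * (Qᵀ * b) = 1 ∧ ‖Ib‖ ^ 2 ≤ 17 / σ ∧ ‖Ib‖ ≤ 5 / σ) ∧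
    (∃ Ia : Matrix ρ ρ ℝ, Ia * (Pᵀ * a) = 1 ∧ ‖Ia‖ ^ 2 ≤ 17 / σ ∧ ‖Ia‖ ≤ 5 / σ) := by
  obtain ⟨Y, hY1, hY2⟩ := hs.hY
  have hYn := (Y_norm he (by positivity) hY2 hΦ (B := B)).2
  refine ⟨L0 _ _ Y he.hσ he.hσ1 hY1 hYn (nm_one_mul_le he.hP hs.ha) hs.hτ, ?_⟩
  refine L0 (Qᵀ * b) (Pᵀ * a) Yᵀ he.hσ he.hσ1 ?_ (nm_t_le hYn) (nm_one_mul_le he.hQ hs.hb) ?_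
  · have h1 := congrArg Matrix.transpose (mul_eq_one_comm.1 hY1)
    rw [Matrix.transpose_mul, Matrix.transpose_mul, Matrix.transpose_transpose,
      Matrix.transpose_one] at h1
    exact h1
  · rw [← norm_neg, neg_sub]; exact hs.hτ

lemma s_inv {P : Matrix ι₁ ρ ℝ} {Q : Matrix ι₂ ρ ℝ} {Sg Si : Matrix ρ ρ ℝ} {μ σ B Φ : ℝ}
    {a : Matrix ι₁ ρ ℝ} {b : Matrix ι₂ ρ ℝ}
    (he : Env P Q Sg Si μ σ) (hs : Sig P Q Si σ B Φ a b) (hΦ : Φ ≤ 15 / σ) :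
    ∃ J : Matrix ρ ρ ℝ, J * (Pᵀ * a + Qᵀ * b) = 1 ∧ (Pᵀ * a + Qᵀ * b) * J = 1 ∧ ‖J‖ ≤ 5 / σ := by
  obtain ⟨-, Ia, h1, -, h2⟩ := inv_bounds he hs hΦ
  have hσ := he.hσ
  have hn : ‖(1 / 2 : ℝ) • Ia‖ ≤ 1 / 2 * (5 / σ) := nm_smul (by norm_num) h2
  obtain ⟨J, hJ1, hJ2, hJ3⟩ := inv_perturb ((2 : ℝ) • (Pᵀ * a)) ((1 / 2 : ℝ) • Ia)
    (Pᵀ * a + Qᵀ * b) (by rw [Matrix.smul_mul, Matrix.mul_smul, h1, smul_smul]; norm_num) (by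
      have e : Pᵀ * a + Qᵀ * b - (2 : ℝ) • (Pᵀ * a) = - (Pᵀ * a - Qᵀ * b) := by module
      rw [e]
      refine (nm_mul ((norm_neg _).le.trans hs.hτ) hn).trans ?_
      have : 0.000000001 * σ ^ 2 * (1 / 2 * (5 / σ)) = 0.0000000025 * σ := by field_simp; norm_num
      rw [this]; linarith [he.hσ1])
  refine ⟨J, hJ1, hJ2, hJ3.trans ?_⟩
  calc _ ≤ 2 * (1 / 2 * (5 / σ)) := by linarith
    _ = _ := by ring

set_option maxHeartbeats 1000000 in
lemma sig_step {P : Matrix ι₁ ρ ℝ} {Q : Matrix ι₂ ρ ℝ} {Sg Si : Matrix ρ ρ ℝ} {μ σ B Φ d : ℝ}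
    {a a' : Matrix ι₁ ρ ℝ} {b b' : Matrix ι₂ ρ ℝ} {G D : Matrix ι₁ ι₂ ℝ}
    (he : Env P Q Sg Si μ σ) (hs : Sig P Q Si σ B Φ a b) (hΦ : Φ ≤ 15 / σ)
    (hG : G = P * Sg * Qᵀ - a * bᵀ + D) (hD : ‖D‖ ≤ d) (hd : d ≤ 0.000000000002 * σ ^ 3)
    (hB : B ≤ 0.00000000001 * σ ^ 3)
    (ha' : a' = a + μ • (G * b)) (hb' : b' = b + μ • (Gᵀ * a)) :
    Sig P Q Si σ (B + 3000 * μ ^ 2) ((1 - μ * σ / 50) * Φ + 10000 * μ * d / σ ^ 2) a' b' := by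
  have hP := he.hP
  have hQ := he.hQ
  have hσ := he.hσ
  have hσ1 := he.hσ1
  have hμ := he.hμ
  have hμs := he.hμs
  have hd0 : 0 ≤ d := (norm_nonneg _).trans hD
  have hσ3 : σ ^ 3 ≤ 1 := pow_le_one₀ hσ.le hσ1
  have hσ4 : σ ^ 4 ≤ 1 := pow_le_one₀ hσ.le hσ1
  have hμσ : μ ≤ 0.000000001 * σ := by
    have : σ ^ 4 ≤ σ := by
      calc σ ^ 4 = σ * σ ^ 3 := by ring
        _ ≤ σ * 1 := by gcongr
        _ = σ := mul_one _
    linarith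
  have hμ1 : μ ≤ 1 / 100 := by linarith
  have hD1 : ‖D‖ ≤ 1 := by linarith
  have hB1 : ‖aᵀ * a - bᵀ * b‖ ≤ 1 := by linarith [hs.hβ]
  have hB1' : ‖bᵀ * b - aᵀ * a‖ ≤ 1 := by rw [← norm_neg, neg_sub]; exact hB1
  have hGt : Gᵀ = Q * Sg * Pᵀ - b * aᵀ + Dᵀ := by
    rw [hG]
    simp only [Matrix.transpose_add, Matrix.transpose_sub, Matrix.transpose_mul,
      Matrix.transpose_transpose, he.hSt, Matrix.mul_assoc]
  obtain ⟨⟨Ib, hIb1, hIb2, -⟩, Ia, hIa1, hIa2, -⟩ := inv_bounds he hs hΦ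
  have hcb := L0c Q b hQ Ib hσ hσ1 hμ.le hμ1 hs.hb hIb1 hIb2
  have hca := L0c P a hP Ia hσ hσ1 hμ.le hμ1 hs.ha hIa1 hIa2
  have hcb1 : ‖1 - μ • (bᵀ * b)‖ ≤ 1 := by
    have : 0 ≤ μ * σ := by positivity
    linarith
  have hG11 : ‖G‖ ≤ 11 := by
    rw [hG]
    have : ‖P * Sg * Qᵀ‖ ≤ 1 * 1 * 1 :=
      nm_mul (nm_mul (nm_iso hP) he.hSg) (nm_t_le (nm_iso hQ))
    have := nm_add (nm_sub this (nm_mul hs.ha (nm_t_le hs.hb))) hD1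
    linarith
  have na2 := L2a P Q Sg a b D hP hμ.le hcb hs.hb hD
  rw [← hG, ← ha'] at na2
  have nb2 := L2a Q P Sg b a Dᵀ hQ hμ.le hca hs.ha (nm_t_le hD)
  rw [← hGt, ← hb'] at nb2
  have hμσ0 : 0 < μ * σ := by positivity
  have hdd : 3 * μ * d ≤ μ * σ / 40 * (0.000000001 * σ ^ 2) := by
    have := mul_le_mul_of_nonneg_left hd hμ.le
    have h2 : 0 ≤ μ * σ ^ 3 := by positivity
    linarith only [this, h2]
  have hθ : 0 ≤ 1 - μ * σ / 40 := (norm_nonneg _).trans hcb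
  have ha2' : ‖a' - P * (Pᵀ * a')‖ ≤ 0.000000001 * σ ^ 2 := by
    have := mul_le_mul_of_nonneg_left hs.ha2 hθ
    linarith only [this, na2, hdd]
  have hb2' : ‖b' - Q * (Qᵀ * b')‖ ≤ 0.000000001 * σ ^ 2 := by
    have := mul_le_mul_of_nonneg_left hs.hb2 hθ
    linarith only [this, nb2, hdd]
  refine ⟨?_, ?_, ?_, ha2', hb2', ?_, ?_⟩
  · rw [ha', hG]; exact L1 P Q Sg a b D hP hQ hμ.le hμ1 he.hSg hs.ha hs.hb hB1 hD1
  · rw [hb', hGt]; exact L1 Q P Sg b a Dᵀ hQ hP hμ.le hμ1 he.hSg hs.hb hs.ha hB1' (nm_t_le hD1)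
  · have := L3 P Q Sg a b D hP hQ he.hSt hμ.le hσ.le he.hSg he.hSc hcb1 hs.ha hs.hb hs.hβ hD
    rw [← hG, ← ha', ← hb'] at this
    refine this.trans ?_
    have h1 : (1 - μ * σ + 9 * μ ^ 2) * ‖Pᵀ * a - Qᵀ * b‖ ≤
        (1 - μ * σ + 9 * μ ^ 2) * (0.000000001 * σ ^ 2) := by
      apply mul_le_mul_of_nonneg_left hs.hτ
      have := (norm_nonneg _).trans he.hSc
      positivity
    have h2 : μ * (3 * B + 6 * d) ≤ μ * (3 * (0.00000000001 * σ ^ 3) + 6 * (0.000000000002 * σ ^ 3)) := by gcongr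
    have h3 : 9 * μ ^ 2 * (0.000000001 * σ ^ 2) ≤ 9 * (μ * (0.000000001 * σ)) * (0.000000001 * σ ^ 2) := by
      rw [sq]; gcongr
    have h4 : 0 ≤ μ * σ ^ 3 := by positivity
    linarith only [h1, h2, h3, h4]
  · have := L4 a b a b G (μ := μ) (ν := 3) hs.ha hs.hb hG11 hs.ha hs.hb
    rw [← ha', ← hb'] at this
    have h1 := hs.hβ
    have h2 := sq_nonneg μ
    linarith only [this, h1, h2]
  · obtain ⟨Y, hY1, hY2⟩ := hs.hY
    have hY15 := (Y_norm he (by positivity) hY2 hΦ (B := B)).1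
    set A2 := ‖a - P * (Pᵀ * a)‖ + ‖b - Q * (Qᵀ * b)‖ with hA2
    set Ra : Matrix ρ ρ ℝ := Pᵀ * (D * b) -
      (Pᵀ * a) * ((b - Q * (Qᵀ * b))ᵀ * (b - Q * (Qᵀ * b))) with hRa
    set Rb : Matrix ρ ρ ℝ := Qᵀ * (Dᵀ * a) -
      (Qᵀ * b) * ((a - P * (Pᵀ * a))ᵀ * (a - P * (Pᵀ * a))) with hRb
    have ea : Pᵀ * a' = Pᵀ * a + μ • ((Sg - (Pᵀ * a) * (Qᵀ * b)ᵀ) * (Qᵀ * b) + Ra) := by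
      rw [ha', hG, hRa]
      simp only [Matrix.mul_add, Matrix.add_mul, Matrix.sub_mul, Matrix.mul_sub, Matrix.mul_assoc,
        Matrix.mul_smul, Matrix.smul_mul, Matrix.transpose_add, Matrix.transpose_sub,
        Matrix.transpose_mul, Matrix.transpose_transpose, pp hP, pp hQ]
      module
    have eb : Qᵀ * b' = Qᵀ * b + μ • ((Sg - (Pᵀ * a) * (Qᵀ * b)ᵀ)ᵀ * (Pᵀ * a) + Rb) := by
      rw [hb', hG, hRb]
      simp only [Matrix.mul_add, Matrix.add_mul, Matrix.sub_mul, Matrix.mul_sub, Matrix.mul_assoc,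
        Matrix.mul_smul, Matrix.smul_mul, Matrix.transpose_add, Matrix.transpose_sub,
        Matrix.transpose_mul, Matrix.transpose_transpose, pp hP, pp hQ, he.hSt]
      module
    set R := 3 * d + 3 * (0.000000001 * σ ^ 2 * A2) with hR
    have hA2a : ‖a - P * (Pᵀ * a)‖ ≤ A2 := by
      have := norm_nonneg (b - Q * (Qᵀ * b)); linarith only [this, hA2]
    have hA2b : ‖b - Q * (Qᵀ * b)‖ ≤ A2 := by
      have := norm_nonneg (a - P * (Pᵀ * a)); linarith only [this, hA2]
    have nRa : ‖Ra‖ ≤ R := by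
      have := nm_sub (nm_one_mul_le hP (nm_mul hD hs.hb))
        (nm_mul (nm_one_mul_le hP hs.ha) (nm_mul (nm_t_le hs.hb2) hA2b))
      rw [hR]; linarith only [this]
    have nRb : ‖Rb‖ ≤ R := by
      have := nm_sub (nm_one_mul_le hQ (nm_mul (nm_t_le hD) hs.ha))
        (nm_mul (nm_one_mul_le hQ hs.hb) (nm_mul (nm_t_le hs.ha2) hA2a))
      rw [hR]; linarith only [this]
    have hA2s : A2 ≤ 0.000000002 * σ ^ 2 := by linarith only [hs.ha2, hs.hb2, hA2]
    have hA20 : 0 ≤ A2 := by positivity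
    have hσ2 : σ ^ 2 ≤ 1 := pow_le_one₀ hσ.le hσ1
    have hRs : R ≤ 0.001 * σ := by
      have h1 : 0.000000001 * σ ^ 2 * A2 ≤ 0.000000001 * 1 * (0.000000002 * σ ^ 2) := by gcongr
      have h2 : σ ^ 3 ≤ σ := by
        calc σ ^ 3 = σ * σ ^ 2 := by ring
          _ ≤ σ * 1 := by gcongr
          _ = σ := mul_one _
      have h3 : σ ^ 2 ≤ σ := by nlinarith only [hσ, hσ1]
      linarith only [h1, h2, h3, hd, hR, hσ]
    obtain ⟨Y', hY'1, hY'2⟩ := Ystep (Pᵀ * a) (Qᵀ * b) Sg Si Y Ra Rb hσ hσ1 hμ hμs hY1 he.hSS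
      he.hSg he.hSc he.hSi (nm_one_mul_le hP hs.ha) (nm_one_mul_le hQ hs.hb) hs.hτ hY15 nRa nRb hRs
    rw [← ea, ← eb] at hY'1
    refine ⟨Y', hY'1, ?_⟩
    have hsum : (‖a' - P * (Pᵀ * a')‖ + ‖b' - Q * (Qᵀ * b')‖) / σ ≤
        ((1 - μ * σ / 40) * A2 + 6 * μ * d) / σ := by
      apply div_le_div_of_nonneg_right _ hσ.le
      linarith only [na2, nb2, hA2]
    have e1 : ((1 - μ * σ / 40) * A2 + 6 * μ * d) / σ =
        (1 - μ * σ / 40) * (A2 / σ) + 6 * (μ * d / σ) := by ring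
    have e2 : 3000 * μ * R / σ ^ 2 = 9000 * (μ * d / σ ^ 2) + 0.000009 * ((μ * σ) * (A2 / σ)) := by
      rw [hR]; field_simp; ring
    have e3 : 10000 * μ * d / σ ^ 2 = 10000 * (μ * d / σ ^ 2) := by ring
    have e4 : μ * d / σ ≤ μ * d / σ ^ 2 := by
      apply div_le_div_of_nonneg_left (by positivity) (by positivity)
      nlinarith only [hσ, hσ1]
    have e5 : 0 ≤ μ * d / σ ^ 2 := by positivity
    have e6 : (1 - μ * σ / 50) * (‖Y - Si‖ + A2 / σ) ≤ (1 - μ * σ / 50) * Φ := by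
      apply mul_le_mul_of_nonneg_left hY2; linarith only [hθ, hμσ0]
    have e7 : 0 ≤ (μ * σ) * (A2 / σ) := by positivity
    have e8 : 0 ≤ (μ * σ) * ‖Y - Si‖ := by positivity
    rw [e1] at hsum
    rw [e2] at hY'2
    rw [e3]
    linarith only [hsum, hY'2, e4, e5, e6, e7, e8]

end Step2


section Noise
variable {ι₁ ι₂ ρ η : Type*} [Fintype ι₁] [Fintype ι₂] [Fintype ρ] [Fintype η]
  [DecidableEq ι₁] [DecidableEq ι₂] [DecidableEq ρ] [DecidableEq η]

def Noi (P : Matrix ι₁ ρ ℝ) (Q : Matrix ι₂ ρ ℝ) (σ Ψ : ℝ)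
    (a : Matrix ι₁ ρ ℝ) (b : Matrix ι₂ ρ ℝ) (u : Matrix ι₁ η ℝ) (w : Matrix ι₂ η ℝ) : Prop :=
  ∃ α : Matrix ρ η ℝ, Pᵀ * u + Qᵀ * w = (Pᵀ * a + Qᵀ * b) * α ∧
    ‖α‖ + ‖u - P * (Pᵀ * u)‖ + ‖w - Q * (Qᵀ * w)‖ + ‖aᵀ * u - bᵀ * w‖ / σ ≤ Ψ

lemma noi_bound {P : Matrix ι₁ ρ ℝ} {Q : Matrix ι₂ ρ ℝ} {Sg Si : Matrix ρ ρ ℝ} {μ σ B Φ Ψ : ℝ}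
    {a : Matrix ι₁ ρ ℝ} {b : Matrix ι₂ ρ ℝ} {u : Matrix ι₁ η ℝ} {w : Matrix ι₂ η ℝ}
    (he : Env P Q Sg Si μ σ) (hs : Sig P Q Si σ B Φ a b) (hΦ : Φ ≤ 15 / σ)
    (α : Matrix ρ η ℝ) (hα : Pᵀ * u + Qᵀ * w = (Pᵀ * a + Qᵀ * b) * α)
    (hΨ : ‖α‖ + ‖u - P * (Pᵀ * u)‖ + ‖w - Q * (Qᵀ * w)‖ + ‖aᵀ * u - bᵀ * w‖ / σ ≤ Ψ) :
    ‖u‖ ≤ 10 * Ψ ∧ ‖w‖ ≤ 10 * Ψ := by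
  have hP := he.hP
  have hQ := he.hQ
  have hσ := he.hσ
  have hσ1 := he.hσ1
  obtain ⟨J, hJ1, hJ2, hJ3⟩ := s_inv he hs hΦ
  set x1 := ‖α‖ with hx1
  set x2 := ‖u - P * (Pᵀ * u)‖ with hx2
  set x3 := ‖w - Q * (Qᵀ * w)‖ with hx3
  set x4 := ‖aᵀ * u - bᵀ * w‖ with hx4
  have y1 : 0 ≤ x1 := norm_nonneg _
  have y2 : 0 ≤ x2 := norm_nonneg _
  have y3 : 0 ≤ x3 := norm_nonneg _
  have y4 : 0 ≤ x4 := norm_nonneg _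
  have y5 : 0 ≤ x4 / σ := by positivity
  have hp : ‖Pᵀ * u + Qᵀ * w‖ ≤ (3 + 3) * x1 := by
    rw [hα]
    exact nm_mul (nm_add (nm_one_mul_le hP hs.ha) (nm_one_mul_le hQ hs.hb)) le_rfl
  have hq : Pᵀ * u - Qᵀ * w = Jᵀ * ((2 : ℝ) • ((aᵀ * u - bᵀ * w)
      - ((a - P * (Pᵀ * a))ᵀ * (u - P * (Pᵀ * u)) - (b - Q * (Qᵀ * b))ᵀ * (w - Q * (Qᵀ * w))))
      - (Pᵀ * a - Qᵀ * b)ᵀ * (Pᵀ * u + Qᵀ * w)) := by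
    have e : (2 : ℝ) • ((aᵀ * u - bᵀ * w)
      - ((a - P * (Pᵀ * a))ᵀ * (u - P * (Pᵀ * u)) - (b - Q * (Qᵀ * b))ᵀ * (w - Q * (Qᵀ * w))))
      - (Pᵀ * a - Qᵀ * b)ᵀ * (Pᵀ * u + Qᵀ * w) =
      (Pᵀ * a + Qᵀ * b)ᵀ * (Pᵀ * u - Qᵀ * w) := by
      simp only [Matrix.mul_add, Matrix.add_mul, Matrix.sub_mul, Matrix.mul_sub, Matrix.mul_assoc,
        Matrix.mul_smul, Matrix.smul_mul, Matrix.transpose_add, Matrix.transpose_sub,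
        Matrix.transpose_mul, Matrix.transpose_transpose, pp hP, pp hQ]
      module
    rw [e, ← Matrix.mul_assoc, ← Matrix.transpose_mul, hJ2, Matrix.transpose_one, Matrix.one_mul]
  have hqn : ‖Pᵀ * u - Qᵀ * w‖ ≤ 5 / σ * (2 * (x4 + (0.000000001 * σ ^ 2 * x2 + 0.000000001 * σ ^ 2 * x3)) +
      0.000000001 * σ ^ 2 * ((3 + 3) * x1)) := by
    rw [hq]
    exact nm_mul (nm_t_le hJ3) (nm_sub (nm_smul (by norm_num) (nm_sub le_rfl
      (nm_sub (nm_mul (nm_t_le hs.ha2) le_rfl) (nm_mul (nm_t_le hs.hb2) le_rfl))))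
      (nm_mul (nm_t_le hs.hτ) hp))
  have e1 : 5 / σ * (2 * (x4 + (0.000000001 * σ ^ 2 * x2 + 0.000000001 * σ ^ 2 * x3)) +
      0.000000001 * σ ^ 2 * ((3 + 3) * x1)) = 10 * (x4 / σ) + σ * (0.00000001 * (x2 + x3) + 0.00000003 * x1) := by
    field_simp; ring
  rw [e1] at hqn
  have e2 : σ * (0.00000001 * (x2 + x3) + 0.00000003 * x1) ≤ 0.00000001 * (x2 + x3) + 0.00000003 * x1 :=
    mul_le_of_le_one_left (by positivity) hσ1
  have hu1 : u = P * ((1 / 2 : ℝ) • ((Pᵀ * u + Qᵀ * w) + (Pᵀ * u - Qᵀ * w))) +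
      (u - P * (Pᵀ * u)) := by
    have : (1 / 2 : ℝ) • ((Pᵀ * u + Qᵀ * w) + (Pᵀ * u - Qᵀ * w)) = Pᵀ * u := by module
    rw [this]; abel
  have hw1 : w = Q * ((1 / 2 : ℝ) • ((Pᵀ * u + Qᵀ * w) - (Pᵀ * u - Qᵀ * w))) +
      (w - Q * (Qᵀ * w)) := by
    have : (1 / 2 : ℝ) • ((Pᵀ * u + Qᵀ * w) - (Pᵀ * u - Qᵀ * w)) = Qᵀ * w := by module
    rw [this]; abel
  constructor
  · have h1 : ‖u‖ ≤ 1 / 2 * ((3 + 3) * x1 + (10 * (x4 / σ) + σ * (0.00000001 * (x2 + x3) + 0.00000003 * x1))) + x2 := by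
      conv_lhs => rw [hu1]
      exact nm_add (nm_one_mul_le2 hP (nm_smul (by norm_num) (nm_add hp hqn))) le_rfl
    linarith only [h1, hΨ, e2, y1, y2, y3, y5]
  · have h1 : ‖w‖ ≤ 1 / 2 * ((3 + 3) * x1 + (10 * (x4 / σ) + σ * (0.00000001 * (x2 + x3) + 0.00000003 * x1))) + x3 := by
      conv_lhs => rw [hw1]
      exact nm_add (nm_one_mul_le2 hQ (nm_smul (by norm_num) (nm_sub hp hqn))) le_rfl
    linarith only [h1, hΨ, e2, y1, y2, y3, y5]

set_option maxHeartbeats 1000000 in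
lemma noi_step {P : Matrix ι₁ ρ ℝ} {Q : Matrix ι₂ ρ ℝ} {Sg Si : Matrix ρ ρ ℝ}
    {μ σ B Φ B' Φ' Ψ d : ℝ}
    {a a' : Matrix ι₁ ρ ℝ} {b b' : Matrix ι₂ ρ ℝ} {u u' : Matrix ι₁ η ℝ} {w w' : Matrix ι₂ η ℝ}
    {G D : Matrix ι₁ ι₂ ℝ}
    (he : Env P Q Sg Si μ σ) (hs : Sig P Q Si σ B Φ a b) (hΦ : Φ ≤ 15 / σ)
    (hs' : Sig P Q Si σ B' Φ' a' b') (hΦ' : Φ' ≤ 15 / σ)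
    (hG : G = P * Sg * Qᵀ - a * bᵀ + D) (hD : ‖D‖ ≤ d) (hd : d ≤ 0.000000000002 * σ ^ 3)
    (ha' : a' = a + μ • (G * b)) (hb' : b' = b + μ • (Gᵀ * a))
    (hu' : u' = u + μ • (G * w)) (hw' : w' = w + μ • (Gᵀ * u))
    (hn : Noi P Q σ Ψ a b u w) :
    Noi P Q σ ((1 + μ * σ / 2400) * Ψ) a' b' u' w' := by
  have hP := he.hP
  have hQ := he.hQ
  have hσ := he.hσ
  have hσ1 := he.hσ1
  have hμ := he.hμ
  have hμs := he.hμs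
  obtain ⟨α, hα, hΨ⟩ := hn
  obtain ⟨hu, hw⟩ := noi_bound he hs hΦ α hα hΨ
  have hΨ0 : 0 ≤ Ψ := by linarith only [(norm_nonneg _).trans hu]
  have hd0 : 0 ≤ d := (norm_nonneg _).trans hD
  have hσ2 : σ ^ 2 ≤ 1 := pow_le_one₀ hσ.le hσ1
  have hσ3 : σ ^ 3 ≤ σ ^ 2 := by
    calc σ ^ 3 = σ ^ 2 * σ := by ring
      _ ≤ σ ^ 2 * 1 := by gcongr
      _ = _ := mul_one _
  have hd2 : d ≤ 0.000000000002 * σ ^ 2 := by linarith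
  have hαn : ‖α‖ ≤ Ψ := by
    have h1 := norm_nonneg (u - P * (Pᵀ * u))
    have h2 := norm_nonneg (w - Q * (Qᵀ * w))
    have h3 : 0 ≤ ‖aᵀ * u - bᵀ * w‖ / σ := by positivity
    linarith only [h1, h2, h3, hΨ]
  have hGt : Gᵀ = Q * Sg * Pᵀ - b * aᵀ + Dᵀ := by
    rw [hG]
    simp only [Matrix.transpose_add, Matrix.transpose_sub, Matrix.transpose_mul,
      Matrix.transpose_transpose, he.hSt, Matrix.mul_assoc]
  have hD1 : ‖D‖ ≤ 1 := by linarith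
  have hG11 : ‖G‖ ≤ 11 := by
    rw [hG]
    have : ‖P * Sg * Qᵀ‖ ≤ 1 * 1 * 1 :=
      nm_mul (nm_mul (nm_iso hP) he.hSg) (nm_t_le (nm_iso hQ))
    have := nm_add (nm_sub this (nm_mul hs.ha (nm_t_le hs.hb))) hD1
    linarith
  obtain ⟨J, hJ1, hJ2, hJ3⟩ := s_inv he hs' hΦ'
  have hf : ‖w - b * α‖ ≤ 10 * Ψ + 3 * Ψ := nm_sub hw (nm_mul hs.hb hαn)
  have hg : ‖u - a * α‖ ≤ 10 * Ψ + 3 * Ψ := nm_sub hu (nm_mul hs.ha hαn)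
  set f := w - b * α with hfd
  set g := u - a * α with hgd
  have hfg : Pᵀ * g = - (Qᵀ * f) := by
    rw [eq_neg_iff_add_eq_zero, hfd, hgd, Matrix.mul_sub, Matrix.mul_sub]
    have : Pᵀ * u - Pᵀ * (a * α) + (Qᵀ * w - Qᵀ * (b * α)) =
      (Pᵀ * u + Qᵀ * w) - (Pᵀ * a + Qᵀ * b) * α := by
      simp only [Matrix.add_mul, Matrix.mul_assoc]; abel
    rw [this, hα, sub_self]
  set f2 := f - Q * (Qᵀ * f) with hf2
  set g2 := g - P * (Pᵀ * g) with hg2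
  set τ := Pᵀ * a - Qᵀ * b with hτ
  set T := (Qᵀ * b * τᵀ - τ * (Qᵀ * b)ᵀ + (Pᵀ * (D * Q) - (Pᵀ * (D * Q))ᵀ)) * (Qᵀ * f)
      + ((Pᵀ * (D * f2) - (Pᵀ * a) * ((b - Q * (Qᵀ * b))ᵀ * f2))
      + (Qᵀ * (Dᵀ * g2) - (Qᵀ * b) * ((a - P * (Pᵀ * a))ᵀ * g2))) with hT
  have hTe : Pᵀ * (G * f) + Qᵀ * (Gᵀ * g) = T := by
    have hff : f = Q * (Qᵀ * f) + f2 := by rw [hf2]; abel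
    have hgg : g = - (P * (Qᵀ * f)) + g2 := by rw [hg2, hfg, Matrix.mul_neg]; abel
    have hQf2 : Qᵀ * f2 = 0 := by rw [hf2, Matrix.mul_sub, pp hQ, sub_self]
    have hPg2 : Pᵀ * g2 = 0 := by rw [hg2, Matrix.mul_sub, pp hP, sub_self]
    rw [hT]
    have e1 : Pᵀ * (G * f) + Qᵀ * (Gᵀ * g) =
      Pᵀ * (G * (Q * (Qᵀ * f) + f2)) + Qᵀ * (Gᵀ * (- (P * (Qᵀ * f)) + g2)) := by
      rw [← hff, ← hgg]
    rw [e1]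
    generalize Qᵀ * f = h
    rw [hGt, hG, hτ]
    clear_value f2 g2
    simp only [Matrix.mul_add, Matrix.add_mul, Matrix.sub_mul, Matrix.mul_sub, Matrix.mul_assoc,
        Matrix.mul_smul, Matrix.smul_mul, Matrix.transpose_add, Matrix.transpose_sub,
        Matrix.transpose_mul, Matrix.transpose_transpose, pp hP, pp hQ, hQf2, hPg2,
        Matrix.mul_zero, Matrix.mul_neg]
    abel
  have hTn : ‖T‖ ≤ 0.000000200 * σ ^ 2 * Ψ := by
    have hb1 := nm_one_mul_le hQ hs.hb
    have ha1 := nm_one_mul_le hP hs.ha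
    have hDQ : ‖Pᵀ * (D * Q)‖ ≤ d * 1 := nm_one_mul_le hP (nm_mul hD (nm_iso hQ))
    have hf2n := nm_comp_le hQ hf
    have hg2n := nm_comp_le hP hg
    have := nm_add (nm_mul (nm_add (nm_sub (nm_mul hb1 (nm_t_le hs.hτ)) (nm_mul hs.hτ (nm_t_le hb1)))
      (nm_sub hDQ (nm_t_le hDQ))) (nm_one_mul_le hQ hf))
      (nm_add (nm_sub (nm_one_mul_le hP (nm_mul hD hf2n)) (nm_mul ha1 (nm_mul (nm_t_le hs.hb2) hf2n)))
       (nm_sub (nm_one_mul_le hQ (nm_mul (nm_t_le hD) hg2n))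
        (nm_mul hb1 (nm_mul (nm_t_le hs.ha2) hg2n))))
    refine this.trans ?_
    have h1 : d * Ψ ≤ 0.000000000002 * σ ^ 2 * Ψ := mul_le_mul_of_nonneg_right hd2 hΨ0
    have h2 : 0 ≤ σ ^ 2 * Ψ := by positivity
    linarith only [h1, h2]
  refine ⟨α + J * (μ • T), ?_, ?_⟩
  · rw [Matrix.mul_add, ← Matrix.mul_assoc _ J, hJ2, Matrix.one_mul, ← hTe, hfd, hgd, ha', hb', hu',
      hw']
    have : Pᵀ * (u + μ • (G * w)) + Qᵀ * (w + μ • (Gᵀ * u)) = (Pᵀ * u + Qᵀ * w) +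
      μ • (Pᵀ * (G * w) + Qᵀ * (Gᵀ * u)) := by
      simp only [Matrix.mul_add, Matrix.mul_smul]; module
    rw [this, hα]
    simp only [Matrix.mul_add, Matrix.add_mul, Matrix.mul_sub, Matrix.mul_smul, Matrix.smul_mul,
      Matrix.mul_assoc]
    module
  · have n1 : ‖α + J * (μ • T)‖ ≤ ‖α‖ + 5 / σ * (μ * (0.000000200 * σ ^ 2 * Ψ)) :=
      nm_add le_rfl (nm_mul hJ3 (nm_smul hμ.le hTn))
    have n2 := L2u P Q Sg a u w b D hP hμ.le hs.ha2 hs.hb hD hw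
    rw [← hG, ← hu'] at n2
    have n3 := L2u Q P Sg b w u a Dᵀ hQ hμ.le hs.hb2 hs.ha (nm_t_le hD) hu
    rw [← hGt, ← hw'] at n3
    have n4 := L4 a b u w G (μ := μ) hs.ha hs.hb hG11 hu hw
    rw [← ha', ← hb', ← hu', ← hw'] at n4
    have n5 := div_le_div_of_nonneg_right n4 hσ.le
    have e1 : 5 / σ * (μ * (0.000000200 * σ ^ 2 * Ψ)) = 0.000001 * (μ * σ * Ψ) := by field_simp; norm_num <;> ring
    have e2 : (‖aᵀ * u - bᵀ * w‖ + 726 * μ ^ 2 * (10 * Ψ)) / σ = ‖aᵀ * u - bᵀ * w‖ / σ +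
      7260 * (μ * Ψ) * (μ / σ) := by ring
    have e3 : μ / σ ≤ 0.000000001 * σ := by
      rw [div_le_iff₀ hσ]
      have : σ ^ 4 ≤ σ ^ 2 := by
        calc σ ^ 4 = σ ^ 2 * σ ^ 2 := by ring
          _ ≤ σ ^ 2 * 1 := by gcongr
          _ = _ := mul_one _
      nlinarith only [this, hμs]
    have e4 : 7260 * (μ * Ψ) * (μ / σ) ≤ 7260 * (μ * Ψ) * (0.000000001 * σ) :=
      mul_le_mul_of_nonneg_left e3 (by positivity)
    have e5 : μ * ((d + 3 * (0.000000001 * σ ^ 2)) * (10 * Ψ)) ≤ 0.00000004 * (μ * σ * Ψ) := by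
      have h3 : σ ^ 2 ≤ σ := by nlinarith only [hσ, hσ1]
      have : d + 3 * (0.000000001 * σ ^ 2) ≤ 0.000000004 * σ := by linarith only [hd2, h3, sq_nonneg σ, hσ]
      calc _ ≤ μ * (0.000000004 * σ * (10 * Ψ)) := by gcongr
        _ = _ := by ring
    have e6 : 0 ≤ μ * σ * Ψ := by positivity
    rw [e1] at n1
    rw [e2] at n5
    linarith only [n1, n2, n3, n5, e4, e5, e6, hΨ]

end Noise


section RIP
variable {n₁ n₂ m : ℕ} {ρ : Type*} [Fintype ρ] [DecidableEq ρ]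

lemma minner_add {ι₁ ι₂ : Type*} [Fintype ι₁] [Fintype ι₂] (M N K : Matrix ι₁ ι₂ ℝ) :
    minner M (N + K) = minner M N + minner M K := by
  simp only [minner, Matrix.add_apply, mul_add, Finset.sum_add_distrib]

lemma minner_smul {ι₁ ι₂ : Type*} [Fintype ι₁] [Fintype ι₂] (c : ℝ) (M N : Matrix ι₁ ι₂ ℝ) :
    minner M (c • N) = c * minner M N := by
  simp only [minner, Matrix.smul_apply, smul_eq_mul, Finset.mul_sum]
  exact Finset.sum_congr rfl fun i _ => Finset.sum_congr rfl fun j _ => by ring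

lemma minner_comm {ι₁ ι₂ : Type*} [Fintype ι₁] [Fintype ι₂] (M N : Matrix ι₁ ι₂ ℝ) :
    minner M N = minner N M := by
  simp only [minner]
  exact Finset.sum_congr rfl fun i _ => Finset.sum_congr rfl fun j _ => by ring

lemma minner_sum {ι₁ ι₂ τ : Type*} [Fintype ι₁] [Fintype ι₂] [Fintype τ] (M : Matrix ι₁ ι₂ ℝ)
    (N : τ → Matrix ι₁ ι₂ ℝ) : minner M (∑ i, N i) = ∑ i, minner M (N i) := by
  have h0 : minner M (0 : Matrix ι₁ ι₂ ℝ) = 0 := by simp [minner]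
  classical
  induction (Finset.univ : Finset τ) using Finset.induction_on with
  | empty => simp [h0]
  | insert a s ha ih => rw [Finset.sum_insert ha, Finset.sum_insert ha, minner_add, ih]

lemma AstarA_add (A : Fin m → Matrix (Fin n₁) (Fin n₂) ℝ) (M N : Matrix (Fin n₁) (Fin n₂) ℝ) :
    AstarA A (M + N) = AstarA A M + AstarA A N := by
  simp only [AstarA, minner_add, add_smul, Finset.sum_add_distrib]

lemma AstarA_smul (A : Fin m → Matrix (Fin n₁) (Fin n₂) ℝ) (c : ℝ)
    (M : Matrix (Fin n₁) (Fin n₂) ℝ) : AstarA A (c • M) = c • AstarA A M := by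
  simp only [AstarA, minner_smul, mul_smul, Finset.smul_sum]

lemma AstarA_sub (A : Fin m → Matrix (Fin n₁) (Fin n₂) ℝ) (M N : Matrix (Fin n₁) (Fin n₂) ℝ) :
    AstarA A (M - N) = AstarA A M - AstarA A N := by
  have : M - N = M + (-1 : ℝ) • N := by module
  rw [this, AstarA_add, AstarA_smul]; module

lemma AstarA_sum {τ : Type*} [Fintype τ] (A : Fin m → Matrix (Fin n₁) (Fin n₂) ℝ)
    (N : τ → Matrix (Fin n₁) (Fin n₂) ℝ) : AstarA A (∑ i, N i) = ∑ i, AstarA A (N i) := by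
  simp only [AstarA, minner_sum, Finset.sum_smul]
  rw [Finset.sum_comm]

lemma calA_sum_mul (A : Fin m → Matrix (Fin n₁) (Fin n₂) ℝ) (M N : Matrix (Fin n₁) (Fin n₂) ℝ) :
    ∑ i, calA A M i * calA A N i = minner (AstarA A M) N := by
  rw [minner_comm, AstarA, minner_sum]
  refine Finset.sum_congr rfl fun i _ => ?_
  rw [minner_smul, calA, calA, minner_comm N]

lemma frob_sq {ι₁ ι₂ : Type*} [Fintype ι₁] [Fintype ι₂] (M : Matrix ι₁ ι₂ ℝ) :
    frobNorm M ^ 2 = minner M M := by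
  rw [frobNorm, Real.sq_sqrt (by positivity), minner]
  exact Finset.sum_congr rfl fun i _ => Finset.sum_congr rfl fun j _ => by ring

lemma frob_mul_sq {ι₁ ι₂ : Type*} [Fintype ι₁] [Fintype ι₂] [DecidableEq ι₁] [DecidableEq ι₂]
    (L : Matrix ι₁ ρ ℝ) (R : Matrix ρ ι₂ ℝ) :
    minner (L * R) (L * R) ≤ Fintype.card ρ * (‖L‖ * ‖R‖) ^ 2 := by
  have h1 : minner (L * R) (L * R) = ∑ j, euclNorm (L *ᵥ (fun i => R i j)) ^ 2 := by
    rw [minner, Finset.sum_comm]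
    refine Finset.sum_congr rfl fun j _ => ?_
    rw [euclNorm_sq]; rfl
  have h2 : ∀ j, euclNorm (L *ᵥ (fun i => R i j)) ^ 2 ≤ ‖L‖ ^ 2 * ∑ i, R i j ^ 2 := fun j => by
    have := euclNorm_mulVec_le L (fun i => R i j)
    have h3 := pow_le_pow_left₀ (euclNorm_nonneg _) this 2
    rw [mul_pow, euclNorm_sq (fun i => R i j)] at h3
    refine h3.trans (le_of_eq ?_)
    congr 1
    exact Finset.sum_congr rfl fun i _ => by ring
  have h4 : ∀ i, ∑ j, R i j ^ 2 ≤ ‖R‖ ^ 2 := fun i => by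
    have := euclNorm_mulVec_le Rᵀ (Pi.single i 1)
    have h3 := pow_le_pow_left₀ (euclNorm_nonneg _) this 2
    rw [mul_pow, euclNorm_sq, euclNorm_sq, nm_t] at h3
    simp only [Matrix.mulVec_single_one, single_dotProduct, Pi.single_eq_same, mul_one] at h3
    refine le_trans (le_of_eq ?_) h3
    exact Finset.sum_congr rfl fun i _ => by simp [Matrix.col, pow_two]
  rw [h1]
  calc _ ≤ ∑ j, ‖L‖ ^ 2 * ∑ i, R i j ^ 2 := Finset.sum_le_sum fun j _ => h2 j
    _ = ‖L‖ ^ 2 * ∑ i, ∑ j, R i j ^ 2 := by rw [← Finset.mul_sum, Finset.sum_comm]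
    _ ≤ ‖L‖ ^ 2 * ∑ i : ρ, ‖R‖ ^ 2 := by
        gcongr with i _; exact h4 i
    _ = _ := by rw [Finset.sum_const, Finset.card_univ, nsmul_eq_mul]; ring

lemma rip_polar {A : Fin m → Matrix (Fin n₁) (Fin n₂) ℝ} {s : ℕ} {δ : ℝ} (hδ : 0 ≤ δ)
    (hR : HasRIP A s δ) (M N : Matrix (Fin n₁) (Fin n₂) ℝ)
    (hr : ∀ t : ℝ, (M + t • N).rank ≤ s) :
    (minner (AstarA A M - M) N) ^ 2 ≤ δ ^ 2 * (minner M M * minner N N) := by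
  set p := minner (AstarA A M - M) N with hp
  have hp' : p = minner (AstarA A M) N - minner M N := by
    have : AstarA A M - M = AstarA A M + (-1 : ℝ) • M := by module
    rw [hp, this, minner_comm, minner_add, minner_smul, minner_comm N, minner_comm N]; ring
  have key : ∀ t : ℝ, 0 ≤ (δ * minner N N / 2) * (t * t) + (-p) * t + δ * minner M M / 2 := fun t => by
    have h1 := (hR (M + t • N) (hr t)).2
    have h2 := (hR (M + (-t) • N) (hr (-t))).1
    have hc : ∀ c : ℝ, ∑ i, calA A (M + c • N) i ^ 2 = ∑ i, calA A M i ^ 2 +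
        2 * c * minner (AstarA A M) N + c ^ 2 * ∑ i, calA A N i ^ 2 := fun c => by
      rw [← calA_sum_mul, Finset.mul_sum, Finset.mul_sum, ← Finset.sum_add_distrib,
        ← Finset.sum_add_distrib]
      refine Finset.sum_congr rfl fun i _ => ?_
      simp only [calA, minner_add, minner_smul]; ring
    have hf : ∀ c : ℝ, frobNorm (M + c • N) ^ 2 = minner M M + 2 * c * minner M N +
        c ^ 2 * minner N N := fun c => by
      rw [frob_sq, minner_add, minner_smul, minner_comm, minner_comm _ N, minner_add, minner_add,
        minner_smul, minner_smul, minner_comm N M]; ring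
    rw [hc, hf] at h1 h2
    rw [hp']
    linarith only [h1, h2]
  have := discrim_le_zero key
  rw [discrim] at this
  linarith only [this]

lemma rip_LR {A : Fin m → Matrix (Fin n₁) (Fin n₂) ℝ} {s : ℕ} {δ : ℝ} (hδ : 0 ≤ δ)
    (hR : HasRIP A s δ) (hs : Fintype.card ρ + 1 ≤ s)
    (L : Matrix (Fin n₁) ρ ℝ) (R : Matrix ρ (Fin n₂) ℝ) :
    ‖AstarA A (L * R) - L * R‖ ≤ δ * (Real.sqrt (Fintype.card ρ) * (‖L‖ * ‖R‖)) := by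
  refine norm_le_of_mulVec _ (by positivity) fun y => ?_
  set E := AstarA A (L * R) - L * R with hE
  have hr : ∀ t : ℝ, (L * R + t • Matrix.vecMulVec (E *ᵥ y) y).rank ≤ s := fun t => by
    have : L * R + t • Matrix.vecMulVec (E *ᵥ y) y =
      Matrix.fromCols L (Matrix.replicateCol Unit (E *ᵥ y)) *
        Matrix.fromRows R (t • Matrix.replicateRow Unit y) := by
      rw [Matrix.fromCols_mul_fromRows, Matrix.mul_smul, Matrix.vecMulVec_eq Unit]
    rw [this]
    refine (Matrix.rank_mul_le_left _ _).trans ((Matrix.rank_le_card_width _).trans ?_)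
    simpa using hs
  have h1 := rip_polar hδ hR (L * R) (Matrix.vecMulVec (E *ᵥ y) y) hr
  have h2 : minner (AstarA A (L * R) - L * R) (Matrix.vecMulVec (E *ᵥ y) y) = euclNorm (E *ᵥ y) ^ 2 := by
    rw [← hE, euclNorm_sq, minner]
    simp only [dotProduct, Matrix.vecMulVec_apply]
    refine Finset.sum_congr rfl fun i _ => ?_
    conv_rhs => rw [Matrix.mulVec, dotProduct, Finset.sum_mul]
    refine Finset.sum_congr rfl fun j _ => ?_
    simp only [Matrix.mulVec, dotProduct]
    ring
  have h3 : minner (Matrix.vecMulVec (E *ᵥ y) y) (Matrix.vecMulVec (E *ᵥ y) y) =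
      euclNorm (E *ᵥ y) ^ 2 * euclNorm y ^ 2 := by
    rw [euclNorm_sq, euclNorm_sq, minner, dotProduct, dotProduct, Finset.sum_mul_sum]
    refine Finset.sum_congr rfl fun i _ => Finset.sum_congr rfl fun j _ => ?_
    simp only [Matrix.vecMulVec_apply]; ring
  rw [h2, h3] at h1
  have h4 := frob_mul_sq L R
  have hx := euclNorm_nonneg (E *ᵥ y)
  set x := euclNorm (E *ᵥ y) with hxd
  rcases hx.eq_or_lt with h0 | h0
  · rw [← h0]; have := euclNorm_nonneg y; positivity
  · refine le_of_sq_le ?_ (by have := euclNorm_nonneg y; positivity)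
    have h5 : x ^ 2 * x ^ 2 ≤ x ^ 2 * (δ ^ 2 * (minner (L * R) (L * R) * euclNorm y ^ 2)) := by
      linarith only [h1]
    have h6 := le_of_mul_le_mul_left h5 (by positivity)
    refine h6.trans ?_
    rw [mul_pow, mul_pow, mul_pow, Real.sq_sqrt (by positivity), mul_assoc]
    gcongr

lemma rip_noise {k' : ℕ} {A : Fin m → Matrix (Fin n₁) (Fin n₂) ℝ} {s : ℕ} {δ ν : ℝ} (hδ : 0 ≤ δ)
    (hR : HasRIP A s δ) (hs : 2 ≤ s) (u : Matrix (Fin n₁) (Fin k') ℝ) (w : Matrix (Fin n₂) (Fin k') ℝ)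
    (hu : ‖u‖ ≤ ν) (hw : ‖w‖ ≤ ν) :
    ‖AstarA A (u * wᵀ)‖ ≤ (1 + δ * k') * ν ^ 2 := by
  have hν : 0 ≤ ν := (norm_nonneg _).trans hu
  have hcol : ∀ {n : ℕ} (u : Matrix (Fin n) (Fin k') ℝ) (j : Fin k'),
      ‖Matrix.replicateCol Unit (fun i => u i j)‖ ≤ ‖u‖ := fun u j => by
    refine norm_le_of_mulVec _ (norm_nonneg _) fun y => ?_
    have := euclNorm_mulVec_le u (Pi.single j (y ()))
    have h1 : u *ᵥ (Pi.single j (y ())) = Matrix.replicateCol Unit (fun i => u i j) *ᵥ y := by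
      ext i; simp [Matrix.mulVec, dotProduct, Pi.single_apply]
    have h2 : euclNorm (Pi.single j (y ()) : Fin k' → ℝ) = euclNorm y := by
      simp [euclNorm, Pi.single_apply]
    rwa [h1, h2] at this
  have he : u * wᵀ = ∑ j, Matrix.replicateCol Unit (fun i => u i j) *
      (Matrix.replicateCol Unit (fun i => w i j))ᵀ := by
    ext i l
    simp [Matrix.mul_apply, Matrix.sum_apply]
  have h1 : AstarA A (u * wᵀ) - u * wᵀ = ∑ j, (AstarA A (Matrix.replicateCol Unit (fun i => u i j) *
      (Matrix.replicateCol Unit (fun i => w i j))ᵀ) - Matrix.replicateCol Unit (fun i => u i j) *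
      (Matrix.replicateCol Unit (fun i => w i j))ᵀ) := by
    rw [Finset.sum_sub_distrib, ← AstarA_sum, ← he]
  have h2 : ‖AstarA A (u * wᵀ) - u * wᵀ‖ ≤ ∑ j : Fin k', δ * ν ^ 2 := by
    rw [h1]
    refine (norm_sum_le _ _).trans (Finset.sum_le_sum fun j _ => ?_)
    refine (rip_LR hδ hR (by simpa using hs) _ _).trans ?_
    rw [nm_t]
    simp only [Fintype.card_unit, Nat.cast_one, Real.sqrt_one, one_mul]
    have h3 := (hcol u j).trans hu
    have h4 := (hcol w j).trans hw
    rw [pow_two]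
    gcongr
  rw [Finset.sum_const, Finset.card_univ, Fintype.card_fin, nsmul_eq_mul] at h2
  have h3 : AstarA A (u * wᵀ) = (AstarA A (u * wᵀ) - u * wᵀ) + u * wᵀ := by abel
  rw [h3]
  have := nm_add h2 (nm_mul hu (nm_t_le hw))
  linarith only [this]

end RIP


section Window

lemma Sig.mono {ι₁ ι₂ ρ : Type*} [Fintype ι₁] [Fintype ι₂] [Fintype ρ]
    [DecidableEq ι₁] [DecidableEq ι₂] [DecidableEq ρ]
    {P : Matrix ι₁ ρ ℝ} {Q : Matrix ι₂ ρ ℝ} {Si : Matrix ρ ρ ℝ} {σ B Φ B' Φ' : ℝ}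
    {a : Matrix ι₁ ρ ℝ} {b : Matrix ι₂ ρ ℝ}
    (h : Sig P Q Si σ B Φ a b) (hB : B ≤ B') (hΦ : Φ ≤ Φ') : Sig P Q Si σ B' Φ' a b := by
  obtain ⟨Y, hY, hY2⟩ := h.hY
  exact ⟨h.ha, h.hb, h.hτ, h.ha2, h.hb2, h.hβ.trans hB, Y, hY, hY2.trans hΦ⟩

lemma E_bound {ι₁ ι₂ ρ : Type*} [Fintype ι₁] [Fintype ι₂] [Fintype ρ]
    [DecidableEq ι₁] [DecidableEq ι₂] [DecidableEq ρ]
    {P : Matrix ι₁ ρ ℝ} {Q : Matrix ι₂ ρ ℝ} {Sg Si : Matrix ρ ρ ℝ} {μ σ B Φ : ℝ}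
    {a : Matrix ι₁ ρ ℝ} {b : Matrix ι₂ ρ ℝ}
    (he : Env P Q Sg Si μ σ) (hs : Sig P Q Si σ B Φ a b) :
    ‖P * Sg * Qᵀ - a * bᵀ‖ ≤ 9 * Φ ∧ ‖a - P * (Pᵀ * a)‖ ≤ Φ := by
  have hP := he.hP
  have hQ := he.hQ
  have hσ := he.hσ
  have hσ1 := he.hσ1
  obtain ⟨Y, hY, hY2⟩ := hs.hY
  have hMY : ((Pᵀ * a) * (Qᵀ * b)ᵀ) * Y = 1 := mul_eq_one_comm.mp hY
  have h1 : Sg - (Pᵀ * a) * (Qᵀ * b)ᵀ = (Pᵀ * a) * (Qᵀ * b)ᵀ * (Y - Si) * Sg := by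
    rw [Matrix.mul_sub, hMY, Matrix.sub_mul, Matrix.one_mul, Matrix.mul_assoc _ Si, he.hSS,
      Matrix.mul_one]
  have ha1 := nm_one_mul_le hP hs.ha
  have hb1 := nm_one_mul_le hQ hs.hb
  have h2 : ‖Sg - (Pᵀ * a) * (Qᵀ * b)ᵀ‖ ≤ 3 * 3 * ‖Y - Si‖ * 1 := by
    rw [h1]
    exact nm_mul (nm_mul (nm_mul ha1 (nm_t_le hb1)) le_rfl) he.hSg
  have h3 : P * Sg * Qᵀ - a * bᵀ = P * ((Sg - (Pᵀ * a) * (Qᵀ * b)ᵀ) * Qᵀ) -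
      P * ((Pᵀ * a) * (b - Q * (Qᵀ * b))ᵀ) - (a - P * (Pᵀ * a)) * bᵀ := by
    simp only [Matrix.sub_mul, Matrix.mul_sub, Matrix.transpose_sub, Matrix.transpose_mul,
      Matrix.transpose_transpose, Matrix.mul_assoc]
    abel
  set x2 := ‖a - P * (Pᵀ * a)‖ with hx2
  set x3 := ‖b - Q * (Qᵀ * b)‖ with hx3
  have y2 : 0 ≤ x2 := norm_nonneg _
  have y3 : 0 ≤ x3 := norm_nonneg _
  have hdiv : x2 + x3 ≤ (x2 + x3) / σ := by
    rw [le_div_iff₀ hσ]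
    exact mul_le_of_le_one_right (by positivity) hσ1
  have h0 := norm_nonneg (Y - Si)
  constructor
  · rw [h3]
    have := nm_sub (nm_sub (nm_one_mul_le2 hP (nm_mul h2 (nm_t_le (nm_iso hQ))))
      (nm_one_mul_le2 hP (nm_mul ha1 (nm_t_le (le_refl x3))))) (nm_mul (le_refl x2) (nm_t_le hs.hb))
    refine this.trans ?_
    linarith only [h0, hdiv, y2, y3, hY2]
  · linarith only [h0, hdiv, y2, y3, hY2]

lemma D_bound {n₁ n₂ m r k' k : ℕ} {A : Fin m → Matrix (Fin n₁) (Fin n₂) ℝ} {δ ν : ℝ}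
    {P : Matrix (Fin n₁) (Fin r) ℝ} {Q : Matrix (Fin n₂) (Fin r) ℝ} {Sg Si : Matrix (Fin r) (Fin r) ℝ}
    {μ σ B Φ : ℝ} {a : Matrix (Fin n₁) (Fin r) ℝ} {b : Matrix (Fin n₂) (Fin r) ℝ}
    {u : Matrix (Fin n₁) (Fin k') ℝ} {w : Matrix (Fin n₂) (Fin k') ℝ}
    (he : Env P Q Sg Si μ σ) (hs : Sig P Q Si σ B Φ a b)
    (hr : 1 ≤ r) (hk : k' ≤ k) (hk1 : 1 ≤ k)
    (hδ0 : 0 ≤ δ) (hδ : δ * Real.sqrt r ≤ 0.00000000000001 * σ ^ 3) (hRIP : HasRIP A (2 * r + 1) δ)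
    (hu : ‖u‖ ≤ ν) (hw : ‖w‖ ≤ ν) :
    ‖AstarA A (P * Sg * Qᵀ - (a * bᵀ + u * wᵀ)) - (P * Sg * Qᵀ - a * bᵀ)‖ ≤
      0.00000000000012 * σ ^ 3 * Φ + 2 * k * ν ^ 2 ∧
    ‖AstarA A (P * Sg * Qᵀ - (a * bᵀ + u * wᵀ)) - (P * Sg * Qᵀ - a * bᵀ)‖ ≤
      0.00000000000013 * σ ^ 3 + 2 * k * ν ^ 2 := by
  have hP := he.hP
  have hQ := he.hQ
  have hσ := he.hσ
  have hσ1 := he.hσ1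
  obtain ⟨hE, ha2⟩ := E_bound he hs
  have hE2 : ‖P * Sg * Qᵀ - a * bᵀ‖ ≤ 1 * 1 * 1 + 3 * 3 :=
    nm_sub (nm_mul (nm_mul (nm_iso hP) he.hSg) (nm_t_le (nm_iso hQ))) (nm_mul hs.ha (nm_t_le hs.hb))
  have hσ2 : σ ^ 2 ≤ 1 := pow_le_one₀ hσ.le hσ1
  have hσ3 : σ ^ 3 ≤ 1 := pow_le_one₀ hσ.le hσ1
  have ha3 : ‖a - P * (Pᵀ * a)‖ ≤ 1 := hs.ha2.trans (by linarith only [hσ2])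
  set E := P * Sg * Qᵀ - a * bᵀ with hEd
  have hEs : E = P * (Pᵀ * E) - (a - P * (Pᵀ * a)) * bᵀ := by
    rw [hEd]
    simp only [Matrix.sub_mul, Matrix.mul_sub, Matrix.mul_assoc, pp hP]
    abel
  have hN := rip_noise hδ0 hRIP (by omega) u w hu hw
  have hr1 := rip_LR hδ0 hRIP (by simp; omega) P (Pᵀ * E)
  have hr2 := rip_LR hδ0 hRIP (by simp; omega) (a - P * (Pᵀ * a)) bᵀ
  have hD : AstarA A (P * Sg * Qᵀ - (a * bᵀ + u * wᵀ)) - E =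
     ((AstarA A (P * (Pᵀ * E)) - P * (Pᵀ * E)) -
      (AstarA A ((a - P * (Pᵀ * a)) * bᵀ) - (a - P * (Pᵀ * a)) * bᵀ)) - AstarA A (u * wᵀ) := by
    have e1 : P * Sg * Qᵀ - (a * bᵀ + u * wᵀ) = E - u * wᵀ := by rw [hEd]; abel
    rw [e1, AstarA_sub]
    conv_lhs => rw [hEs]
    rw [AstarA_sub]; abel
  simp only [Fintype.card_fin] at hr1 hr2
  have s0 := Real.sqrt_nonneg (r : ℝ)
  have hδs : 0 ≤ δ * Real.sqrt r := by positivity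
  have hs1 : 1 ≤ Real.sqrt r := Real.one_le_sqrt.mpr (by exact_mod_cast hr)
  have hδ1 : δ ≤ 1 := by
    have : δ * 1 ≤ δ * Real.sqrt r := by gcongr
    linarith only [this, hδ, hσ3]
  have hkk : (1 + δ * k') * ν ^ 2 ≤ 2 * k * ν ^ 2 := by
    have h1 : (1 : ℝ) ≤ k := by exact_mod_cast hk1
    have h2 : (k' : ℝ) ≤ k := by exact_mod_cast hk
    have h3 : δ * k' ≤ 1 * k := by gcongr
    gcongr
    linarith only [h1, h3]
  have gen : ∀ e c : ℝ, ‖E‖ ≤ e → ‖a - P * (Pᵀ * a)‖ ≤ c →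
      ‖AstarA A (P * Sg * Qᵀ - (a * bᵀ + u * wᵀ)) - E‖ ≤ 0.00000000000001 * σ ^ 3 * (e + 3 * c) + 2 * k * ν ^ 2 := by
    intro e c h1 h2
    have e0 : 0 ≤ e := (norm_nonneg _).trans h1
    have c0 : 0 ≤ c := (norm_nonneg _).trans h2
    have g1 : ‖AstarA A (P * (Pᵀ * E)) - P * (Pᵀ * E)‖ ≤ δ * Real.sqrt r * e := by
      refine hr1.trans ?_
      have : ‖P‖ * ‖Pᵀ * E‖ ≤ 1 * e :=
        mul_le_mul (nm_iso hP) (nm_one_mul_le hP h1) (norm_nonneg _) (by norm_num)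
      rw [mul_assoc]
      gcongr
      linarith only [this]
    have g2 : ‖AstarA A ((a - P * (Pᵀ * a)) * bᵀ) - (a - P * (Pᵀ * a)) * bᵀ‖ ≤
        δ * Real.sqrt r * (3 * c) := by
      refine hr2.trans ?_
      have : ‖a - P * (Pᵀ * a)‖ * ‖bᵀ‖ ≤ c * 3 :=
        mul_le_mul h2 (nm_t_le hs.hb) (norm_nonneg _) c0
      rw [mul_comm c] at this
      rw [mul_assoc]
      exact mul_le_mul_of_nonneg_left (mul_le_mul_of_nonneg_left this s0) hδ0
    rw [hD]
    refine (nm_sub (nm_sub g1 g2) (hN.trans hkk)).trans ?_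
    have : δ * Real.sqrt r * (e + 3 * c) ≤ 0.00000000000001 * σ ^ 3 * (e + 3 * c) := by gcongr
    linarith only [this]
  constructor
  · exact (gen _ _ hE ha2).trans (le_of_eq (by ring))
  · exact (gen _ _ hE2 ha3).trans (le_of_eq (by norm_num <;> ring))

set_option maxHeartbeats 1000000 in
lemma window {n₁ n₂ m r k' k : ℕ} {A : Fin m → Matrix (Fin n₁) (Fin n₂) ℝ} {δ γ B0 K1 : ℝ} {N : ℕ}
    {P : Matrix (Fin n₁) (Fin r) ℝ} {Q : Matrix (Fin n₂) (Fin r) ℝ} {Sg Si : Matrix (Fin r) (Fin r) ℝ}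
    {μ σ : ℝ} {a : ℕ → Matrix (Fin n₁) (Fin r) ℝ} {b : ℕ → Matrix (Fin n₂) (Fin r) ℝ}
    {u : ℕ → Matrix (Fin n₁) (Fin k') ℝ} {w : ℕ → Matrix (Fin n₂) (Fin k') ℝ}
    {G : ℕ → Matrix (Fin n₁) (Fin n₂) ℝ}
    (he : Env P Q Sg Si μ σ)
    (hr : 1 ≤ r) (hk : k' ≤ k) (hk1 : 1 ≤ k)
    (hδ0 : 0 ≤ δ) (hδ : δ * Real.sqrt r ≤ 0.00000000000001 * σ ^ 3) (hRIP : HasRIP A (2 * r + 1) δ)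
    (hG : ∀ t, G t = AstarA A (P * Sg * Qᵀ - (a t * (b t)ᵀ + u t * (w t)ᵀ)))
    (ha : ∀ t, a (t + 1) = a t + μ • (G t * b t)) (hb : ∀ t, b (t + 1) = b t + μ • ((G t)ᵀ * a t))
    (hu : ∀ t, u (t + 1) = u t + μ • (G t * w t)) (hw : ∀ t, w (t + 1) = w t + μ • ((G t)ᵀ * u t))
    (hs0 : Sig P Q Si σ B0 (12 / σ) (a 0) (b 0)) (hn0 : Noi P Q σ (4 * γ) (a 0) (b 0) (u 0) (w 0))
    (hγ : 0 < γ) (hB : B0 + 3000 * μ ^ 2 * N ≤ 0.00000000001 * σ ^ 3)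
    (hK : k * (10 * ((1 + μ * σ / 2400) ^ N * (4 * γ))) ^ 2 ≤ K1)
    (hK1 : K1 ≤ 0.0000000000001 * σ ^ 3) (hK2 : 1200000 * K1 / σ ^ 3 ≤ 3 / σ) :
    ∀ t ≤ N, Sig P Q Si σ (B0 + 3000 * μ ^ 2 * t)
        (12 / σ * (1 - μ * σ / 60) ^ t + 1200000 * K1 / σ ^ 3) (a t) (b t) ∧
      Noi P Q σ ((1 + μ * σ / 2400) ^ t * (4 * γ)) (a t) (b t) (u t) (w t) := by
  have hσ := he.hσ
  have hσ1 := he.hσ1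
  have hμ := he.hμ
  have hμs := he.hμs
  have hσ4 : σ ^ 4 ≤ 1 := pow_le_one₀ hσ.le hσ1
  have hK0 : 0 ≤ K1 := le_trans (by positivity) hK
  have hKs : 0 ≤ 1200000 * K1 / σ ^ 3 := by positivity
  have hμσ0 : 0 < μ * σ := mul_pos hμ hσ
  have hμσ : μ * σ ≤ 1 := by
    have : μ * σ ≤ μ * 1 := by gcongr
    linarith only [this, hμs, hσ4]
  have hq0 : 0 ≤ 1 - μ * σ / 60 := by linarith only [hμσ]
  have hq1 : 1 - μ * σ / 60 ≤ 1 := by linarith only [hμσ0]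
  have hΦb : ∀ t : ℕ, 12 / σ * (1 - μ * σ / 60) ^ t + 1200000 * K1 / σ ^ 3 ≤ 15 / σ := fun t => by
    have h1 : (1 - μ * σ / 60) ^ t ≤ 1 := pow_le_one₀ hq0 hq1
    have h2 : 12 / σ * (1 - μ * σ / 60) ^ t ≤ 12 / σ * 1 := by gcongr
    have h3 : 12 / σ * 1 + 3 / σ = 15 / σ := by ring
    linarith only [h2, h3, hK2]
  intro t
  induction t with
  | zero =>
    intro _
    refine ⟨hs0.mono (by simp) ?_, by simpa using hn0⟩
    simp only [pow_zero, mul_one]; linarith only [hKs]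
  | succ t ih =>
    intro ht
    obtain ⟨hs, hn⟩ := ih (by omega)
    have hn' := hn
    obtain ⟨α, hα, hΨ⟩ := hn'
    obtain ⟨hun, hwn⟩ := noi_bound he hs (hΦb t) α hα hΨ
    obtain ⟨hD1, hD2⟩ := D_bound he hs hr hk hk1 hδ0 hδ hRIP hun hwn
    rw [← hG t] at hD1 hD2
    have hKt : k * (10 * ((1 + μ * σ / 2400) ^ t * (4 * γ))) ^ 2 ≤ K1 := by
      refine le_trans ?_ hK
      have : (1 : ℝ) ≤ 1 + μ * σ / 2400 := by linarith only [hμσ0]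
      gcongr
      omega
    set Φ := 12 / σ * (1 - μ * σ / 60) ^ t + 1200000 * K1 / σ ^ 3 with hΦd
    have hΦ0 : 0 ≤ Φ := by positivity
    set D := G t - (P * Sg * Qᵀ - a t * (b t)ᵀ) with hDd
    have hGe : G t = P * Sg * Qᵀ - a t * (b t)ᵀ + D := by rw [hDd]; abel
    have hBt : ∀ s : ℕ, s ≤ N → B0 + 3000 * μ ^ 2 * s ≤ 0.00000000001 * σ ^ 3 := fun s hsN => by
      refine le_trans ?_ hB
      have : (s : ℝ) ≤ N := by exact_mod_cast hsN
      gcongr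
    have hd : ‖D‖ ≤ 0.000000000002 * σ ^ 3 := by
      have : 0 < σ ^ 3 := by positivity
      linarith only [hD2, hKt, hK1, this]
    have hs' := sig_step he hs (hΦb t) hGe le_rfl hd (hBt t (by omega)) (ha t) (hb t)
    have hs2 : Sig P Q Si σ (B0 + 3000 * μ ^ 2 * ((t + 1 : ℕ) : ℝ))
        (12 / σ * (1 - μ * σ / 60) ^ (t + 1) + 1200000 * K1 / σ ^ 3) (a (t + 1)) (b (t + 1)) := by
      refine hs'.mono (le_of_eq (by push_cast; ring)) ?_
      have h1 : ‖D‖ ≤ 0.00000000000012 * σ ^ 3 * Φ + 2 * K1 := by linarith only [hD1, hKt]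
      have h2 : 10000 * μ * ‖D‖ / σ ^ 2 ≤ 10000 * μ * (0.00000000000012 * σ ^ 3 * Φ + 2 * K1) / σ ^ 2 := by
        gcongr
      have h3 : 10000 * μ * (0.00000000000012 * σ ^ 3 * Φ + 2 * K1) / σ ^ 2 =
          0.0000000012 * (μ * σ * Φ) + 20000 * μ * K1 / σ ^ 2 := by
        field_simp; ring
      have h4 : 12 / σ * (1 - μ * σ / 60) ^ (t + 1) + 1200000 * K1 / σ ^ 3 =
          (1 - μ * σ / 60) * Φ + 20000 * μ * K1 / σ ^ 2 := by
        rw [hΦd, pow_succ]; field_simp; ring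
      have h5 : 0 ≤ μ * σ * Φ := by positivity
      rw [h4]
      linarith only [h2, h3, h5]
    refine ⟨hs2, ?_⟩
    have := noi_step he hs (hΦb t) hs2 (hΦb (t + 1)) hGe le_rfl hd (ha t) (hb t) (hu t) (hw t) hn
    rwa [← mul_assoc, ← pow_succ'] at this

end Window


section Final

lemma window_scal {μ σ γ κ l : ℝ} {N : ℕ} (hσ : 0 < σ) (hσ1 : σ ≤ 1) (hμ : 0 < μ) (hμ1 : μ ≤ 1)
    (hγ : 0 < γ) (hγσ : γ ≤ σ ^ 5) (hk1 : 1 ≤ κ) (hkγ : κ * γ ≤ 0.000000000000000001 * σ)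
    (hl : l = Real.log (9 / (200 * κ * γ)))
    (hN : (N : ℝ) ≤ 300 * l / (μ * σ)) (hN2 : 300 * l / (μ * σ) < N + 1) :
    γ * ((1 + μ * σ / 2400) ^ N) ^ 2 ≤ σ ^ 3 ∧
      1 / σ * (1 - μ * σ / 60) ^ N ≤ 61 * (κ * γ) := by
  set L := 9 / (200 * κ * γ) with hL
  have hκ : 0 < κ := by linarith
  have hκγ : 0 < κ * γ := by positivity
  have hL0 : 0 < L := by positivity
  have hLi : L * (κ * γ) = 9 / 200 := by rw [hL]; field_simp
  have hLσ : 1 ≤ L * σ := by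
    have : L * (κ * γ) ≤ L * (0.000000000000000001 * σ) := by gcongr
    have h2 : 0 < L * σ := by positivity
    linarith only [this, hLi, h2]
  have hL1 : 1 ≤ L := by
    have : L * σ ≤ L * 1 := by gcongr
    linarith only [this, hLσ]
  have hμσ : 0 < μ * σ := by positivity
  have hμσ1 : μ * σ ≤ 1 := mul_le_one₀ hμ1 hσ.le hσ1
  have hel : Real.exp l = L := by rw [hl, Real.exp_log hL0]
  have hNu : μ * σ * N ≤ 300 * l := by
    rw [le_div_iff₀ hμσ] at hN; linarith only [hN]
  have hNl : 300 * l - μ * σ ≤ μ * σ * N := by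
    rw [div_lt_iff₀ hμσ] at hN2; linarith only [hN2]
  constructor
  · set g := (1 + μ * σ / 2400) ^ N with hg
    have hg0 : 0 < g := by positivity
    have hg8 : g ^ 8 ≤ L := by
      have h1 : (1 + μ * σ / 2400) ≤ Real.exp (μ * σ / 2400) := by
        have := Real.add_one_le_exp (μ * σ / 2400); linarith only [this]
      calc g ^ 8 ≤ (Real.exp (μ * σ / 2400) ^ N) ^ 8 := by rw [hg]; gcongr
        _ = Real.exp ((N * 8 : ℕ) * (μ * σ / 2400)) := by rw [← pow_mul, Real.exp_nat_mul]
        _ ≤ Real.exp l := by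
          apply Real.exp_le_exp.mpr; push_cast; linarith only [hNu]
        _ = L := hel
    have h4 : (γ * g ^ 2) ^ 4 ≤ (σ ^ 3) ^ 4 := by
      have h5 : γ * L ≤ 1 := by
        have : γ * L * 1 ≤ γ * L * κ := by gcongr
        linarith only [this, hLi]
      calc (γ * g ^ 2) ^ 4 = γ ^ 4 * g ^ 8 := by ring
        _ ≤ γ ^ 4 * L := by gcongr
        _ = γ ^ 3 * (γ * L) := by ring
        _ ≤ γ ^ 3 * 1 := by gcongr
        _ = γ ^ 3 := by ring
        _ ≤ (σ ^ 5) ^ 3 := by gcongr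
        _ = (σ ^ 3) ^ 4 * σ ^ 3 := by ring
        _ ≤ (σ ^ 3) ^ 4 * 1 := by
          gcongr; exact pow_le_one₀ hσ.le hσ1
        _ = _ := by ring
    exact le_of_pow_le_pow_left₀ (by norm_num) (by positivity) h4
  · have h1 : 1 - μ * σ / 60 ≤ Real.exp (-(μ * σ / 60)) := by
      have := Real.add_one_le_exp (-(μ * σ / 60)); linarith only [this]
    have h0 : 0 ≤ 1 - μ * σ / 60 := by linarith only [hμσ1]
    have hlp : 0 ≤ l := by rw [hl]; exact Real.log_nonneg hL1
    have h2 : (1 - μ * σ / 60) ^ N ≤ Real.exp (1 - 2 * l) := by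
      calc _ ≤ Real.exp (-(μ * σ / 60)) ^ N := by gcongr
        _ = Real.exp (N * (-(μ * σ / 60))) := by rw [Real.exp_nat_mul]
        _ ≤ _ := by
          apply Real.exp_le_exp.mpr
          linarith only [hNl, hμσ1, hlp]
    have h3 : Real.exp (1 - 2 * l) = Real.exp 1 * (1 / L) * (1 / L) := by
      rw [show 1 - 2 * l = 1 + -l + -l by ring, Real.exp_add, Real.exp_add, Real.exp_neg, hel]
      simp
    have h4 : Real.exp 1 ≤ 2.7182818286 := Real.exp_one_lt_d9.le
    have h5 : 1 / L = 200 / 9 * (κ * γ) := by rw [hL]; field_simp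
    have h6 : 1 / σ * (1 / L) ≤ 1 := by
      rw [div_mul_div_comm, one_mul, div_le_one (by positivity)]; linarith only [hLσ]
    calc 1 / σ * (1 - μ * σ / 60) ^ N ≤ 1 / σ * (Real.exp 1 * (1 / L) * (1 / L)) := by
          rw [← h3]; gcongr
      _ = Real.exp 1 * (1 / L) * (1 / σ * (1 / L)) := by ring
      _ ≤ 2.7182818286 * (1 / L) * 1 := by gcongr
      _ ≤ _ := by rw [h5]; linarith only [hκγ]

lemma converge {n₁ n₂ m r k' k : ℕ} {A : Fin m → Matrix (Fin n₁) (Fin n₂) ℝ} {δ γ B0 l : ℝ}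
    {P : Matrix (Fin n₁) (Fin r) ℝ} {Q : Matrix (Fin n₂) (Fin r) ℝ} {Sg Si : Matrix (Fin r) (Fin r) ℝ}
    {μ σ : ℝ} {a : ℕ → Matrix (Fin n₁) (Fin r) ℝ} {b : ℕ → Matrix (Fin n₂) (Fin r) ℝ}
    {u : ℕ → Matrix (Fin n₁) (Fin k') ℝ} {w : ℕ → Matrix (Fin n₂) (Fin k') ℝ}
    {G : ℕ → Matrix (Fin n₁) (Fin n₂) ℝ}
    (he : Env P Q Sg Si μ σ)
    (hr : 1 ≤ r) (hk : k' ≤ k) (hk1 : 1 ≤ k)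
    (hδ0 : 0 ≤ δ) (hδ : δ * Real.sqrt r ≤ 0.00000000000001 * σ ^ 3) (hRIP : HasRIP A (2 * r + 1) δ)
    (hG : ∀ t, G t = AstarA A (P * Sg * Qᵀ - (a t * (b t)ᵀ + u t * (w t)ᵀ)))
    (ha : ∀ t, a (t + 1) = a t + μ • (G t * b t)) (hb : ∀ t, b (t + 1) = b t + μ • ((G t)ᵀ * a t))
    (hu : ∀ t, u (t + 1) = u t + μ • (G t * w t)) (hw : ∀ t, w (t + 1) = w t + μ • ((G t)ᵀ * u t))
    (hs0 : Sig P Q Si σ B0 (12 / σ) (a 0) (b 0)) (hn0 : Noi P Q σ (4 * γ) (a 0) (b 0) (u 0) (w 0))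
    (hγ : 0 < γ) (hγσ : γ ≤ σ ^ 5) (hkγ : k * γ ≤ 0.000000000000000001 * σ)
    (hl : l = Real.log (9 / (200 * k * γ)))
    (hB : B0 + 900000 * μ * l / σ ≤ 0.00000000001 * σ ^ 3) :
    ∃ N : ℕ, (N : ℝ) ≤ 300 * l / (μ * σ) ∧
      ‖P * Sg * Qᵀ - (a N * (b N)ᵀ + u N * (w N)ᵀ)‖ ≤ 20000000000 * (k * γ) := by
  have hσ := he.hσ
  have hσ1 := he.hσ1
  have hμ := he.hμ
  have hμs := he.hμs
  have hσ4 : σ ^ 4 ≤ 1 := pow_le_one₀ hσ.le hσ1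
  have hμ1 : μ ≤ 1 := by linarith only [hμs, hσ4]
  have hkr : (1 : ℝ) ≤ k := by exact_mod_cast hk1
  have hkγ0 : 0 < k * γ := by positivity
  have hL1 : (1 : ℝ) ≤ 9 / (200 * k * γ) := by
    rw [le_div_iff₀ (by positivity)]
    linarith only [hkγ, hσ1]
  have hl0 : 0 ≤ l := by rw [hl]; exact Real.log_nonneg hL1
  set N := ⌊300 * l / (μ * σ)⌋₊ with hNd
  have hN : (N : ℝ) ≤ 300 * l / (μ * σ) := Nat.floor_le (by positivity)
  have hN2 : 300 * l / (μ * σ) < N + 1 := Nat.lt_floor_add_one _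
  obtain ⟨hg, hq⟩ := window_scal hσ hσ1 hμ hμ1 hγ hγσ hkr hkγ hl hN hN2
  refine ⟨N, hN, ?_⟩
  have hσ3 : 0 < σ ^ 3 := by positivity
  have hB' : B0 + 3000 * μ ^ 2 * N ≤ 0.00000000001 * σ ^ 3 := by
    refine le_trans ?_ hB
    have : 3000 * μ ^ 2 * N ≤ 3000 * μ ^ 2 * (300 * l / (μ * σ)) := by gcongr
    have h2 : 3000 * μ ^ 2 * (300 * l / (μ * σ)) = 900000 * μ * l / σ := by field_simp; ring
    linarith only [this, h2]
  have hK : k * (10 * ((1 + μ * σ / 2400) ^ N * (4 * γ))) ^ 2 ≤ 1600 * (k * γ) * σ ^ 3 := by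
    calc _ = 1600 * (k * γ) * (γ * ((1 + μ * σ / 2400) ^ N) ^ 2) := by ring
      _ ≤ _ := by gcongr
  have hkγ1 : k * γ ≤ 0.000000000000000001 := by linarith only [hkγ, hσ1]
  have hKσ : 1200000 * (1600 * (k * γ) * σ ^ 3) / σ ^ 3 = 1920000000 * (k * γ) := by
    field_simp; norm_num
  have hσi : 1 ≤ 1 / σ := by rw [le_div_iff₀ hσ]; linarith only [hσ1]
  have key := window he hr hk hk1 hδ0 hδ hRIP hG ha hb hu hw hs0 hn0 hγ hB' hK
    (by
      have : k * γ * σ ^ 3 ≤ 0.000000000000000001 * σ ^ 3 := by gcongr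
      linarith only [this, hσ3])
    (by
      rw [hKσ]
      have : 3 / σ = 3 * (1 / σ) := by ring
      linarith only [this, hσi, hkγ1]) N le_rfl
  obtain ⟨hs, α, hα, hΨ⟩ := key
  rw [hKσ] at hs
  have hΦ : 12 / σ * (1 - μ * σ / 60) ^ N + 1920000000 * (k * γ) ≤ 2000000000 * (k * γ) := by
    have : 12 / σ * (1 - μ * σ / 60) ^ N = 12 * (1 / σ * (1 - μ * σ / 60) ^ N) := by ring
    linarith only [this, hq, hkγ0]
  have hs' := hs.mono le_rfl hΦ
  obtain ⟨hE, -⟩ := E_bound he hs'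
  obtain ⟨h1, h2⟩ := noi_bound he hs' (by
    have : 15 / σ = 15 * (1 / σ) := by ring
    linarith only [this, hσi, hkγ1]) α hα hΨ
  have e1 : P * Sg * Qᵀ - (a N * (b N)ᵀ + u N * (w N)ᵀ) =
    (P * Sg * Qᵀ - a N * (b N)ᵀ) - u N * (w N)ᵀ := by abel
  rw [e1]
  refine (nm_sub hE (nm_mul h1 (nm_t_le h2))).trans ?_
  have hσ31 : σ ^ 3 ≤ 1 := pow_le_one₀ hσ.le hσ1
  set z := 10 * ((1 + μ * σ / 2400) ^ N * (4 * γ))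
  have h3 : 1 * (z * z) ≤ k * (z * z) := mul_le_mul_of_nonneg_right hkr (mul_self_nonneg z)
  have h4 : k * γ * σ ^ 3 ≤ k * γ * 1 := by gcongr
  linarith only [h3, h4, hK, hkγ0]

end Final


section Init

lemma complete {ι α β : Type*} [Fintype ι] [Fintype α] [Fintype β] [DecidableEq ι] [DecidableEq α]
    [DecidableEq β] (L : Matrix ι α ℝ) (M : Matrix ι β ℝ) (hL : Lᵀ * L = 1) (hM : Mᵀ * M = 1)
    (hLM : Lᵀ * M = 0) (hc : Fintype.card ι = Fintype.card α + Fintype.card β) :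
    L * Lᵀ + M * Mᵀ = 1 := by
  have hML : Mᵀ * L = 0 := by
    have := congrArg Matrix.transpose hLM
    simpa [Matrix.transpose_mul] using this
  have h1 : (Matrix.fromRows Lᵀ Mᵀ) * (Matrix.fromCols L M) = 1 := by
    rw [Matrix.fromRows_mul_fromCols, hL, hM, hLM, hML, Matrix.fromBlocks_one]
  have e : α ⊕ β ≃ ι := Fintype.equivOfCardEq (by simp [hc])
  have h2 := (Matrix.mul_eq_one_comm_of_equiv e).mp h1
  rwa [Matrix.fromCols_mul_fromRows] at h2

lemma iso_card {ι α : Type*} [Fintype ι] [Fintype α] [DecidableEq ι] [DecidableEq α]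
    (L : Matrix ι α ℝ) (hL : Lᵀ * L = 1) : Fintype.card α ≤ Fintype.card ι := by
  have h1 := Matrix.rank_mul_le_left Lᵀ L
  rw [hL, Matrix.rank_one] at h1
  exact h1.trans (Matrix.rank_le_card_width _)

lemma euclNorm_iso {ι α : Type*} [Fintype ι] [Fintype α] [DecidableEq ι] [DecidableEq α]
    {L : Matrix ι α ℝ} (hL : Lᵀ * L = 1) (v : α → ℝ) : euclNorm (L *ᵥ v) = euclNorm v := by
  have h : euclNorm (L *ᵥ v) ^ 2 = euclNorm v ^ 2 := by
    rw [euclNorm_sq, euclNorm_sq, Matrix.dotProduct_mulVec, ← Matrix.mulVec_transpose,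
      Matrix.mulVec_mulVec, hL, Matrix.one_mulVec]
  exact (pow_left_inj₀ (euclNorm_nonneg _) (euclNorm_nonneg _) (by norm_num)).mp h

lemma inv_of_lower {ρ : Type*} [Fintype ρ] [DecidableEq ρ] (S : Matrix ρ ρ ℝ) {s : ℝ} (hs : 0 < s)
    (h : ∀ z, s * euclNorm z ≤ euclNorm (S *ᵥ z)) : ∃ J, J * S = 1 ∧ S * J = 1 ∧ ‖J‖ ≤ 1 / s := by
  have hu : IsUnit S := by
    rw [← Matrix.mulVec_injective_iff_isUnit]
    intro x y hxy
    have h1 := h (x - y)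
    have h2 : S *ᵥ (x - y) = 0 := by rw [Matrix.mulVec_sub]; simpa [sub_eq_zero] using hxy
    have h3 : euclNorm (0 : ρ → ℝ) = 0 := by simp [euclNorm]
    rw [h2, h3] at h1
    have h4 : euclNorm (x - y) = 0 := by nlinarith [euclNorm_nonneg (x - y)]
    exact sub_eq_zero.mp (euclNorm_eq_zero h4)
  obtain ⟨U, rfl⟩ := hu
  refine ⟨((U⁻¹ : (Matrix ρ ρ ℝ)ˣ) : Matrix ρ ρ ℝ), Units.inv_mul _, Units.mul_inv _, ?_⟩
  refine norm_le_of_mulVec _ (by positivity) fun v => ?_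
  have h1 := h (((U⁻¹ : (Matrix ρ ρ ℝ)ˣ) : Matrix ρ ρ ℝ) *ᵥ v)
  rw [Matrix.mulVec_mulVec, Units.mul_inv, Matrix.one_mulVec] at h1
  rw [div_mul_eq_mul_div, one_mul, le_div_iff₀ hs]
  linarith only [h1]

lemma lower_scale {ι α : Type*} [Fintype ι] [Fintype α] [DecidableEq ι] [DecidableEq α]
    (M : Matrix ι α ℝ) {s : ℝ} (h : ∀ z, euclNorm z = 1 → s ≤ euclNorm (M *ᵥ z)) (z : α → ℝ) :
    s * euclNorm z ≤ euclNorm (M *ᵥ z) := by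
  rcases (euclNorm_nonneg z).eq_or_lt with h0 | h0
  · rw [← h0, mul_zero]; exact euclNorm_nonneg _
  · have h1 := h ((euclNorm z)⁻¹ • z) (by
      rw [euclNorm_smul, abs_of_pos (by positivity)]; field_simp)
    rw [Matrix.mulVec_smul, euclNorm_smul, abs_of_pos (by positivity)] at h1
    rw [inv_mul_eq_div, le_div_iff₀ h0] at h1
    exact h1

lemma sigmaMin_inv {k r : ℕ} (M : Matrix (Fin r) (Fin k) ℝ) (Q : Matrix (Fin k) (Fin r) ℝ)
    (hQ : Qᵀ * Q = 1) (hM : M * Q * Qᵀ = M) {s : ℝ} (hs : 0 < s) (h : s ≤ sigmaMin M) :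
    ∃ J, J * (M * Q) = 1 ∧ ‖J‖ ≤ 1 / s := by
  rw [sigmaMin, le_max_iff] at h
  rcases h with h | h
  · obtain ⟨J, h1, -, h2⟩ := inv_of_lower (M * Q) hs (lower_scale _ fun z hz => by
      refine h.trans (csInf_le ⟨0, ?_⟩ ⟨Q *ᵥ z, by rw [euclNorm_iso hQ, hz], by
        rw [Matrix.mulVec_mulVec]⟩)
      rintro c ⟨x, -, rfl⟩; exact euclNorm_nonneg _)
    exact ⟨J, h1, h2⟩
  · obtain ⟨J, -, h1, h2⟩ := inv_of_lower (M * Q)ᵀ hs (lower_scale _ fun z hz => by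
      refine h.trans (csInf_le ⟨0, ?_⟩ ⟨z, hz, ?_⟩)
      · rintro c ⟨x, -, rfl⟩; exact euclNorm_nonneg _
      · conv_rhs => rw [← hM, Matrix.transpose_mul, Matrix.transpose_transpose,
          ← Matrix.mulVec_mulVec, euclNorm_iso hQ])
    refine ⟨Jᵀ, ?_, by rwa [nm_t]⟩
    have := congrArg Matrix.transpose h1
    rwa [Matrix.transpose_mul, Matrix.transpose_transpose, Matrix.transpose_one] at this

lemma sigmaPos_facts {n₁ n₂ r : ℕ} (hr : 1 ≤ r) (X : Matrix (Fin n₁) (Fin n₂) ℝ)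
    (P : Matrix (Fin n₁) (Fin r) ℝ) (Q : Matrix (Fin n₂) (Fin r) ℝ) (s : Fin r → ℝ)
    (hP : Pᵀ * P = 1) (hQ : Qᵀ * Q = 1) (hs : ∀ i, 0 < s i)
    (hX : X = P * Matrix.diagonal s * Qᵀ) :
    0 < sigmaPos X ∧ (∀ i, sigmaPos X ≤ s i) ∧ ∀ i, s i ≤ ‖X‖ := by
  have hXv : ∀ v, X *ᵥ v = P *ᵥ (Matrix.diagonal s *ᵥ (Qᵀ *ᵥ v)) := fun v => by
    rw [hX, ← Matrix.mulVec_mulVec, ← Matrix.mulVec_mulVec]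
  have hsingle : ∀ i : Fin r, euclNorm (Pi.single i (1 : ℝ) : Fin r → ℝ) = 1 := fun i => by
    simp [euclNorm, Pi.single_apply]
  have hXi : ∀ i : Fin r, euclNorm (X *ᵥ (Q *ᵥ (Pi.single i 1))) = s i := fun i => by
    rw [hXv, euclNorm_iso hP, Matrix.mulVec_mulVec _ Qᵀ Q, hQ, Matrix.one_mulVec]
    have : Matrix.diagonal s *ᵥ (Pi.single i 1) = s i • (Pi.single i 1 : Fin r → ℝ) := by
      ext j; simp [Matrix.mulVec_diagonal, Pi.single_apply]; split_ifs with h <;> simp [h]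
    rw [this, euclNorm_smul, hsingle, mul_one, abs_of_pos (hs i)]
  have hker : ∀ i : Fin r, ∀ y : Fin n₂ → ℝ, X *ᵥ y = 0 → (Q *ᵥ (Pi.single i 1)) ⬝ᵥ y = 0 := by
    intro i y hy
    rw [hXv] at hy
    have h1 : Matrix.diagonal s *ᵥ (Qᵀ *ᵥ y) = 0 := by
      have := congrArg (fun v => Pᵀ *ᵥ v) hy
      beta_reduce at this
      rwa [Matrix.mulVec_mulVec _ Pᵀ P, hP, Matrix.mulVec_zero, Matrix.one_mulVec] at this
    have h2 : (Qᵀ *ᵥ y) i = 0 := by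
      have := congrFun h1 i
      rw [Matrix.mulVec_diagonal, Pi.zero_apply] at this
      exact (mul_eq_zero.mp this).resolve_left (hs i).ne'
    rw [dotProduct_comm, Matrix.dotProduct_mulVec, ← Matrix.mulVec_transpose, dotProduct_single,
      h2, zero_mul]
  have : Nonempty (Fin r) := ⟨⟨0, hr⟩⟩
  obtain ⟨i0, hi0⟩ := Finite.exists_min s
  refine ⟨?_, fun i => ?_, fun i => ?_⟩
  · refine lt_of_lt_of_le (hs i0) (le_csInf ?_ ?_)
    · exact ⟨_, Q *ᵥ (Pi.single i0 1), by rw [euclNorm_iso hQ, hsingle], hker i0, rfl⟩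
    · rintro c ⟨v, hv, hvk, rfl⟩
      have h1 : X *ᵥ (v - Q *ᵥ (Qᵀ *ᵥ v)) = 0 := by
        rw [Matrix.mulVec_sub, hXv, hXv (Q *ᵥ _), Matrix.mulVec_mulVec _ Qᵀ Q, hQ, Matrix.one_mulVec,
          sub_self]
      have h2 := hvk _ h1
      have h3 : euclNorm (Qᵀ *ᵥ v) ^ 2 = 1 := by
        rw [dotProduct_sub, ← euclNorm_sq, hv, Matrix.dotProduct_mulVec, ← Matrix.mulVec_transpose,
          ← euclNorm_sq] at h2
        linarith only [h2]
      rw [hXv, euclNorm_iso hP]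
      refine le_of_sq_le ?_ (euclNorm_nonneg _)
      calc s i0 ^ 2 = s i0 ^ 2 * euclNorm (Qᵀ *ᵥ v) ^ 2 := by rw [h3, mul_one]
        _ ≤ _ := by
          rw [euclNorm_sq, euclNorm_sq, dotProduct, dotProduct, Finset.mul_sum]
          refine Finset.sum_le_sum fun i _ => ?_
          rw [Matrix.mulVec_diagonal]
          have : s i0 ^ 2 ≤ s i ^ 2 := pow_le_pow_left₀ (hs i0).le (hi0 i) 2
          nlinarith [mul_le_mul_of_nonneg_right this (mul_self_nonneg ((Qᵀ *ᵥ v) i))]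
  · refine csInf_le ⟨0, ?_⟩ ⟨Q *ᵥ (Pi.single i 1), by rw [euclNorm_iso hQ, hsingle], hker i, (hXi i).symm⟩
    rintro c ⟨x, -, -, rfl⟩; exact euclNorm_nonneg _
  · have := euclNorm_mulVec_le X (Q *ᵥ (Pi.single i 1))
    rwa [hXi, euclNorm_iso hQ, hsingle, mul_one] at this

lemma env_diag {n₁ n₂ r : ℕ} {P : Matrix (Fin n₁) (Fin r) ℝ} {Q : Matrix (Fin n₂) (Fin r) ℝ}
    {s : Fin r → ℝ} {μ σ : ℝ} (hP : Pᵀ * P = 1) (hQ : Qᵀ * Q = 1) (hσ : 0 < σ) (hσ1 : σ ≤ 1)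
    (hs : ∀ i, σ ≤ s i) (hs1 : ∀ i, s i ≤ 1) (hμ : 0 < μ) (hμs : μ ≤ 0.000000001 * σ ^ 4) :
    Env P Q (Matrix.diagonal s) (Matrix.diagonal fun i => 1 / s i) μ σ := by
  have hσ4 : σ ^ 4 ≤ 1 := pow_le_one₀ hσ.le hσ1
  have hμ1 : μ ≤ 1 := by linarith only [hμs, hσ4]
  have hs0 : ∀ i, 0 < s i := fun i => hσ.trans_le (hs i)
  refine ⟨hP, hQ, ?_, Matrix.diagonal_transpose _, ?_, ?_, ?_, hσ, hσ1, hμ, hμs⟩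
  · rw [Matrix.diagonal_mul_diagonal, ← Matrix.diagonal_one]
    congr 1; funext i; have := (hs0 i).ne'; field_simp
  · rw [Matrix.l2_opNorm_diagonal, pi_norm_le_iff_of_nonneg (by norm_num)]
    intro i; rw [Real.norm_of_nonneg (hs0 i).le]; exact hs1 i
  · have : (1 : Matrix (Fin r) (Fin r) ℝ) - μ • Matrix.diagonal s =
        Matrix.diagonal fun i => 1 - μ * s i := by
      rw [← Matrix.diagonal_one, ← Matrix.diagonal_smul, ← Matrix.diagonal_sub]; rfl
    have h0 : μ * σ ≤ 1 := mul_le_one₀ hμ1 hσ.le hσ1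
    rw [this, Matrix.l2_opNorm_diagonal, pi_norm_le_iff_of_nonneg (by linarith)]
    intro i
    have h1 : μ * s i ≤ 1 := mul_le_one₀ hμ1 (hs0 i).le (hs1 i)
    have h2 : μ * σ ≤ μ * s i := mul_le_mul_of_nonneg_left (hs i) hμ.le
    rw [Real.norm_of_nonneg (by linarith only [h1])]
    linarith only [h2]
  · rw [Matrix.l2_opNorm_diagonal, pi_norm_le_iff_of_nonneg (by positivity)]
    intro i
    have := hs0 i
    rw [Real.norm_of_nonneg (by positivity)]
    exact one_div_le_one_div_of_le hσ (hs i)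

end Init


section Init2
variable {n₁ n₂ k r : ℕ}

lemma Zstack_mul {k k' : ℕ} (V : Matrix (Fin n₁) (Fin k) ℝ) (W : Matrix (Fin n₂) (Fin k) ℝ)
    (M : Matrix (Fin k) (Fin k') ℝ) : Zstack V W * M = Zstack (V * M) (W * M) := by
  rw [Zstack, Zstack, Matrix.smul_mul, Matrix.fromRows_mul]

lemma sqrt2_inv_sq : (Real.sqrt 2)⁻¹ * (Real.sqrt 2)⁻¹ = 1 / 2 := by
  rw [← mul_inv, Real.mul_self_sqrt (by norm_num)]; norm_num

lemma Zstack_tmul {k k' : ℕ} (P : Matrix (Fin n₁) (Fin k) ℝ) (Q : Matrix (Fin n₂) (Fin k) ℝ)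
    (V : Matrix (Fin n₁) (Fin k') ℝ) (W : Matrix (Fin n₂) (Fin k') ℝ) :
    (Zstack P Q)ᵀ * Zstack V W = (1 / 2 : ℝ) • (Pᵀ * V + Qᵀ * W) := by
  rw [Zstack, Zstack, Matrix.transpose_smul, Matrix.smul_mul, Matrix.mul_smul, smul_smul,
    sqrt2_inv_sq, Matrix.transpose_fromRows, Matrix.fromCols_mul_fromRows]

lemma sqrt2_le : Real.sqrt 2 ≤ 3 / 2 := by
  rw [Real.sqrt_le_left (by norm_num)]; norm_num

lemma nm_left (V : Matrix (Fin n₁) (Fin k) ℝ) (W : Matrix (Fin n₂) (Fin k) ℝ) {x : ℝ}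
    (h : ‖Zstack V W‖ ≤ x) : ‖V‖ ≤ 3 / 2 * x := by
  have hi : (Matrix.fromRows (1 : Matrix (Fin n₁) (Fin n₁) ℝ) (0 : Matrix (Fin n₂) (Fin n₁) ℝ))ᵀ *
     (Matrix.fromRows (1 : Matrix (Fin n₁) (Fin n₁) ℝ) (0 : Matrix (Fin n₂) (Fin n₁) ℝ)) = 1 := by
    rw [Matrix.transpose_fromRows, Matrix.fromCols_mul_fromRows]; simp
  have e : V = Real.sqrt 2 • ((Matrix.fromRows (1 : Matrix (Fin n₁) (Fin n₁) ℝ)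
      (0 : Matrix (Fin n₂) (Fin n₁) ℝ))ᵀ * Zstack V W) := by
    rw [Zstack, Matrix.mul_smul, smul_smul, mul_inv_cancel₀ (by positivity), one_smul,
      Matrix.transpose_fromRows, Matrix.fromCols_mul_fromRows]; simp
  rw [e]
  have h0 : 0 ≤ x := (norm_nonneg _).trans h
  refine (nm_smul (Real.sqrt_nonneg _) (nm_one_mul_le hi h)).trans ?_
  exact mul_le_mul_of_nonneg_right sqrt2_le h0

lemma nm_right (V : Matrix (Fin n₁) (Fin k) ℝ) (W : Matrix (Fin n₂) (Fin k) ℝ) {x : ℝ}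
    (h : ‖Zstack V W‖ ≤ x) : ‖W‖ ≤ 3 / 2 * x := by
  have hi : (Matrix.fromRows (0 : Matrix (Fin n₁) (Fin n₂) ℝ) (1 : Matrix (Fin n₂) (Fin n₂) ℝ))ᵀ *
     (Matrix.fromRows (0 : Matrix (Fin n₁) (Fin n₂) ℝ) (1 : Matrix (Fin n₂) (Fin n₂) ℝ)) = 1 := by
    rw [Matrix.transpose_fromRows, Matrix.fromCols_mul_fromRows]; simp
  have e : W = Real.sqrt 2 • ((Matrix.fromRows (0 : Matrix (Fin n₁) (Fin n₂) ℝ)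
      (1 : Matrix (Fin n₂) (Fin n₂) ℝ))ᵀ * Zstack V W) := by
    rw [Zstack, Matrix.mul_smul, smul_smul, mul_inv_cancel₀ (by positivity), one_smul,
      Matrix.transpose_fromRows, Matrix.fromCols_mul_fromRows]; simp
  rw [e]
  have h0 : 0 ≤ x := (norm_nonneg _).trans h
  refine (nm_smul (Real.sqrt_nonneg _) (nm_one_mul_le hi h)).trans ?_
  exact mul_le_mul_of_nonneg_right sqrt2_le h0

lemma near_inv {ρ : Type*} [Fintype ρ] [DecidableEq ρ] {S J M : Matrix ρ ρ ℝ} {σ : ℝ}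
    (hσ : 0 < σ) (hσ1 : σ ≤ 1) (hJ : J * S = 1) (hj : ‖J‖ ^ 2 ≤ 8 / σ) (hM : ‖M - S‖ ≤ 0.0000000003 * σ ^ 2) :
    ∃ N, N * M = 1 ∧ M * N = 1 ∧ ‖N‖ ≤ 1.01 * ‖J‖ := by
  have hj0 := norm_nonneg J
  have hjσ : σ ^ 2 * ‖J‖ ≤ 3 := by
    refine le_of_sq_le ?_ (by norm_num)
    rw [le_div_iff₀ hσ] at hj
    calc (σ ^ 2 * ‖J‖) ^ 2 = σ ^ 3 * (‖J‖ ^ 2 * σ) := by ring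
      _ ≤ 1 * 8 := mul_le_mul (pow_le_one₀ hσ.le hσ1) hj (by positivity) (by norm_num)
      _ ≤ _ := by norm_num
  have h1 : ‖(M - S) * J‖ ≤ 0.000000001 := by
    refine (nm_mul hM le_rfl).trans ?_
    linarith only [hjσ]
  obtain ⟨N, hN1, hN2, hN3⟩ := inv_perturb S J M hJ (h1.trans (by norm_num))
  refine ⟨N, hN1, hN2, ?_⟩
  have hSJ : S * J = 1 := mul_eq_one_comm.mp hJ
  have e : N = J - N * ((M - S) * J) := by
    rw [Matrix.sub_mul, hSJ, Matrix.mul_sub, ← Matrix.mul_assoc, hN1, Matrix.one_mul, Matrix.mul_one]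
    abel
  rw [e]
  refine (nm_sub le_rfl (nm_mul hN3 h1)).trans ?_
  linarith only [hj0]

lemma init_sig {n₁ n₂ r k : ℕ} {P : Matrix (Fin n₁) (Fin r) ℝ} {Q : Matrix (Fin n₂) (Fin r) ℝ}
    {Sg Si : Matrix (Fin r) (Fin r) ℝ} {μ σ γ B0 : ℝ}
    (he : Env P Q Sg Si μ σ)
    (V : Matrix (Fin n₁) (Fin k) ℝ) (W : Matrix (Fin n₂) (Fin k) ℝ)
    (LXp : Matrix (Fin n₁ ⊕ Fin n₂) (Fin (n₁ + n₂ - r)) ℝ)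
    (hLXp1 : LXpᵀ * LXp = 1) (hLXp2 : (Zstack P Q)ᵀ * LXp = 0)
    (Q2 : Matrix (Fin k) (Fin r) ℝ) (hQ2 : Q2ᵀ * Q2 = 1)
    (Q2p : Matrix (Fin k) (Fin (k - r)) ℝ)
    (hQ2p : (Zstack P Q)ᵀ * Zstack V W * Q2p = 0)
    (P2 : Matrix (Fin n₁ ⊕ Fin n₂) (Fin r) ℝ) (hP2 : P2ᵀ * P2 = 1)
    (hP2' : P2 * P2ᵀ * (Zstack V W * Q2) = Zstack V W * Q2)
    (J : Matrix (Fin r) (Fin r) ℝ) (hJ : J * ((Zstack P Q)ᵀ * Zstack V W * Q2) = 1)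
    (hj : ‖J‖ ^ 2 ≤ 8 / σ)
    (h2 : ‖Zstack V W * Q2p‖ ≤ γ)
    (h3 : ‖LXpᵀ * P2‖ ≤ 0.0000000001 * σ ^ 2)
    (h4 : ‖Zstack V W‖ ≤ 2)
    (h5 : ‖(Zstack V (-W))ᵀ * Zstack V W * Q2p‖ ≤ 0.0000000001 * σ ^ 3 * γ)
    (h7 : ‖(Zstack V (-W))ᵀ * Zstack V W‖ ≤ B0) :
    Sig P Q Si σ (2 * B0) (12 / σ) (V * Q2) (W * Q2) ∧
      Noi P Q σ (4 * γ) (V * Q2) (W * Q2) (V * Q2p) (W * Q2p) := by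
  have hP := he.hP
  have hQ := he.hQ
  have hσ := he.hσ
  have hσ1 := he.hσ1
  have hσ2 : 0 < σ ^ 2 := by positivity
  have hγ0 : 0 ≤ γ := (norm_nonneg _).trans h2
  have hLL : (Zstack P Q)ᵀ * Zstack P Q = 1 := by
    rw [Zstack_tmul, hP, hQ]; module
  have hrn : r ≤ n₁ := by simpa using iso_card P hP
  have hcomp := complete (Zstack P Q) LXp hLL hLXp1 hLXp2 (by simp; omega)
  -- the error of the projection
  have hZQ : ‖Zstack V W * Q2‖ ≤ 2 * 1 := nm_mul h4 (nm_iso hQ2)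
  set S := (Zstack P Q)ᵀ * Zstack V W * Q2 with hS
  have hSe : S = (1 / 2 : ℝ) • (Pᵀ * (V * Q2) + Qᵀ * (W * Q2)) := by
    rw [hS, Matrix.mul_assoc, Zstack_mul, Zstack_tmul]
  have herr : Zstack (V * Q2 - P * S) (W * Q2 - Q * S) =
      LXp * ((LXpᵀ * P2) * (P2ᵀ * (Zstack V W * Q2))) := by
    have e1 : LXp * ((LXpᵀ * P2) * (P2ᵀ * (Zstack V W * Q2))) =
        (LXp * LXpᵀ) * (P2 * P2ᵀ * (Zstack V W * Q2)) := by simp only [Matrix.mul_assoc]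
    have e2 : LXp * LXpᵀ = 1 - Zstack P Q * (Zstack P Q)ᵀ := by rw [← hcomp]; abel
    rw [e1, hP2', e2, Matrix.sub_mul, Matrix.one_mul]
    have e3 : Zstack P Q * (Zstack P Q)ᵀ * (Zstack V W * Q2) = Zstack (P * S) (Q * S) := by
      rw [← Zstack_mul, hS]; simp only [Matrix.mul_assoc]
    rw [e3, Zstack_mul, Zstack, Zstack, Zstack, ← smul_sub]
    congr 1
    ext (i | i) j <;> simp
  have herrn : ‖Zstack (V * Q2 - P * S) (W * Q2 - Q * S)‖ ≤ 0.0000000001 * σ ^ 2 * (2 * 1) := by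
    rw [herr]
    exact nm_one_mul_le2 hLXp1 (nm_mul h3 (nm_one_mul_le hP2 hZQ))
  have hea := nm_left _ _ herrn
  have heb := nm_right _ _ herrn
  have ec : 3 / 2 * (0.0000000001 * σ ^ 2 * (2 * 1)) = 0.0000000003 * σ ^ 2 := by ring
  rw [ec] at hea heb
  have ea1 : Pᵀ * (V * Q2) - S = Pᵀ * (V * Q2 - P * S) := by rw [Matrix.mul_sub, pp hP]
  have eb1 : Qᵀ * (W * Q2) - S = Qᵀ * (W * Q2 - Q * S) := by rw [Matrix.mul_sub, pp hQ]
  have ha1 : ‖Pᵀ * (V * Q2) - S‖ ≤ 0.0000000003 * σ ^ 2 := by rw [ea1]; exact nm_one_mul_le hP hea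
  have hb1 : ‖Qᵀ * (W * Q2) - S‖ ≤ 0.0000000003 * σ ^ 2 := by rw [eb1]; exact nm_one_mul_le hQ heb
  have ha2 : ‖V * Q2 - P * (Pᵀ * (V * Q2))‖ ≤ 0.0000000003 * σ ^ 2 := by
    have : V * Q2 - P * (Pᵀ * (V * Q2)) = (V * Q2 - P * S) - P * (Pᵀ * (V * Q2 - P * S)) := by
      rw [← ea1, Matrix.mul_sub]; abel
    rw [this]; exact nm_comp_le hP hea
  have hb2 : ‖W * Q2 - Q * (Qᵀ * (W * Q2))‖ ≤ 0.0000000003 * σ ^ 2 := by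
    have : W * Q2 - Q * (Qᵀ * (W * Q2)) = (W * Q2 - Q * S) - Q * (Qᵀ * (W * Q2 - Q * S)) := by
      rw [← eb1, Matrix.mul_sub]; abel
    rw [this]; exact nm_comp_le hQ heb
  have hbal : Vᵀ * V - Wᵀ * W = (2 : ℝ) • ((Zstack V (-W))ᵀ * Zstack V W) := by
    rw [Zstack_tmul, Matrix.transpose_neg, Matrix.neg_mul]; module
  constructor
  · refine ⟨?_, ?_, ?_, ha2.trans (by linarith only [hσ2]), hb2.trans (by linarith only [hσ2]), ?_, ?_⟩
    · have := nm_mul (nm_left _ _ h4) (nm_iso hQ2); linarith only [this]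
    · have := nm_mul (nm_right _ _ h4) (nm_iso hQ2); linarith only [this]
    · have := nm_sub ha1 hb1
      rw [sub_sub_sub_cancel_right] at this
      linarith only [this, hσ2]
    · have : (V * Q2)ᵀ * (V * Q2) - (W * Q2)ᵀ * (W * Q2) = Q2ᵀ * ((Vᵀ * V - Wᵀ * W) * Q2) := by
        simp only [Matrix.transpose_mul, Matrix.mul_assoc, Matrix.sub_mul, Matrix.mul_sub]
      rw [this, hbal]
      have := nm_one_mul_le hQ2 (nm_mul (nm_smul (by norm_num : (0:ℝ) ≤ 2) h7) (nm_iso hQ2))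
      linarith only [this]
    · obtain ⟨Na, hNa1, -, hNa⟩ := near_inv hσ hσ1 hJ hj ha1
      obtain ⟨Nb, -, hNb1, hNb⟩ := near_inv hσ hσ1 hJ hj hb1
      refine ⟨Nbᵀ * Na, ?_, ?_⟩
      · rw [Matrix.mul_assoc, ← Matrix.mul_assoc Na, hNa1, Matrix.one_mul, ← Matrix.transpose_mul,
          hNb1, Matrix.transpose_one]
      · have n1 := nm_sub (nm_mul (nm_t_le hNb) hNa) he.hSi
        have n2 : (‖V * Q2 - P * (Pᵀ * (V * Q2))‖ + ‖W * Q2 - Q * (Qᵀ * (W * Q2))‖) / σ ≤ 1 / σ := by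
          have : σ ^ 2 ≤ 1 := pow_le_one₀ hσ.le hσ1
          gcongr
          linarith only [ha2, hb2, this]
        have n3 : 1.01 * ‖J‖ * (1.01 * ‖J‖) = 1.0201 * ‖J‖ ^ 2 := by ring
        have n4 : 8 / σ = 8 * (1 / σ) := by ring
        have n5 : 12 / σ = 12 * (1 / σ) := by ring
        have n6 : 0 < 1 / σ := by positivity
        rw [n3] at n1
        rw [n4] at hj
        rw [n5]
        linarith only [n1, n2, hj, n6]
  · rw [Zstack_mul] at h2
    have hu := nm_left _ _ h2
    have hw := nm_right _ _ h2
    refine ⟨0, ?_, ?_⟩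
    · rw [Matrix.mul_zero]
      rw [Matrix.mul_assoc, Zstack_mul, Zstack_tmul] at hQ2p
      exact (smul_eq_zero.mp hQ2p).resolve_left (by norm_num)
    · have e1 : (V * Q2)ᵀ * (V * Q2p) - (W * Q2)ᵀ * (W * Q2p) = Q2ᵀ * ((Vᵀ * V - Wᵀ * W) * Q2p) := by
        simp only [Matrix.transpose_mul, Matrix.mul_assoc, Matrix.sub_mul, Matrix.mul_sub]
      have n1 : ‖(V * Q2)ᵀ * (V * Q2p) - (W * Q2)ᵀ * (W * Q2p)‖ ≤ 2 * (0.0000000001 * σ ^ 3 * γ) := by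
        rw [e1, hbal, Matrix.smul_mul]
        exact nm_one_mul_le hQ2 (nm_smul (by norm_num : (0:ℝ) ≤ 2) h5)
      have n2 : ‖(V * Q2)ᵀ * (V * Q2p) - (W * Q2)ᵀ * (W * Q2p)‖ / σ ≤ γ := by
        rw [div_le_iff₀ hσ]
        refine n1.trans ?_
        have : σ ^ 3 * γ ≤ σ * γ := by
          gcongr
          calc σ ^ 3 = σ * σ ^ 2 := by ring
            _ ≤ σ * 1 := by gcongr; exact pow_le_one₀ hσ.le hσ1
            _ = σ := mul_one _
        have h0 : 0 ≤ σ * γ := by positivity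
        linarith only [this, h0]
      have n3 := nm_comp_le hP hu
      have n4 := nm_comp_le hQ hw
      rw [norm_zero]
      linarith only [n2, n3, n4, hγ0]

end Init2


section MainAux

lemma gamma_scal {σm x γ : ℝ} {k : ℕ} (hk : 1 ≤ k) (hσm : 0 < σm) (hx : 0 < x) (hγ0 : 0 < γ)
    (hσx : σm ≤ x)
    (hγ : γ ≤ 0.000000000000000001 * min (Real.sqrt σm / (x / σm) ^ ((9 : ℝ) / 2))
        (Real.sqrt x / (k : ℝ) ^ ((4 : ℝ) / 3))) :
    γ / Real.sqrt x ≤ 0.000000000000000001 * (σm / x) ^ 5 ∧ k * (γ / Real.sqrt x) ≤ 0.000000000000000001 * (σm / x) := by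
  have hy : 0 < Real.sqrt x := Real.sqrt_pos.mpr hx
  set σ := σm / x with hσd
  have hσ : 0 < σ := by positivity
  have hσ1 : σ ≤ 1 := by rw [hσd, div_le_one hx]; exact hσx
  have hk0 : (0 : ℝ) < k := by exact_mod_cast hk
  have h1 : Real.sqrt σm / (x / σm) ^ ((9 : ℝ) / 2) = Real.sqrt x * σ ^ 5 := by
    have e1 : x / σm = σ⁻¹ := by rw [hσd, inv_div]
    have e2 : Real.sqrt σm = Real.sqrt x * σ ^ ((1 : ℝ) / 2) := by
      have : σm = x * σ := by rw [hσd]; field_simp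
      rw [this, Real.sqrt_mul hx.le, ← Real.sqrt_eq_rpow]
    have e3 : σ ^ ((1 : ℝ) / 2) * σ ^ ((9 : ℝ) / 2) = σ ^ 5 := by
      rw [← Real.rpow_add hσ, ← Real.rpow_natCast]; norm_num
    rw [e1, Real.inv_rpow hσ.le, div_inv_eq_mul, e2, mul_assoc, e3]
  rw [h1] at hγ
  have ha : γ ≤ 0.000000000000000001 * (Real.sqrt x * σ ^ 5) :=
    hγ.trans (mul_le_mul_of_nonneg_left (min_le_left _ _) (by norm_num))
  have hb : γ ≤ 0.000000000000000001 * (Real.sqrt x / (k : ℝ) ^ ((4 : ℝ) / 3)) :=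
    hγ.trans (mul_le_mul_of_nonneg_left (min_le_right _ _) (by norm_num))
  have g1 : γ / Real.sqrt x ≤ 0.000000000000000001 * σ ^ 5 := by
    rw [div_le_iff₀ hy]; linarith only [ha]
  refine ⟨g1, ?_⟩
  set g := γ / Real.sqrt x with hg
  have hg0 : 0 < g := by positivity
  set q := (k : ℝ) ^ ((4 : ℝ) / 3) with hq
  have hq0 : 0 < q := by positivity
  have hq3 : q ^ 3 = (k : ℝ) ^ 4 := by
    rw [hq, ← Real.rpow_natCast, ← Real.rpow_mul hk0.le, ← Real.rpow_natCast]; norm_num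
  have g2 : q * g ≤ 0.000000000000000001 := by
    rw [hg, mul_div_assoc', div_le_iff₀ hy]
    rw [← mul_div_assoc, le_div_iff₀ hq0] at hb
    linarith only [hb]
  have h4 : (k * g) ^ 4 ≤ (0.000000000000000001 * σ) ^ 4 := by
    calc (k * g) ^ 4 = (q * g) ^ 3 * g := by rw [mul_pow, mul_pow, hq3]; ring
      _ ≤ (0.000000000000000001) ^ 3 * (0.000000000000000001 * σ ^ 5) := by gcongr
      _ = (0.000000000000000001 * σ) ^ 4 * σ := by ring
      _ ≤ (0.000000000000000001 * σ) ^ 4 * 1 := by gcongr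
      _ = _ := mul_one _
  exact le_of_pow_le_pow_left₀ (by norm_num) (by positivity) h4

lemma sym_norm {n₁ n₂ : ℕ} (E : Matrix (Fin n₁) (Fin n₂) ℝ) : ‖symMat E‖ ≤ 2 * ‖E‖ := by
  set I1 := (Matrix.fromRows (1 : Matrix (Fin n₁) (Fin n₁) ℝ) (0 : Matrix (Fin n₂) (Fin n₁) ℝ)) with h1
  set I2 := (Matrix.fromRows (0 : Matrix (Fin n₁) (Fin n₂) ℝ) (1 : Matrix (Fin n₂) (Fin n₂) ℝ)) with h2
  have hi1 : I1ᵀ * I1 = 1 := by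
    rw [h1, Matrix.transpose_fromRows, Matrix.fromCols_mul_fromRows]; simp
  have hi2 : I2ᵀ * I2 = 1 := by
    rw [h2, Matrix.transpose_fromRows, Matrix.fromCols_mul_fromRows]; simp
  have e : symMat E = I1 * (E * I2ᵀ) + I2 * (Eᵀ * I1ᵀ) := by
    rw [h1, h2, symMat]
    ext (i | i) (j | j) <;> simp [Matrix.mul_apply, Matrix.one_apply]
  rw [e]
  have := nm_add (nm_one_mul_le2 hi1 (nm_mul (le_refl ‖E‖) (nm_t_le (nm_iso hi2))))
    (nm_one_mul_le2 hi2 (nm_mul (nm_t_le (le_refl ‖E‖)) (nm_t_le (nm_iso hi1))))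
  linarith only [this]

lemma sym_eq {n₁ n₂ k : ℕ} (X : Matrix (Fin n₁) (Fin n₂) ℝ) (V : Matrix (Fin n₁) (Fin k) ℝ)
    (W : Matrix (Fin n₂) (Fin k) ℝ) :
    symMat X - Zstack V W * (Zstack V W)ᵀ + Zstack V (-W) * (Zstack V (-W))ᵀ =
      symMat (X - V * Wᵀ) := by
  simp only [Zstack, Matrix.transpose_smul, Matrix.smul_mul, Matrix.mul_smul, smul_smul,
    sqrt2_inv_sq, Matrix.transpose_fromRows, Matrix.fromRows_mul_fromCols, symMat,
    Matrix.transpose_neg, Matrix.mul_neg, Matrix.neg_mul, neg_neg]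
  have hw : W * Vᵀ = (V * Wᵀ)ᵀ := by rw [Matrix.transpose_mul, Matrix.transpose_transpose]
  rw [hw]
  ext (i | i) (j | j) <;> simp <;> ring

lemma Zstack_smul {n₁ n₂ k : ℕ} (s : ℝ) (V : Matrix (Fin n₁) (Fin k) ℝ)
    (W : Matrix (Fin n₂) (Fin k) ℝ) : Zstack (s • V) (s • W) = s • Zstack V W := by
  rw [Zstack, Zstack, smul_comm]
  congr 1
  ext (i | i) j <;> simp

end MainAux


set_option maxHeartbeats 2000000 in
theorem phase3_core {n₁ n₂ m k r : ℕ}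
    (A : Fin m → Matrix (Fin n₁) (Fin n₂) ℝ) (X : Matrix (Fin n₁) (Fin n₂) ℝ)
    (PX : Matrix (Fin n₁) (Fin r) ℝ) (QX : Matrix (Fin n₂) (Fin r) ℝ) (σX : Fin r → ℝ)
    (μ x y σ κ σm δ γ : ℝ) (hμ : 0 < μ) (hx : 0 < x) (hy : 0 < y) (hyy : y * y = x)
    (hyy' : y⁻¹ * y⁻¹ = x⁻¹) (hσm0 : 0 < σm)
    (hσd : σ = σm / x) (hσ : 0 < σ) (hσ1 : σ ≤ 1) (hκσ : κ = σ⁻¹) (hσmσ : σm = σ * x)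
    (hδ0 : 0 < δ) (hδs : δ * Real.sqrt r ≤ 0.00000000000001 * σ ^ 3)
    (he : Env PX QX (Matrix.diagonal fun i => σX i / x)
      (Matrix.diagonal fun i => 1 / (σX i / x)) (μ * x) σ)
    (hX' : PX * (Matrix.diagonal fun i => σX i / x) * QXᵀ = x⁻¹ • X)
    (hr : 1 ≤ r) (hk1 : 1 ≤ k) (hkr : (0 : ℝ) < k)
    (hRIP : HasRIP A (2 * r + 1) δ)
    (hγ0 : 0 < γ) (hg1 : γ / y ≤ 0.000000000000000001 * σ ^ 5) (hg2 : k * (γ / y) ≤ 0.000000000000000001 * σ)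
    (V : ℕ → Matrix (Fin n₁) (Fin k) ℝ) (W : ℕ → Matrix (Fin n₂) (Fin k) ℝ)
    (hVs : ∀ t, V (t + 1) = V t - μ • (AstarA A (V t * (W t)ᵀ - X) * W t))
    (hWs : ∀ t, W (t + 1) = W t - μ • ((AstarA A (V t * (W t)ᵀ - X))ᵀ * V t))
    (LX : Matrix (Fin n₁ ⊕ Fin n₂) (Fin r) ℝ) (hLX : LX = Zstack PX QX)
    (LXp : Matrix (Fin n₁ ⊕ Fin n₂) (Fin (n₁ + n₂ - r)) ℝ)
    (hLXp1 : LXpᵀ * LXp = 1) (hLXp2 : LXᵀ * LXp = 0)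
    (Q2 : Matrix (Fin k) (Fin r) ℝ) (hQ21 : Q2ᵀ * Q2 = 1)
    (hQ22 : LXᵀ * Zstack (V 0) (W 0) * Q2 * Q2ᵀ = LXᵀ * Zstack (V 0) (W 0))
    (Q2p : Matrix (Fin k) (Fin (k - r)) ℝ) (hQ2p1 : Q2pᵀ * Q2p = 1) (hQ2p2 : Q2ᵀ * Q2p = 0)
    (hQQ : Q2 * Q2ᵀ + Q2p * Q2pᵀ = 1)
    (P2 : Matrix (Fin n₁ ⊕ Fin n₂) (Fin r) ℝ) (hP2a : P2ᵀ * P2 = 1)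
    (hP2b : P2 * P2ᵀ * (Zstack (V 0) (W 0) * Q2) = Zstack (V 0) (W 0) * Q2)
    (hb1 : Real.sqrt (σm / 8) ≤ sigmaMin (LXᵀ * Zstack (V 0) (W 0)))
    (hb2 : ‖Zstack (V 0) (W 0) * Q2p‖ ≤ γ)
    (hb3 : ‖LXpᵀ * P2‖ ≤ 0.0000000001 / κ ^ 2)
    (hb4 : ‖Zstack (V 0) (W 0)‖ ≤ 2 * y)
    (hb5 : ‖(Zstack (V 0) (-(W 0)))ᵀ * Zstack (V 0) (W 0) * Q2p‖ ≤ 0.0000000001 * 1 * y / κ ^ 3 * γ)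
    (hb7 : ‖(Zstack (V 0) (-(W 0)))ᵀ * Zstack (V 0) (W 0)‖
      + 120000 * μ * Real.log (9 * y / (200 * k * γ)) * x ^ 3 / σm ≤ 0.0000000000001 / κ ^ 4 * x) :
    ∃ N : ℕ, (N : ℝ) ≤ 300 * Real.log (9 * y / (200 * k * γ)) / (μ * σm) ∧
      ‖symMat X - Zstack (V N) (W N) * (Zstack (V N) (W N))ᵀ
        + Zstack (V N) (-(W N)) * (Zstack (V N) (-(W N)))ᵀ‖ ≤ 100000000000 * k * γ * y := by
  have hzs : ‖Zstack (y⁻¹ • V 0) (y⁻¹ • W 0)‖ ≤ 2 := by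
    rw [Zstack_smul]
    refine (nm_smul (by positivity) hb4).trans (le_of_eq ?_)
    field_simp
  have hneg : Zstack (y⁻¹ • V 0) (-(y⁻¹ • W 0)) = y⁻¹ • Zstack (V 0) (-(W 0)) := by
    rw [← smul_neg, Zstack_smul]
  set l := Real.log (9 * y / (200 * k * γ)) with hld
  have hl : l = Real.log (9 / (200 * k * (γ / y))) := by
    rw [hld]; congr 1; field_simp
  -- initial inverse
  have hs8 : 0 < Real.sqrt (σm / 8) := Real.sqrt_pos.mpr (by positivity)
  obtain ⟨J, hJ1, hJ2⟩ := sigmaMin_inv (LXᵀ * Zstack (V 0) (W 0)) Q2 hQ21 hQ22 hs8 hb1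
  rw [hLX] at hJ1 hQ22 hLXp2
  have hinit := init_sig he (y⁻¹ • V 0) (y⁻¹ • W 0) LXp hLXp1 hLXp2 Q2 hQ21 Q2p
    (by
      rw [Zstack_smul, Matrix.mul_smul, Matrix.smul_mul, ← hQ22, Matrix.mul_assoc _ Q2ᵀ, hQ2p2,
        Matrix.mul_zero, smul_zero])
    P2 hP2a (by rw [Zstack_smul, Matrix.smul_mul, Matrix.mul_smul, hP2b])
    (y • J) (by
      rw [Zstack_smul, Matrix.mul_smul, Matrix.smul_mul, Matrix.smul_mul, Matrix.mul_smul, smul_smul,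
        mul_inv_cancel₀ hy.ne', one_smul, hJ1])
    (by
      have h1 := nm_smul hy.le hJ2
      have h2 := pow_le_pow_left₀ (norm_nonneg _) h1 2
      refine h2.trans (le_of_eq ?_)
      rw [mul_pow, div_pow, Real.sq_sqrt (by positivity), pow_two y, hyy, hσd]
      field_simp)
    (γ := γ / y) (B0 := x⁻¹ * ‖(Zstack (V 0) (-(W 0)))ᵀ * Zstack (V 0) (W 0)‖)
    (by
      rw [Zstack_smul, Matrix.smul_mul]
      refine (nm_smul (by positivity) hb2).trans (le_of_eq ?_)
      rw [div_eq_inv_mul])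
    (by
      refine hb3.trans (le_of_eq ?_)
      rw [hκσ]; field_simp)
    hzs
    (by
      rw [hneg, Zstack_smul, Matrix.transpose_smul, Matrix.smul_mul, Matrix.mul_smul, smul_smul,
        Matrix.smul_mul, hyy']
      refine (nm_smul (by positivity) hb5).trans (le_of_eq ?_)
      rw [hκσ, ← hyy]; field_simp)
    (by
      rw [hneg, Zstack_smul, Matrix.transpose_smul, Matrix.smul_mul, Matrix.mul_smul, smul_smul, hyy']
      exact nm_smul (by positivity) le_rfl)
  obtain ⟨hs0, hn0⟩ := hinit
  have hVW : ∀ t, (y⁻¹ • V t) * Q2 * ((y⁻¹ • W t) * Q2)ᵀ +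
      (y⁻¹ • V t) * Q2p * ((y⁻¹ • W t) * Q2p)ᵀ = x⁻¹ • (V t * (W t)ᵀ) := fun t => by
    have e : V t * (W t)ᵀ = V t * (Q2 * Q2ᵀ + Q2p * Q2pᵀ) * (W t)ᵀ := by rw [hQQ, Matrix.mul_one]
    rw [e]
    simp only [Matrix.smul_mul, Matrix.transpose_smul, Matrix.mul_smul, smul_smul, hyy',
      Matrix.transpose_mul, Matrix.mul_add, Matrix.add_mul, Matrix.mul_assoc, smul_add]
  have hG : ∀ t, AstarA A (PX * (Matrix.diagonal fun i => σX i / x) * QXᵀ -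
      ((y⁻¹ • V t) * Q2 * ((y⁻¹ • W t) * Q2)ᵀ + (y⁻¹ • V t) * Q2p * ((y⁻¹ • W t) * Q2p)ᵀ)) =
      -(x⁻¹ • AstarA A (V t * (W t)ᵀ - X)) := fun t => by
    rw [hVW, hX', ← smul_sub, AstarA_smul, AstarA_sub, AstarA_sub, ← smul_neg, neg_sub]
  have hμx : ∀ z : ℝ, μ * x * (x⁻¹ * z) = μ * z := fun z => by field_simp
  obtain ⟨N, hN1, hN2⟩ := converge (a := fun t => (y⁻¹ • V t) * Q2) (b := fun t => (y⁻¹ • W t) * Q2)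
    (u := fun t => (y⁻¹ • V t) * Q2p) (w := fun t => (y⁻¹ • W t) * Q2p)
    (G := fun t => -(x⁻¹ • AstarA A (V t * (W t)ᵀ - X)))
    he hr (Nat.sub_le k r) hk1 hδ0.le hδs hRIP (fun t => (hG t).symm)
    (fun t => by
      simp only [hVs, smul_sub, Matrix.sub_mul, Matrix.smul_mul, Matrix.mul_smul, Matrix.neg_mul,
        smul_neg, smul_smul, Matrix.mul_assoc]
      rw [mul_comm y⁻¹ x⁻¹, hμx, mul_comm μ, sub_eq_add_neg])
    (fun t => by
      simp only [hWs, smul_sub, Matrix.sub_mul, Matrix.smul_mul, Matrix.mul_smul, Matrix.neg_mul,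
        Matrix.transpose_neg, Matrix.transpose_smul, smul_neg, smul_smul, Matrix.mul_assoc]
      rw [mul_comm y⁻¹ x⁻¹, hμx, mul_comm μ, sub_eq_add_neg])
    (fun t => by
      simp only [hVs, smul_sub, Matrix.sub_mul, Matrix.smul_mul, Matrix.mul_smul, Matrix.neg_mul,
        smul_neg, smul_smul, Matrix.mul_assoc]
      rw [mul_comm y⁻¹ x⁻¹, hμx, mul_comm μ, sub_eq_add_neg])
    (fun t => by
      simp only [hWs, smul_sub, Matrix.sub_mul, Matrix.smul_mul, Matrix.mul_smul, Matrix.neg_mul,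
        Matrix.transpose_neg, Matrix.transpose_smul, smul_neg, smul_smul, Matrix.mul_assoc]
      rw [mul_comm y⁻¹ x⁻¹, hμx, mul_comm μ, sub_eq_add_neg])
    hs0 hn0 (by positivity)
    (hg1.trans (by
      have : 0 < σ ^ 5 := by positivity
      linarith only [this])) hg2 hl
    (by
      set β := ‖(Zstack (V 0) (-(W 0)))ᵀ * Zstack (V 0) (W 0)‖ with hβ
      have hβ0 : 0 ≤ β := norm_nonneg _
      have h1 := mul_le_mul_of_nonneg_left hb7 (inv_nonneg.mpr hx.le)
      have e1 : x⁻¹ * (β + 120000 * μ * l * x ^ 3 / σm) = x⁻¹ * β + 120000 * (μ * x * l / σ) := by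
        rw [hσmσ]; field_simp
      have e2 : x⁻¹ * (0.0000000000001 / κ ^ 4 * x) = 0.0000000000001 * σ ^ 4 := by rw [hκσ]; field_simp
      have e3 : 900000 * (μ * x) * l / σ = 900000 * (μ * x * l / σ) := by ring
      have e4 : σ ^ 4 ≤ σ ^ 3 := by
        calc σ ^ 4 = σ ^ 3 * σ := by ring
          _ ≤ σ ^ 3 * 1 := by gcongr
          _ = _ := mul_one _
      have e5 : 0 ≤ x⁻¹ * β := by positivity
      have e6 : 0 < σ ^ 3 := by positivity
      rw [e1, e2] at h1
      rw [e3]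
      linarith only [h1, e4, e5, e6])
  refine ⟨N, ?_, ?_⟩
  · refine hN1.trans (le_of_eq ?_)
    rw [hσmσ]; congr 1; ring
  · rw [sym_eq]
    refine (sym_norm _).trans ?_
    beta_reduce at hN2
    rw [hVW, hX', ← smul_sub, norm_smul, Real.norm_of_nonneg (by positivity), inv_mul_eq_div,
      div_le_iff₀ hx] at hN2
    have e : 20000000000 * (k * (γ / y)) * x = 20000000000 * (k * γ * y) := by
      rw [← hyy]; field_simp
    rw [e] at hN2
    have : 0 ≤ k * γ * y := by positivity
    linarith only [hN2, this]


set_option maxHeartbeats 1000000 in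
theorem phase3_aux :
    ∃ c1 c2 c3 c4 c5 c6 c7 C : ℝ,
      0 < c1 ∧ 0 < c2 ∧ 0 < c3 ∧ 0 < c4 ∧ 0 < c5 ∧ 0 < c6 ∧ 0 < c7 ∧ 0 < C ∧
    ∀
    (n₁ n₂ m k r : ℕ)
    (A : Fin m → Matrix (Fin n₁) (Fin n₂) ℝ) (X : Matrix (Fin n₁) (Fin n₂) ℝ)
    (PX : Matrix (Fin n₁) (Fin r) ℝ) (QX : Matrix (Fin n₂) (Fin r) ℝ) (σX : Fin r → ℝ)
    (hPX : PXᵀ * PX = 1) (hQX : QXᵀ * QX = 1)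
    (hσpos : ∀ i, 0 < σX i) (hσanti : Antitone σX)
    (hXsvd : X = PX * Matrix.diagonal σX * QXᵀ)
    (μ : ℝ) (hμ : 0 < μ)
    (V₀ : Matrix (Fin n₁) (Fin k) ℝ) (W₀ : Matrix (Fin n₂) (Fin k) ℝ)
    (Z Z' : ℕ → Matrix (Fin n₁ ⊕ Fin n₂) (Fin k) ℝ)
    (hZ : Z = Zit A X μ V₀ W₀) (hZ' : Z' = Ztil A X μ V₀ W₀)
    (LX : Matrix (Fin n₁ ⊕ Fin n₂) (Fin r) ℝ) (hLX : LX = Zstack PX QX)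
    (κ σm : ℝ) (hκ : κ = condNum X) (hσm : σm = sigmaPos X)
    (LXp : Matrix (Fin n₁ ⊕ Fin n₂) (Fin (n₁ + n₂ - r)) ℝ)
    (hLXp1 : LXpᵀ * LXp = 1) (hLXp2 : LXᵀ * LXp = 0)
    (δ : ℝ) (hδ0 : 0 < δ) (hδ : δ < c1 / (κ ^ 3 * Real.sqrt r))
    (hRIP : HasRIP A (2 * r + 1) δ)
    (hμbound : μ ≤ c2 / (κ ^ 4 * specNorm X))
    (t₂ : ℕ) (γ : ℝ) (hγ0 : 0 < γ)
    (hγ : γ ≤ c3 * min (Real.sqrt σm / κ ^ ((9 : ℝ) / 2))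
        (Real.sqrt (specNorm X) / (k : ℝ) ^ ((4 : ℝ) / 3)))
    (Q2 : Matrix (Fin k) (Fin r) ℝ) (hQ21 : Q2ᵀ * Q2 = 1)
    (hQ22 : LXᵀ * Z t₂ * Q2 * Q2ᵀ = LXᵀ * Z t₂)
    (Q2p : Matrix (Fin k) (Fin (k - r)) ℝ) (hQ2p1 : Q2pᵀ * Q2p = 1) (hQ2p2 : Q2ᵀ * Q2p = 0)
    (P2 : Matrix (Fin n₁ ⊕ Fin n₂) (Fin r) ℝ) (hP2 : IsOrthCol P2 (Z t₂ * Q2))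
    (hb1 : Real.sqrt (σm / 8) ≤ sigmaMin (LXᵀ * Z t₂))
    (hb2 : specNorm (Z t₂ * Q2p) ≤ γ)
    (hb3 : specNorm (LXpᵀ * P2) ≤ c4 / κ ^ 2)
    (hb4 : specNorm (Z t₂) ≤ 2 * Real.sqrt (specNorm X))
    (hb5 : specNorm ((Z' t₂)ᵀ * Z t₂ * Q2p) ≤ c4 * c5 * Real.sqrt (specNorm X) / κ ^ 3 * γ)
    (hb6 : specNorm ((Z' t₂)ᵀ * P2) ≤ c4 * c6 * Real.sqrt (specNorm X) / κ ^ 3)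
    (hb7 : specNorm ((Z' t₂)ᵀ * Z t₂)
      + 120000 * μ * Real.log (9 * Real.sqrt (specNorm X) / (200 * k * γ))
        * specNorm X ^ 3 / σm
      ≤ c7 / κ ^ 4 * specNorm X),
    ∃ t₃ : ℕ, t₂ ≤ t₃ ∧
      ((t₃ - t₂ : ℕ) : ℝ)
        ≤ 300 * Real.log (9 * Real.sqrt (specNorm X) / (200 * k * γ)) / (μ * σm) ∧
      specNorm (symMat X - Z t₃ * (Z t₃)ᵀ + Z' t₃ * (Z' t₃)ᵀ)
        ≤ C * k * γ * Real.sqrt (specNorm X) := by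
  refine ⟨0.00000000000001, 0.000000001, 0.000000000000000001, 0.0000000001, 1, 1, 0.0000000000001, 100000000000, by norm_num, by norm_num, by norm_num,
    by norm_num, by norm_num, by norm_num, by norm_num, by norm_num, ?_⟩
  intro n₁ n₂ m k r A X PX QX σX hPX hQX hσpos hσanti hXsvd μ hμ V₀ W₀ Z Z' hZ hZ' LX hLX κ σm hκ hσm
    LXp hLXp1 hLXp2 δ hδ0 hδ hRIP hμbound t₂ γ hγ0 hγ Q2 hQ21 hQ22 Q2p hQ2p1 hQ2p2 P2 hP2 hb1 hb2 hb3
    hb4 hb5 hb6 hb7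
  obtain ⟨hP2a, -, hP2b⟩ := hP2
  simp only [specNorm_eq] at *
  have hr : 1 ≤ r := by
    rcases Nat.eq_zero_or_pos r with h | h
    · rw [h] at hδ
      simp only [Nat.cast_zero, Real.sqrt_zero, mul_zero, div_zero] at hδ
      linarith only [hδ, hδ0]
    · exact h
  obtain ⟨hσm0, hσmle, hσXle⟩ := sigmaPos_facts hr X PX QX σX hPX hQX hσpos hXsvd
  rw [← hσm] at hσm0 hσmle
  have hrk : r ≤ k := by simpa using iso_card Q2 hQ21
  have hk1 : 1 ≤ k := hr.trans hrk
  have hkr : (0 : ℝ) < k := by exact_mod_cast hk1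
  set x := ‖X‖ with hxd
  have hσx : σm ≤ x := (hσmle ⟨0, hr⟩).trans (hσXle _)
  have hx : 0 < x := hσm0.trans_le hσx
  have hκ' : κ = x / σm := by rw [hκ, condNum, specNorm_eq, hσm]
  rw [hκ'] at hγ
  obtain ⟨hg1, hg2⟩ := gamma_scal hk1 hσm0 hx hγ0 hσx hγ
  set y := Real.sqrt x with hyd
  have hy : 0 < y := Real.sqrt_pos.mpr hx
  have hyy : y * y = x := Real.mul_self_sqrt hx.le
  have hyy' : y⁻¹ * y⁻¹ = x⁻¹ := by rw [← mul_inv, hyy]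
  set σ := σm / x with hσd
  have hσ : 0 < σ := by positivity
  have hσ1 : σ ≤ 1 := by rw [hσd, div_le_one hx]; exact hσx
  have hκσ : κ = σ⁻¹ := by rw [hκ', hσd, inv_div]
  have hσmσ : σm = σ * x := by rw [hσd]; field_simp
  have hδs : δ * Real.sqrt r ≤ 0.00000000000001 * σ ^ 3 := by
    have hsr : 0 < Real.sqrt r := Real.sqrt_pos.mpr (by exact_mod_cast hr)
    rw [hκσ, lt_div_iff₀ (by positivity)] at hδ
    have := mul_le_mul_of_nonneg_right hδ.le (pow_nonneg hσ.le 3)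
    have e : δ * (σ⁻¹ ^ 3 * Real.sqrt r) * σ ^ 3 = δ * Real.sqrt r := by field_simp
    rwa [e] at this
  have hμs : μ * x ≤ 0.000000001 * σ ^ 4 := by
    rw [hκσ, le_div_iff₀ (by positivity)] at hμbound
    have := mul_le_mul_of_nonneg_right hμbound (pow_nonneg hσ.le 4)
    have e : μ * (σ⁻¹ ^ 4 * x) * σ ^ 4 = μ * x := by field_simp
    rwa [e] at this
  have he : Env PX QX (Matrix.diagonal fun i => σX i / x)
      (Matrix.diagonal fun i => 1 / (σX i / x)) (μ * x) σ :=
    env_diag hPX hQX hσ hσ1 (fun i => by rw [hσd]; gcongr; exact hσmle i)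
      (fun i => by rw [div_le_one hx]; exact hσXle i) (by positivity) hμs
  have hX' : PX * (Matrix.diagonal fun i => σX i / x) * QXᵀ = x⁻¹ • X := by
    have : (Matrix.diagonal fun i => σX i / x) = x⁻¹ • Matrix.diagonal σX := by
      rw [← Matrix.diagonal_smul]; congr 1; funext i; simp [div_eq_inv_mul]
    rw [this, Matrix.mul_smul, Matrix.smul_mul, ← hXsvd]
  have hQQ : Q2 * Q2ᵀ + Q2p * Q2pᵀ = 1 := complete Q2 Q2p hQ21 hQ2p1 hQ2p2 (by simp; omega)
  have hZt : ∀ t, Z (t₂ + t) = Zstack (iter A X μ V₀ W₀ (t₂ + t)).1 (iter A X μ V₀ W₀ (t₂ + t)).2 :=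
    fun t => by rw [hZ]; rfl
  have hZt' : ∀ t, Z' (t₂ + t) =
      Zstack (iter A X μ V₀ W₀ (t₂ + t)).1 (-(iter A X μ V₀ W₀ (t₂ + t)).2) :=
    fun t => by rw [hZ']; rfl
  have hZ0 := hZt 0
  have hZ0' := hZt' 0
  rw [Nat.add_zero] at hZ0 hZ0'
  rw [hZ0] at hQ22 hP2b hb1 hb2 hb4 hb5 hb7
  rw [hZ0'] at hb5 hb7
  obtain ⟨N, hN1, hN2⟩ := phase3_core A X PX QX σX μ x y σ κ σm δ γ hμ hx hy hyy hyy' hσm0 hσd hσ hσ1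
    hκσ hσmσ hδ0 hδs he hX' hr hk1 hkr hRIP hγ0 hg1 hg2 (fun t => (iter A X μ V₀ W₀ (t₂ + t)).1)
    (fun t => (iter A X μ V₀ W₀ (t₂ + t)).2) (fun t => rfl) (fun t => rfl) LX hLX LXp hLXp1 hLXp2
    Q2 hQ21 hQ22 Q2p hQ2p1 hQ2p2 hQQ P2 hP2a hP2b hb1 hb2 hb3 hb4 hb5 hb7
  refine ⟨t₂ + N, Nat.le_add_right _ _, ?_, ?_⟩
  · rw [Nat.add_sub_cancel_left]
    exact hN1
  · rw [hZt, hZt']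
    exact hN2


end Phase3Aux

/-- main lemma for Phase 3 (local convergence). -/
theorem statement19_phase3 :
    ∃ c1 c2 c3 c4 c5 c6 c7 C : ℝ,
      0 < c1 ∧ 0 < c2 ∧ 0 < c3 ∧ 0 < c4 ∧ 0 < c5 ∧ 0 < c6 ∧ 0 < c7 ∧ 0 < C ∧
    ∀
    (n₁ n₂ m k r : ℕ)
    (A : Fin m → Matrix (Fin n₁) (Fin n₂) ℝ) (X : Matrix (Fin n₁) (Fin n₂) ℝ)
    (PX : Matrix (Fin n₁) (Fin r) ℝ) (QX : Matrix (Fin n₂) (Fin r) ℝ) (σX : Fin r → ℝ)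
    (hPX : PXᵀ * PX = 1) (hQX : QXᵀ * QX = 1)
    (hσpos : ∀ i, 0 < σX i) (hσanti : Antitone σX)
    (hXsvd : X = PX * Matrix.diagonal σX * QXᵀ)
    (μ : ℝ) (hμ : 0 < μ)
    (V₀ : Matrix (Fin n₁) (Fin k) ℝ) (W₀ : Matrix (Fin n₂) (Fin k) ℝ)
    (Z Z' : ℕ → Matrix (Fin n₁ ⊕ Fin n₂) (Fin k) ℝ)
    (hZ : Z = Zit A X μ V₀ W₀) (hZ' : Z' = Ztil A X μ V₀ W₀)
    (LX : Matrix (Fin n₁ ⊕ Fin n₂) (Fin r) ℝ) (hLX : LX = Zstack PX QX)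
    (κ σm : ℝ) (hκ : κ = condNum X) (hσm : σm = sigmaPos X)
    (LXp : Matrix (Fin n₁ ⊕ Fin n₂) (Fin (n₁ + n₂ - r)) ℝ)
    (hLXp1 : LXpᵀ * LXp = 1) (hLXp2 : LXᵀ * LXp = 0)
    (δ : ℝ) (hδ0 : 0 < δ) (hδ : δ < c1 / (κ ^ 3 * Real.sqrt r))
    (hRIP : HasRIP A (2 * r + 1) δ)
    (hμbound : μ ≤ c2 / (κ ^ 4 * specNorm X))
    (t₂ : ℕ) (γ : ℝ) (hγ0 : 0 < γ)
    (hγ : γ ≤ c3 * min (Real.sqrt σm / κ ^ ((9 : ℝ) / 2))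
        (Real.sqrt (specNorm X) / (k : ℝ) ^ ((4 : ℝ) / 3)))
    (Q2 : Matrix (Fin k) (Fin r) ℝ) (hQ21 : Q2ᵀ * Q2 = 1)
    (hQ22 : LXᵀ * Z t₂ * Q2 * Q2ᵀ = LXᵀ * Z t₂)
    (Q2p : Matrix (Fin k) (Fin (k - r)) ℝ) (hQ2p1 : Q2pᵀ * Q2p = 1) (hQ2p2 : Q2ᵀ * Q2p = 0)
    (P2 : Matrix (Fin n₁ ⊕ Fin n₂) (Fin r) ℝ) (hP2 : IsOrthCol P2 (Z t₂ * Q2))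
    (hb1 : Real.sqrt (σm / 8) ≤ sigmaMin (LXᵀ * Z t₂))
    (hb2 : specNorm (Z t₂ * Q2p) ≤ γ)
    (hb3 : specNorm (LXpᵀ * P2) ≤ c4 / κ ^ 2)
    (hb4 : specNorm (Z t₂) ≤ 2 * Real.sqrt (specNorm X))
    (hb5 : specNorm ((Z' t₂)ᵀ * Z t₂ * Q2p) ≤ c4 * c5 * Real.sqrt (specNorm X) / κ ^ 3 * γ)
    (hb6 : specNorm ((Z' t₂)ᵀ * P2) ≤ c4 * c6 * Real.sqrt (specNorm X) / κ ^ 3)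
    (hb7 : specNorm ((Z' t₂)ᵀ * Z t₂)
      + 120000 * μ * Real.log (9 * Real.sqrt (specNorm X) / (200 * k * γ))
        * specNorm X ^ 3 / σm
      ≤ c7 / κ ^ 4 * specNorm X),
    ∃ t₃ : ℕ, t₂ ≤ t₃ ∧
      ((t₃ - t₂ : ℕ) : ℝ)
        ≤ 300 * Real.log (9 * Real.sqrt (specNorm X) / (200 * k * γ)) / (μ * σm) ∧
      specNorm (symMat X - Z t₃ * (Z t₃)ᵀ + Z' t₃ * (Z' t₃)ᵀ)
        ≤ C * k * γ * Real.sqrt (specNorm X) := by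
  exact phase3_aux

end AsymMatrixSensing
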